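/- Let K ⊆ ℝ^d be the limit set of an irreducible finite similarity IFS satisfying the open set condition, let s = dim_H(K) be its Hausdorff dimension, and let μ_K be the restriction to K of the s-dimensional Hausdorff measure (a finite nonzero measure under these hypotheses). Then μ_K(BA) = 0, i.e. μ_K-almost every point of K is not badly approximable. -/

import Mathlib

open MeasureTheory Filter Topology

noncomputable section

/-- `φ` is a contracting similarity of `ℝ^d`: for some ratio `c ∈ (0,1)`,
`dist (φ x) (φ y) = c * dist x y` for all `x, y`. -/
def ContractingSimilarity {d : ℕ} (φ : EuclideanSpace ℝ (Fin d) → EuclideanSpace ℝ (Fin d)) :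
    Prop :=
  ∃ c : ℝ, 0 < c ∧ c < 1 ∧ ∀ x y, dist (φ x) (φ y) = c * dist x y

/-- The IFS `φ` is irreducible: no nonempty proper affine subspace of `ℝ^d` is invariant
under all maps of the system. -/
def IrreducibleIFS {E : Type*} {d : ℕ}
    (φ : E → EuclideanSpace ℝ (Fin d) → EuclideanSpace ℝ (Fin d)) : Prop :=
  ¬ ∃ L : AffineSubspace ℝ (EuclideanSpace ℝ (Fin d)),
      (L : Set (EuclideanSpace ℝ (Fin d))).Nonempty ∧ L ≠ ⊤ ∧
        ∀ e, φ e '' (L : Set (EuclideanSpace ℝ (Fin d))) = (L : Set (EuclideanSpace ℝ (Fin d)))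

/-- The open set condition: there is a nonempty open set `U` such that the sets `φ e '' U`
are pairwise disjoint subsets of `U`. -/
def OpenSetCondition {E : Type*} {d : ℕ}
    (φ : E → EuclideanSpace ℝ (Fin d) → EuclideanSpace ℝ (Fin d)) : Prop :=
  ∃ U : Set (EuclideanSpace ℝ (Fin d)), IsOpen U ∧ U.Nonempty ∧
    (∀ e, φ e '' U ⊆ U) ∧ ∀ e e', e ≠ e' → Disjoint (φ e '' U) (φ e' '' U)

/-- `seqApply φ b n = φ_{b 0} ∘ φ_{b 1} ∘ ⋯ ∘ φ_{b (n-1)}`, i.e. `φ_{b_1} ∘ ⋯ ∘ φ_{b_n}`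
in 1-indexed notation. -/
def seqApply {E X : Type*} (φ : E → X → X) (b : ℕ → E) : ℕ → X → X
  | 0 => id
  | n + 1 => fun x => seqApply φ b n (φ (b n) x)

/-- The set of badly approximable vectors in `ℝ^d`: those `α` for which there is `c > 0`
with `‖qα - p‖ ≥ c q^{-1/d}` for every positive integer `q` and every `p ∈ ℤ^d`. -/
def badlyApproximable (d : ℕ) : Set (EuclideanSpace ℝ (Fin d)) :=
  {α | ∃ c : ℝ, 0 < c ∧ ∀ q : ℕ, 0 < q → ∀ p : Fin d → ℤ,
    c * (q : ℝ) ^ (-(1 : ℝ) / d) ≤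
      ‖(q : ℝ) • α - (EuclideanSpace.equiv (Fin d) ℝ).symm (fun i => (p i : ℝ))‖}

section

namespace DriftBA

set_option linter.unusedSectionVars false
set_option linter.unusedSimpArgs false
set_option linter.unusedVariables false
set_option linter.style.longLine false

open scoped CompactlySupported

/-! ### A Banach limit -/

/-- Cesaro averages. -/
def avg (φ : ℕ → ℝ) (n : ℕ) : ℝ := (∑ k ∈ Finset.range n, φ k) / n

/-- Bounded sequences. -/
def Bdd (φ : ℕ → ℝ) : Prop := ∃ C, ∀ k, |φ k| ≤ C

/-- Banach limit of a sequence. -/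
def BL (φ : ℕ → ℝ) : ℝ := limUnder (hyperfilter ℕ : Filter ℕ) (avg φ)

lemma abs_avg_le {φ : ℕ → ℝ} {C : ℝ} (h : ∀ k, |φ k| ≤ C) (n : ℕ) : |avg φ n| ≤ C := by
  have hC : 0 ≤ C := (abs_nonneg _).trans (h 0)
  rcases Nat.eq_zero_or_pos n with rfl | hn
  · simpa [avg] using hC
  · have hn' : (0 : ℝ) < n := by exact_mod_cast hn
    rw [avg, abs_div, abs_of_pos hn', div_le_iff₀ hn']
    calc |∑ k ∈ Finset.range n, φ k| ≤ ∑ k ∈ Finset.range n, |φ k| := Finset.abs_sum_le_sum_abs _ _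
      _ ≤ ∑ k ∈ Finset.range n, C := Finset.sum_le_sum fun k _ => h k
      _ = C * n := by simp [mul_comm]

lemma tendsto_BL {φ : ℕ → ℝ} (h : Bdd φ) :
    Tendsto (avg φ) (hyperfilter ℕ : Filter ℕ) (𝓝 (BL φ)) := by
  obtain ⟨C, hC⟩ := h
  have h1 : ∀ n, avg φ n ∈ Set.Icc (-C) C := fun n => abs_le.1 (abs_avg_le hC n)
  have h2 := (isCompact_Icc (a := -C) (b := C)).ultrafilter_le_nhds
    ((hyperfilter ℕ).map (avg φ)) (by
      simp only [Ultrafilter.coe_map, le_principal_iff]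
      exact Filter.mem_map.2 (Filter.Eventually.of_forall h1))
  obtain ⟨x, _, hx⟩ := h2
  exact tendsto_nhds_limUnder ⟨x, hx⟩

lemma BL_eq {φ : ℕ → ℝ} {l : ℝ}
    (h : Tendsto (avg φ) (hyperfilter ℕ : Filter ℕ) (𝓝 l)) : BL φ = l := h.limUnder_eq

lemma Bdd.add {φ ψ : ℕ → ℝ} (h : Bdd φ) (h' : Bdd ψ) : Bdd (fun k => φ k + ψ k) := by
  obtain ⟨C, hC⟩ := h
  obtain ⟨C', hC'⟩ := h'
  exact ⟨C + C', fun k => (abs_add_le _ _).trans (add_le_add (hC k) (hC' k))⟩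

lemma Bdd.const_mul {φ : ℕ → ℝ} (h : Bdd φ) (c : ℝ) : Bdd (fun k => c * φ k) := by
  obtain ⟨C, hC⟩ := h
  exact ⟨|c| * C, fun k => by rw [abs_mul]; exact mul_le_mul_of_nonneg_left (hC k) (abs_nonneg _)⟩

lemma Bdd.shift {φ : ℕ → ℝ} (h : Bdd φ) (m : ℕ) : Bdd (fun k => φ (k + m)) := by
  obtain ⟨C, hC⟩ := h
  exact ⟨C, fun k => hC _⟩

lemma BL_add {φ ψ : ℕ → ℝ} (h : Bdd φ) (h' : Bdd ψ) :
    BL (fun k => φ k + ψ k) = BL φ + BL ψ := by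
  apply BL_eq
  refine ((tendsto_BL h).add (tendsto_BL h')).congr fun n => ?_
  simp [avg, Finset.sum_add_distrib, add_div]

lemma BL_const_mul {φ : ℕ → ℝ} (h : Bdd φ) (c : ℝ) :
    BL (fun k => c * φ k) = c * BL φ := by
  apply BL_eq
  refine ((tendsto_BL h).const_mul c).congr fun n => ?_
  simp only [avg]
  rw [← Finset.mul_sum, mul_div_assoc]

lemma BL_mono {φ ψ : ℕ → ℝ} (h : Bdd φ) (h' : Bdd ψ) (hle : ∀ k, φ k ≤ ψ k) : BL φ ≤ BL ψ := by
  refine le_of_tendsto_of_tendsto' (tendsto_BL h) (tendsto_BL h') fun n => ?_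
  unfold avg
  gcongr with k _
  exact hle k

lemma BL_const (c : ℝ) : BL (fun _ => c) = c := by
  apply BL_eq
  refine Tendsto.congr' ?_ tendsto_const_nhds
  refine Filter.Eventually.filter_mono (Nat.hyperfilter_le_atTop) ?_
  filter_upwards [eventually_gt_atTop 0] with n hn
  have : (n : ℝ) ≠ 0 := by exact_mod_cast hn.ne'
  simp [avg]
  field_simp

lemma BL_succ {φ : ℕ → ℝ} (h : Bdd φ) : BL (fun k => φ (k + 1)) = BL φ := by
  apply BL_eq
  obtain ⟨C, hC⟩ := h
  have h0 : Tendsto (fun n : ℕ => (φ n - φ 0) / n) (hyperfilter ℕ : Filter ℕ) (𝓝 0) := by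
    refine Tendsto.mono_left ?_ Nat.hyperfilter_le_atTop
    refine squeeze_zero_norm (a := fun n : ℕ => (2 * C) / n) (fun n => ?_)
      (tendsto_const_div_atTop_nhds_zero_nat _)
    rw [norm_div, Real.norm_eq_abs, Real.norm_natCast]
    gcongr
    have := abs_sub (φ n) (φ 0)
    linarith [hC n, hC 0]
  have h1 := (tendsto_BL ⟨C, hC⟩).add h0
  rw [add_zero] at h1
  refine h1.congr fun n => ?_
  unfold avg
  rw [← add_div]
  congr 1
  have := Finset.sum_range_succ φ n
  rw [Finset.sum_range_succ' φ n] at this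
  linarith

lemma BL_shift {φ : ℕ → ℝ} (h : Bdd φ) (m : ℕ) : BL (fun k => φ (k + m)) = BL φ := by
  induction m with
  | zero => rfl
  | succ m ih =>
    rw [← ih, ← BL_succ (h.shift m)]
    congr 1
    ext k
    congr 1
    ring

lemma BL_sum {ι : Type*} (s : Finset ι) {φ : ι → ℕ → ℝ} (h : ∀ i ∈ s, Bdd (φ i)) :
    Bdd (fun k => ∑ i ∈ s, φ i k) ∧ BL (fun k => ∑ i ∈ s, φ i k) = ∑ i ∈ s, BL (φ i) := by
  classical
  induction s using Finset.induction_on with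
  | empty => exact ⟨⟨0, by simp⟩, by simpa using BL_const 0⟩
  | insert a s ha ih =>
    have ih' := ih fun i hi => h i (Finset.mem_insert_of_mem hi)
    have hb := h a (Finset.mem_insert_self a s)
    simp only [Finset.sum_insert ha]
    exact ⟨hb.add ih'.1, by rw [BL_add hb ih'.1, ih'.2]⟩

/-! ### Markov operator of a finite family of maps -/

/-- averaging operator -/
def Pop {I W : Type*} [Fintype I] (T : I → W → W) (f : W → ℝ) : W → ℝ :=
  fun w => (∑ i, f (T i w)) / Fintype.card I

section
variable {I W : Type*} [Fintype I] [Nonempty I] (T : I → W → W)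

lemma card_pos' : (0 : ℝ) < Fintype.card I := by exact_mod_cast Fintype.card_pos

lemma Pop_mono_on {S : Set W} (hS : ∀ i, ∀ w ∈ S, T i w ∈ S) {f g : W → ℝ}
    (h : ∀ w ∈ S, f w ≤ g w) : ∀ w ∈ S, Pop T f w ≤ Pop T g w := by
  intro w hw
  unfold Pop
  gcongr with i _
  exact h _ (hS i w hw)

lemma Pop_const (c : ℝ) : Pop T (fun _ => c) = fun _ => c := by
  ext w
  have := (card_pos' (I := I)).ne'
  simp [Pop]

lemma Pop_affine (f : W → ℝ) (a c : ℝ) : Pop T (fun w => a * f w + c) =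
    fun w => a * Pop T f w + c := by
  ext w
  have := (card_pos' (I := I)).ne'
  simp only [Pop, Finset.sum_add_distrib, ← Finset.mul_sum, Finset.sum_const, Finset.card_univ,
    nsmul_eq_mul]
  field_simp

lemma Pop_iter_bound {S : Set W} (hS : ∀ i, ∀ w ∈ S, T i w ∈ S) {f : W → ℝ} {a b : ℝ}
    (h : ∀ w ∈ S, f w ∈ Set.Icc a b) (k : ℕ) : ∀ w ∈ S, (Pop T)^[k] f w ∈ Set.Icc a b := by
  induction k with
  | zero => exact h
  | succ k ih =>
    intro w hw
    rw [Function.iterate_succ_apply']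
    have h1 := Pop_mono_on T hS (fun w hw => (ih w hw).1) w hw
    have h2 := Pop_mono_on T hS (fun w hw => (ih w hw).2) w hw
    rw [Pop_const] at h1 h2
    exact ⟨h1, h2⟩

/-- Drift (Margulis function) inequality iterated. -/
lemma Pop_iter_margulis {S : Set W} (hS : ∀ i, ∀ w ∈ S, T i w ∈ S) {f : W → ℝ} {a c : ℝ}
    (ha : 0 ≤ a) (ha1 : a < 1) (hc : 0 ≤ c)
    (hf : ∀ w ∈ S, 0 ≤ f w) (h : ∀ w ∈ S, Pop T f w ≤ a * f w + c) (k : ℕ) :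
    ∀ w ∈ S, (Pop T)^[k] f w ≤ f w + c / (1 - a) := by
  have key : ∀ k : ℕ, ∀ w ∈ S, (Pop T)^[k] f w ≤ a ^ k * f w + c * ∑ j ∈ Finset.range k, a ^ j := by
    intro k
    induction k with
    | zero => intro w _; simp
    | succ k ih =>
      intro w hw
      rw [Function.iterate_succ_apply']
      have h1 := Pop_mono_on T hS ih w hw
      rw [Pop_affine] at h1
      have h2 := mul_le_mul_of_nonneg_left (h w hw) (pow_nonneg ha k)
      rw [Finset.sum_range_succ, pow_succ]
      simp only at h1
      linarith
  intro w hw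
  refine (key k w hw).trans ?_
  have h1 : a ^ k * f w ≤ 1 * f w :=
    mul_le_mul_of_nonneg_right (pow_le_one₀ ha ha1.le) (hf w hw)
  have h2 : ∑ j ∈ Finset.range k, a ^ j ≤ 1 / (1 - a) := by
    rw [geom_sum_eq ha1.ne, ← neg_div_neg_eq, neg_sub, neg_sub]
    refine div_le_div_of_nonneg_right ?_ (by linarith)
    linarith [pow_nonneg ha k]
  have h3 := mul_le_mul_of_nonneg_left h2 hc
  rw [mul_one_div] at h3
  linarith

lemma Pop_iter_sum {ι : Type*} (s : Finset ι) (f : ι → W → ℝ) (k : ℕ) :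
    (Pop T)^[k] (fun w => ∑ i ∈ s, f i w) = fun w => ∑ i ∈ s, (Pop T)^[k] (f i) w := by
  induction k generalizing f with
  | zero => rfl
  | succ k ih =>
    simp only [Function.iterate_succ_apply]
    rw [← ih]
    congr 1
    ext w
    simp only [Pop]
    rw [Finset.sum_comm, Finset.sum_div]

/-- equivariance of iterates -/
lemma Pop_iter_comp {W' : Type*} (T' : I → W' → W') (F : W → W') (hF : ∀ i w, F (T i w) = T' i (F w))
    (f : W' → ℝ) (k : ℕ) (w : W) : (Pop T)^[k] (f ∘ F) w = (Pop T')^[k] f (F w) := by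
  induction k generalizing w with
  | zero => rfl
  | succ k ih =>
    rw [Function.iterate_succ_apply', Function.iterate_succ_apply']
    simp only [Pop, ih, hF]

lemma Pop_continuous [TopologicalSpace W] (hT : ∀ i, Continuous (T i)) {f : W → ℝ}
    (hf : Continuous f) : Continuous (Pop T f) := by
  unfold Pop
  exact (continuous_finsetSum _ fun i _ => hf.comp (hT i)).div_const _

/-- Existence of stationary measures attached to a starting point. -/
theorem exists_stationary [TopologicalSpace W] [CompactSpace W] [T2Space W]
    [MeasurableSpace W] [BorelSpace W]
    (w0 : W) :
    ∃ η : Measure W, IsProbabilityMeasure η ∧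
      ∀ f : W → ℝ, Continuous f → ∫ w, f w ∂η = BL (fun k => (Pop T)^[k] f w0) := by
  have hb : ∀ f : W → ℝ, Continuous f → Bdd (fun k => (Pop T)^[k] f w0) := by
    intro f hf
    obtain ⟨C, hC⟩ := isCompact_univ.exists_bound_of_continuousOn hf.continuousOn
    refine ⟨C, fun k => abs_le.2 ?_⟩
    exact Pop_iter_bound T (S := Set.univ) (fun _ _ _ => trivial)
      (fun w hw => abs_le.1 (hC w hw)) k w0 trivial
  have hlin : ∀ (f g : W → ℝ) (k : ℕ), (Pop T)^[k] (fun w => f w + g w) =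
      fun w => (Pop T)^[k] f w + (Pop T)^[k] g w := by
    intro f g k
    have := Pop_iter_sum T Finset.univ (fun b : Bool => if b then f else g) k
    simpa using this
  have hsmul : ∀ (c : ℝ) (f : W → ℝ) (k : ℕ), (Pop T)^[k] (fun w => c * f w) =
      fun w => c * (Pop T)^[k] f w := by
    intro c f k
    induction k with
    | zero => rfl
    | succ k ih =>
      rw [Function.iterate_succ_apply', ih, Function.iterate_succ_apply']
      simpa using Pop_affine T ((Pop T)^[k] f) c 0
  let L : C_c(W, ℝ) →ₗ[ℝ] ℝ :=
    { toFun := fun f => BL (fun k => (Pop T)^[k] f w0)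
      map_add' := by
        intro f g
        rw [← BL_add (hb f f.continuous) (hb g g.continuous)]
        congr 1
        ext k
        exact congrFun (hlin f g k) w0
      map_smul' := by
        intro c f
        rw [RingHom.id_apply, smul_eq_mul, ← BL_const_mul (hb f f.continuous)]
        congr 1
        ext k
        exact congrFun (hsmul c f k) w0 }
  let Λ : C_c(W, ℝ) →ₚ[ℝ] ℝ := PositiveLinearMap.mk₀ L (by
    intro f hf
    have : (0 : ℝ) = BL (fun _ => 0) := (BL_const 0).symm
    rw [this]
    refine BL_mono ⟨0, by simp⟩ (hb f f.continuous) fun k => ?_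
    obtain ⟨C, hC⟩ := isCompact_univ.exists_bound_of_continuousOn f.continuous.continuousOn
    exact (Pop_iter_bound T (S := Set.univ) (a := 0) (b := C) (fun _ _ _ => trivial)
      (fun w hw => ⟨hf w, (abs_le.1 (hC w hw)).2⟩) k w0 trivial).1)
  have key : ∀ f : W → ℝ, Continuous f →
      ∫ w, f w ∂(RealRMK.rieszMeasure Λ) = BL (fun k => (Pop T)^[k] f w0) := by
    intro f hf
    let F : C_c(W, ℝ) := ⟨⟨f, hf⟩, HasCompactSupport.of_compactSpace _⟩
    exact RealRMK.integral_rieszMeasure Λ F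
  refine ⟨RealRMK.rieszMeasure Λ, ?_, key⟩
  have h1 := key (fun _ => 1) continuous_const
  have h2 : ∀ k, (Pop T)^[k] (fun _ => (1 : ℝ)) = fun _ => 1 := by
    intro k
    induction k with
    | zero => rfl
    | succ k ih => rw [Function.iterate_succ_apply', ih, Pop_const]
  simp only [h2, BL_const, integral_const, smul_eq_mul, mul_one] at h1
  constructor
  rw [Measure.real, ENNReal.toReal_eq_one_iff] at h1
  exact h1

/-- Stationarity on bounded continuous functions implies stationarity on measurable functions. -/
theorem stationary_measurable [TopologicalSpace W] [CompactSpace W] [T2Space W]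
    [MeasurableSpace W] [BorelSpace W] [HasOuterApproxClosed W]
    (hT : ∀ i, Continuous (T i)) (η : Measure W) [IsProbabilityMeasure η] (w0 : W)
    (hη : ∀ f : W → ℝ, Continuous f → ∫ w, f w ∂η = BL (fun k => (Pop T)^[k] f w0)) :
    ∑ i, η.map (T i) = (Fintype.card I : ENNReal) • η := by
  have hfin : IsFiniteMeasure ((Fintype.card I : ENNReal) • η) :=
    Measure.smul_finite η (ENNReal.natCast_ne_top _)
  have : ∀ i, IsFiniteMeasure (η.map (T i)) := fun i => inferInstance
  refine ext_of_forall_integral_eq_of_IsFiniteMeasure fun f => ?_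
  have hfc : Continuous f := f.continuous
  have hInt : ∀ i, Integrable f (η.map (T i)) := fun i => f.integrable _
  rw [integral_finsetSum_measure (fun i _ => hInt i), integral_smul_measure]
  have h1 : ∀ i, ∫ w, f w ∂(η.map (T i)) = ∫ w, f (T i w) ∂η := fun i =>
    integral_map (hT i).measurable.aemeasurable hfc.aestronglyMeasurable
  simp only [h1]
  have hb : Bdd (fun k => (Pop T)^[k] f w0) := by
    obtain ⟨C, hC⟩ := isCompact_univ.exists_bound_of_continuousOn hfc.continuousOn
    refine ⟨C, fun k => abs_le.2 ?_⟩
    exact Pop_iter_bound T (S := Set.univ) (fun _ _ _ => trivial)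
      (fun w hw => abs_le.1 (hC w hw)) k w0 trivial
  have h2 : ∫ w, Pop T f w ∂η = ∫ w, f w ∂η := by
    rw [hη _ (Pop_continuous T hT hfc), hη _ hfc, ← BL_succ hb]
    rfl
  rw [← h2]
  unfold Pop
  rw [integral_div, integral_finsetSum]
  · have := (card_pos' (I := I)).ne'
    simp
    field_simp
  · intro i _
    have := (hInt i)
    exact (f.integrable _ : Integrable f (η.map (T i))).comp_measurable (hT i).measurable

end

end DriftBA

end

section

namespace DriftBA

set_option linter.unusedSectionVars false
set_option linter.unusedSimpArgs false
set_option linter.unusedVariables false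

section
variable {I Z : Type*} [Fintype I] [Nonempty I] (T : I → Z → Z)

/-- action of words: the head of the list is applied last -/
def actw : List I → Z → Z
  | [], z => z
  | i :: l, z => T i (actw l z)

lemma actw_append (l l' : List I) (z : Z) : actw T (l ++ l') z = actw T l (actw T l' z) := by
  induction l with
  | nil => rfl
  | cons i l ih => simp [actw, ih]

lemma sum_words (K : ℕ) (f : Z → ℝ) (z : Z) :
    ∑ α : Fin K → I, f (actw T (List.ofFn α) z) =
      (Fintype.card I : ℝ) ^ K * (Pop T)^[K] f z := by
  induction K generalizing f with
  | zero => simp [actw]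
  | succ K ih =>
    rw [← (Fin.consEquiv (fun _ => I)).sum_comp, Fintype.sum_prod_type, Finset.sum_comm]
    have hc := (card_pos' (I := I)).ne'
    have h1 : ∀ α : Fin K → I, ∑ i : I, f (actw T (List.ofFn
        ((Fin.consEquiv (fun _ => I)) (i, α))) z) =
        Fintype.card I * Pop T f (actw T (List.ofFn α) z) := by
      intro α
      simp only [Fin.consEquiv, Equiv.coe_fn_mk, List.ofFn_cons, actw, Pop]
      field_simp
    simp only [h1]
    rw [← Finset.mul_sum, ih, Function.iterate_succ_apply]
    ring

/-- If all words of length `k` send `z` into the set, the iterated average of the indicator is 1. -/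
lemma Pop_iter_indicator_one (E : Set Z) (k : ℕ) (z : Z)
    (h : ∀ l : List I, l.length = k → actw T l z ∈ E) :
    (Pop T)^[k] (E.indicator 1) z = 1 := by
  induction k generalizing z with
  | zero =>
    have := h [] rfl
    simp only [actw] at this
    simp [this]
  | succ k ih =>
    rw [Function.iterate_succ_apply']
    have hc := (card_pos' (I := I)).ne'
    unfold Pop
    rw [Finset.sum_congr rfl (g := fun _ => (1 : ℝ))]
    · simp
    · intro i _
      apply ih
      intro l hl
      have := h (l ++ [i]) (by simp [hl])
      rw [actw_append] at this
      exact this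

lemma Pop_iter_indicator_ge (E : Set Z) (k : ℕ) (z : Z) (good : Finset I) (c : ℝ)
    (hgood : c * Fintype.card I ≤ good.card)
    (h : ∀ i ∈ good, ∀ l : List I, l.length = k → actw T (l ++ [i]) z ∈ E) :
    c ≤ (Pop T)^[k + 1] (E.indicator 1) z := by
  have hc := (card_pos' (I := I))
  rw [Function.iterate_succ_apply']
  unfold Pop
  rw [le_div_iff₀ hc]
  refine hgood.trans ?_
  have h0 : ∀ z, 0 ≤ (Pop T)^[k] (E.indicator 1) z := fun z =>
    (Pop_iter_bound T (S := Set.univ) (a := 0) (b := 1) (fun _ _ _ => trivial) (fun w _ =>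
      ⟨Set.indicator_nonneg (fun _ _ => by simp) _, Set.indicator_le_self' (by simp) w⟩) k z trivial).1
  calc (good.card : ℝ) = ∑ i ∈ good, (1 : ℝ) := by simp
    _ ≤ ∑ i ∈ good, (Pop T)^[k] (E.indicator 1) (T i z) := by
        refine Finset.sum_le_sum fun i hi => ?_
        rw [Pop_iter_indicator_one]
        intro l hl
        have := h i hi l hl
        rw [actw_append] at this
        exact this
    _ ≤ _ := Finset.sum_le_sum_of_subset_of_nonneg (Finset.subset_univ _) fun i _ _ => h0 _

/-- diagonal system on tuples -/
def diagT (A : Type*) (i : I) (w : A → Z) : A → Z := fun α => T i (w α)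

variable [TopologicalSpace Z] [CompactSpace Z] [T2Space Z] [MeasurableSpace Z] [BorelSpace Z]

lemma bdd_Pop_iter {f : Z → ℝ} (hf : Continuous f) (z0 : Z) :
    Bdd (fun k => (Pop T)^[k] f z0) := by
  obtain ⟨C, hC⟩ := isCompact_univ.exists_bound_of_continuousOn hf.continuousOn
  refine ⟨C, fun k => abs_le.2 ?_⟩
  exact Pop_iter_bound T (S := Set.univ) (fun _ _ _ => trivial)
    (fun w hw => abs_le.1 (hC w hw)) k z0 trivial

theorem tuple_marginal [HasOuterApproxClosed Z] [SecondCountableTopology Z]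
    (hT : ∀ i, Continuous (T i)) (z0 : Z) (m : Measure Z) [IsProbabilityMeasure m]
    (hm : ∀ f : Z → ℝ, Continuous f → ∫ w, f w ∂m = BL (fun k => (Pop T)^[k] f z0))
    (K : ℕ) (η : Measure ((Fin K → I) → Z)) [IsProbabilityMeasure η]
    (hη : ∀ f : ((Fin K → I) → Z) → ℝ, Continuous f → ∫ w, f w ∂η =
      BL (fun k => (Pop (diagT T (Fin K → I)))^[k] f (fun α => actw T (List.ofFn α) z0))) :
    ∑ α : Fin K → I, η.map (fun w => w α) = ((Fintype.card I : ENNReal) ^ K) • m := by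
  have hfin : IsFiniteMeasure (((Fintype.card I : ENNReal) ^ K) • m) :=
    Measure.smul_finite m (by simp)
  have : ∀ α : Fin K → I, IsFiniteMeasure (η.map (fun w => w α)) := fun i => inferInstance
  refine ext_of_forall_integral_eq_of_IsFiniteMeasure fun f => ?_
  have hfc : Continuous f := f.continuous
  have hInt : ∀ α : Fin K → I, Integrable f (η.map (fun w => w α)) := fun i => f.integrable _
  rw [integral_finsetSum_measure (fun i _ => hInt i), integral_smul_measure]
  have h1 : ∀ α : Fin K → I, ∫ w, f w ∂(η.map (fun w => w α)) =
      BL (fun k => (Pop T)^[k] f (actw T (List.ofFn α) z0)) := fun α => by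
    rw [integral_map (measurable_pi_apply α).aemeasurable hfc.aestronglyMeasurable,
      hη (fun w => f (w α)) (hfc.comp (continuous_apply α))]
    congr 1
    ext k
    exact Pop_iter_comp (diagT T (Fin K → I)) T (fun w => w α) (fun _ _ => rfl) f k _
  simp only [h1]
  rw [← (BL_sum Finset.univ (fun α _ => bdd_Pop_iter T hfc _)).2, hm _ hfc]
  have h2 : ∀ k, ∑ α : Fin K → I, (Pop T)^[k] f (actw T (List.ofFn α) z0) =
      (Fintype.card I : ℝ) ^ K * (Pop T)^[k + K] f z0 := by
    intro k
    rw [sum_words, ← Function.iterate_add_apply, add_comm]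
  simp only [h2]
  rw [BL_const_mul ((bdd_Pop_iter T hfc z0).shift K), BL_shift (bdd_Pop_iter T hfc z0)]
  simp

/-! ### Doob type maximal inequality -/

/-- stationarity of a measure -/
def Stat (m : Measure Z) : Prop := ∑ i, m.map (T i) = (Fintype.card I : ENNReal) • m

lemma Stat.integral (hT : ∀ i, Continuous (T i)) {m : Measure Z} [IsProbabilityMeasure m]
    (hm : Stat T m) {f : Z → ℝ} (hf : Measurable f) {C : ℝ} (hC : ∀ z, |f z| ≤ C) :
    ∫ z, Pop T f z ∂m = ∫ z, f z ∂m := by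
  have hInt : ∀ (ν : Measure Z) [IsFiniteMeasure ν], Integrable f ν := fun ν _ =>
    Integrable.of_bound hf.aestronglyMeasurable C (Eventually.of_forall fun z => hC z)
  have h1 : ∀ i, ∫ w, f w ∂(m.map (T i)) = ∫ w, f (T i w) ∂m := fun i =>
    integral_map (hT i).measurable.aemeasurable hf.aestronglyMeasurable
  have h2 : ∫ z, f z ∂(∑ i, m.map (T i)) = ∑ i, ∫ w, f (T i w) ∂m := by
    rw [integral_finsetSum_measure (fun i _ => hInt _)]
    simp only [h1]
  rw [hm, integral_smul_measure] at h2
  unfold Pop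
  rw [integral_div, integral_finsetSum]
  · rw [← h2]
    have := (card_pos' (I := I)).ne'
    simp
  · intro i _
    exact (hInt (m.map (T i))).comp_measurable (hT i).measurable

lemma Pop_measurable (hT : ∀ i, Continuous (T i)) {f : Z → ℝ} (hf : Measurable f) :
    Measurable (Pop T f) := by
  unfold Pop
  exact (Finset.measurable_sum _ fun i _ => hf.comp (hT i).measurable).div_const _

lemma Pop_iter_measurable (hT : ∀ i, Continuous (T i)) {f : Z → ℝ} (hf : Measurable f) (k : ℕ) :
    Measurable ((Pop T)^[k] f) := by
  induction k with
  | zero => exact hf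
  | succ k ih => rw [Function.iterate_succ_apply']; exact Pop_measurable T hT ih

lemma Stat.integral_iter (hT : ∀ i, Continuous (T i)) {m : Measure Z} [IsProbabilityMeasure m]
    (hm : Stat T m) {f : Z → ℝ} (hf : Measurable f) {C : ℝ} (hC : ∀ z, |f z| ≤ C) (k : ℕ) :
    ∫ z, (Pop T)^[k] f z ∂m = ∫ z, f z ∂m := by
  induction k with
  | zero => rfl
  | succ k ih =>
    rw [← ih, Function.iterate_succ_apply']
    refine hm.integral T hT (Pop_iter_measurable T hT hf k) (C := C) fun z => ?_
    exact abs_le.2 (Pop_iter_bound T (S := Set.univ) (fun _ _ _ => trivial)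
      (fun w _ => abs_le.1 (hC w)) k z trivial)

lemma Pop_iter_mul_comp (σ : Z → Z) (hσ : ∀ i z, σ (T i z) = z) (f g : Z → ℝ) (k : ℕ) :
    (Pop T)^[k] (fun z => f z * g (σ^[k] z)) = fun z => (Pop T)^[k] f z * g z := by
  induction k generalizing f g with
  | zero => rfl
  | succ k ih =>
    rw [Function.iterate_succ_apply']
    have h1 : (fun z => f z * g (σ^[k+1] z)) = fun z => f z * (g ∘ σ) (σ^[k] z) := by
      ext z
      rw [Function.iterate_succ_apply']
      rfl
    rw [h1, ih, Function.iterate_succ_apply']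
    ext z
    simp only [Pop, Function.comp, hσ]
    rw [← Finset.sum_mul]
    ring

theorem doob (hT : ∀ i, Continuous (T i)) (σ : Z → Z) (hσm : Measurable σ)
    (hσ : ∀ i z, σ (T i z) = z) {m : Measure Z} [IsProbabilityMeasure m]
    (hm : Stat T m) {E : Set Z} (hE : MeasurableSet E) (a : ℝ) (ha : 0 ≤ a) :
    MeasurableSet {z | ∃ k, a ≤ (Pop T)^[k] (E.indicator 1) (σ^[k] z)} ∧
    ENNReal.ofReal a * m {z | ∃ k, a ≤ (Pop T)^[k] (E.indicator 1) (σ^[k] z)} ≤ m E := by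
  set H : ℕ → Set Z := fun k => {z | a ≤ (Pop T)^[k] (E.indicator 1) z} with hH
  have hEm : Measurable (E.indicator (1 : Z → ℝ)) := measurable_one.indicator hE
  have hEb : ∀ z, |E.indicator (1 : Z → ℝ) z| ≤ 1 := by
    intro z
    by_cases h : z ∈ E <;> simp [h]
  have hHm : ∀ k, MeasurableSet (H k) := fun k =>
    measurableSet_le measurable_const (Pop_iter_measurable T hT hEm k)
  have hσk : ∀ k, Measurable (σ^[k]) := fun k => hσm.iterate k
  -- level sets
  set F : ℕ → Set Z := fun k => σ^[k] ⁻¹' (H k) with hF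
  have hFm : ∀ k, MeasurableSet (F k) := fun k => hσk k (hHm k)
  have hset : {z | ∃ k, a ≤ (Pop T)^[k] (E.indicator 1) (σ^[k] z)} = ⋃ k, F k := by
    ext z; simp [hF, hH]
  rw [hset]
  refine ⟨MeasurableSet.iUnion hFm, ?_⟩
  -- key identity
  have key : ∀ k, ∀ S : Set Z, MeasurableSet S → S ⊆ H k →
      ENNReal.ofReal a * m (σ^[k] ⁻¹' S) ≤ m (E ∩ σ^[k] ⁻¹' S) := by
    intro k S hS hSH
    have hSm : Measurable (S.indicator (1 : Z → ℝ)) := measurable_one.indicator hS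
    have hσinv : m.real (σ^[k] ⁻¹' S) = m.real S := by
      have e1 := hm.integral_iter T hT (f := fun z => 1 * (S.indicator (1 : Z → ℝ)) (σ^[k] z)) (by
        simp only [one_mul]; exact hSm.comp (hσk k)) (C := 1) (by
          intro z; by_cases h : σ^[k] z ∈ S <;> simp [h]) k
      rw [Pop_iter_mul_comp T σ hσ (fun _ => 1)] at e1
      have e2 : (Pop T)^[k] (fun _ => (1:ℝ)) = fun _ => 1 := by
        clear e1
        induction k with
        | zero => rfl
        | succ k ih => 
          rw [Function.iterate_succ_apply', (show (Pop T)^[k] (fun _ => (1:ℝ)) = fun _ => 1 from ?_), Pop_const]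
          have := Pop_iter_bound T (S := Set.univ) (f := fun _ => (1:ℝ)) (a := 1) (b := 1) (fun _ _ _ => trivial)
            (fun w _ => by simp) k
          ext z
          exact le_antisymm (this z trivial).2 (this z trivial).1
      rw [e2] at e1
      simp only [one_mul] at e1
      have e3 : (fun z => S.indicator (1 : Z → ℝ) (σ^[k] z)) = (σ^[k] ⁻¹' S).indicator 1 := by
        ext z; rfl
      rw [e3, integral_indicator_one hS, integral_indicator_one (hσk k hS)] at e1
      exact e1.symm
    have e1 := hm.integral_iter T hT (f := fun z => E.indicator (1 : Z → ℝ) z * (S.indicator (1 : Z → ℝ)) (σ^[k] z)) (by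
        exact hEm.mul (hSm.comp (hσk k))) (C := 1) (by
          intro z; by_cases h : σ^[k] z ∈ S <;> by_cases h' : z ∈ E <;> simp [h, h']) k
    rw [Pop_iter_mul_comp T σ hσ] at e1
    have e3 : (fun z => E.indicator (1 : Z → ℝ) z * S.indicator (1 : Z → ℝ) (σ^[k] z)) =
        (E ∩ σ^[k] ⁻¹' S).indicator 1 := by
      ext z; by_cases h : σ^[k] z ∈ S <;> by_cases h' : z ∈ E <;> simp [h, h']
    rw [e3, integral_indicator_one (hE.inter (hσk k hS))] at e1
    have e4 : a * m.real S ≤ ∫ z, (Pop T)^[k] (E.indicator 1) z * S.indicator (1 : Z → ℝ) z ∂m := by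
      rw [← integral_indicator_one hS, ← integral_const_mul]
      refine integral_mono ?_ ?_ ?_
      · exact ((integrable_const (1:ℝ)).indicator hS).const_mul a
      · refine Integrable.of_bound ((Pop_iter_measurable T hT hEm k).mul hSm).aestronglyMeasurable 1
          (Eventually.of_forall fun z => ?_)
        have h1 := abs_le.2 (Pop_iter_bound T (S := Set.univ) (fun _ _ _ => trivial)
          (fun w _ => abs_le.1 (hEb w)) k z trivial)
        by_cases h : z ∈ S
        · simpa [h] using h1
        · simp [h]
      · intro z
        by_cases h : z ∈ S
        · have h2 : a ≤ (Pop T)^[k] (E.indicator 1) z := hSH h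
          simpa [h] using h2
        · simp [h]
    rw [e1, ← hσinv] at e4
    rw [← ofReal_measureReal (μ := m) (s := σ^[k] ⁻¹' S), ← ENNReal.ofReal_mul ha,
      ← ofReal_measureReal (μ := m) (s := E ∩ σ^[k] ⁻¹' S)]
    exact ENNReal.ofReal_le_ofReal e4
  -- finite unions
  have hfin : ∀ n, ENNReal.ofReal a * m (⋃ k ∈ Finset.range n, F k) ≤ m E := by
    intro n
    set S : ℕ → Set Z := fun k => H k \ ⋃ j ∈ Finset.Ioo k n, σ^[j - k] ⁻¹' (H j) with hS
    have hSm : ∀ k, MeasurableSet (S k) := fun k => (hHm k).diff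
      (Finset.measurableSet_biUnion _ fun j _ => hσk _ (hHm j))
    have hmem : ∀ k z, z ∈ σ^[k] ⁻¹' S k ↔ z ∈ F k ∧ ∀ j, k < j → j < n → z ∉ F j := by
      intro k z
      simp only [hS, Set.mem_preimage, Set.mem_sdiff, hF, Set.mem_iUnion, Finset.mem_Ioo, not_exists]
      refine and_congr Iff.rfl ?_
      constructor
      · intro h j hj hjn hz
        refine h j ⟨hj, hjn⟩ ?_
        rw [← Function.iterate_add_apply, Nat.sub_add_cancel hj.le]
        exact hz
      · intro h j hj hz
        refine h j hj.1 hj.2 ?_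
        rw [← Function.iterate_add_apply, Nat.sub_add_cancel hj.1.le] at hz
        exact hz
    have hdisj : (Finset.range n : Set ℕ).PairwiseDisjoint (fun k => σ^[k] ⁻¹' S k) := by
      intro k hk j hj hkj
      rw [Function.onFun, Set.disjoint_left]
      intro z hz hz'
      rw [hmem] at hz hz'
      rcases lt_or_gt_of_ne hkj with h | h
      · exact hz.2 j h (by simpa using hj) hz'.1
      · exact hz'.2 k h (by simpa using hk) hz.1
    have hcov : (⋃ k ∈ Finset.range n, F k) ⊆ ⋃ k ∈ Finset.range n, σ^[k] ⁻¹' S k := by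
      intro z hz
      simp only [Set.mem_iUnion, Finset.mem_range, exists_prop] at hz
      classical
      have hne : ((Finset.range n).filter (fun k => z ∈ F k)).Nonempty := by
        obtain ⟨k, hk, hzk⟩ := hz
        exact ⟨k, by simp [hk, hzk]⟩
      have hmax := Finset.max'_mem _ hne
      set k := Finset.max' _ hne with hkdef
      rw [Finset.mem_filter] at hmax
      simp only [Set.mem_iUnion, exists_prop]
      refine ⟨k, hmax.1, (hmem k z).2 ⟨hmax.2, fun j hj hjn hzj => ?_⟩⟩
      have := Finset.le_max' ((Finset.range n).filter (fun k => z ∈ F k)) j (by simp [hjn, hzj])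
      omega
    calc ENNReal.ofReal a * m (⋃ k ∈ Finset.range n, F k)
        ≤ ENNReal.ofReal a * m (⋃ k ∈ Finset.range n, σ^[k] ⁻¹' S k) := by gcongr
      _ = ∑ k ∈ Finset.range n, ENNReal.ofReal a * m (σ^[k] ⁻¹' S k) := by
          rw [measure_biUnion_finset hdisj (fun k _ => hσk k (hSm k)), Finset.mul_sum]
      _ ≤ ∑ k ∈ Finset.range n, m (E ∩ σ^[k] ⁻¹' S k) :=
          Finset.sum_le_sum fun k _ => key k (S k) (hSm k) Set.sdiff_subset
      _ = m (⋃ k ∈ Finset.range n, E ∩ σ^[k] ⁻¹' S k) := by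
          rw [measure_biUnion_finset]
          · exact hdisj.mono fun k => Set.inter_subset_right
          · exact fun k _ => hE.inter (hσk k (hSm k))
      _ ≤ m E := measure_mono (by simp)
  have hmono : Monotone (fun n => ⋃ k ∈ Finset.range n, F k) := by
    intro n n' hn
    exact Set.biUnion_subset_biUnion_left (by
      intro k hk
      have : k < n := by simpa using hk
      simpa using this.trans_le hn)
  have hU : (⋃ k, F k) = ⋃ n, ⋃ k ∈ Finset.range n, F k := by
    ext z
    simp only [Set.mem_iUnion, Finset.mem_range, exists_prop]
    constructor
    · rintro ⟨k, hk⟩; exact ⟨k + 1, k, by omega, hk⟩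
    · rintro ⟨_, k, _, hk⟩; exact ⟨k, hk⟩
  rw [hU, hmono.measure_iUnion, ENNReal.mul_iSup]
  exact iSup_le hfin

end

end DriftBA

end

section

namespace DriftBA

set_option linter.unusedSectionVars false
set_option linter.unusedSimpArgs false
set_option linter.unusedVariables false

/-- The abstract dynamical system. -/
structure Sys (I G X V : Type*) [Fintype I] [Group G] [TopologicalSpace G] [TopologicalSpace X]
    [MulAction G X] [NormedAddCommGroup V] [NormedSpace ℝ V] where
  h : I → G
  u : V → G
  N : G → ℝ
  Y : Set X
  lam : ℝ
  rot : I → V ≃ₗᵢ[ℝ] V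
  one_lt_lam : 1 < lam
  u_cont : Continuous u
  u_add : ∀ s t, u (s + t) = u s * u t
  h_u : ∀ i t, h i * u t * (h i)⁻¹ = u (lam • rot i t)
  N_cont : Continuous N
  N_eq_zero : ∀ g, N g = 0 ↔ g = 1
  N_nonneg : ∀ g, 0 ≤ N g
  N_compact : ∀ r, IsCompact {g | N g ≤ r}
  N_u : ∃ C, ∀ t, ‖t‖ ≤ C * N (u t)
  Y_compact : IsCompact Y
  Y_inv : ∀ i, ∀ x ∈ Y, h i • x ∈ Y
  inj : ∃ r, 0 < r ∧ ∀ x ∈ Y, ∀ g g', N g < r → N g' < r → g • x = g' • x → g = g'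
  locTrans : ∀ r, 0 < r → ∀ x : X, ∃ C : Set X, IsOpen C ∧ x ∈ C ∧
    ∀ y ∈ C, ∀ y' ∈ C, ∃ g, N g < r ∧ g • y = y'
  conj_bound : ∃ C, 1 ≤ C ∧ ∀ i g, N (h i * g * (h i)⁻¹) ≤ C * N g ∧
    N ((h i)⁻¹ * g * h i) ≤ C * N g
  expand : ∃ A r, 1 < A ∧ 0 < r ∧ ∀ g, N g < r →
    (∃ good : Finset I, (3 / 4 : ℝ) * Fintype.card I ≤ good.card ∧
      ∀ i ∈ good, A * N g ≤ N (h i * g * (h i)⁻¹)) ∧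
    ∀ i, N g ≤ A ^ 2 * N (h i * g * (h i)⁻¹)

namespace Sys

variable {I G X V : Type*} [Fintype I] [Nonempty I] [TopologicalSpace I] [DiscreteTopology I]
  [Group G] [TopologicalSpace G] [IsTopologicalGroup G]
  [TopologicalSpace X] [T2Space X] [TopologicalSpace.MetrizableSpace X]
  [MulAction G X] [ContinuousSMul G X] [NormedAddCommGroup V] [NormedSpace ℝ V]
  [FiniteDimensional ℝ V]
  (S : Sys I G X V)

/-- product along a word -/
def Hw (l : List I) : G := (l.map S.h).prod

@[simp] lemma Hw_nil : S.Hw [] = 1 := rfl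
@[simp] lemma Hw_cons (i : I) (l : List I) : S.Hw (i :: l) = S.h i * S.Hw l := by simp [Hw]
lemma Hw_append (l l' : List I) : S.Hw (l ++ l') = S.Hw l * S.Hw l' := by simp [Hw]

lemma u_zero : S.u 0 = 1 := by
  have := S.u_add 0 0
  simpa using this

lemma u_neg (t : V) : S.u (-t) = (S.u t)⁻¹ := by
  rw [eq_inv_iff_mul_eq_one, ← S.u_add]
  simp [S.u_zero]

/-- prepend a letter -/
def consS (i : I) (b : ℕ → I) : ℕ → I
  | 0 => i
  | n + 1 => b n

lemma consS_zero (i : I) (b : ℕ → I) : consS i b 0 = i := rfl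
lemma consS_succ (i : I) (b : ℕ → I) (n : ℕ) : consS i b (n + 1) = b n := rfl

lemma continuous_consS (i : I) : Continuous (consS i) := by
  refine continuous_pi fun n => ?_
  cases n with
  | zero => exact continuous_const
  | succ n => exact continuous_apply n

/-- forward maps -/
def T0 (i : I) (z : (ℕ → I) × X) : (ℕ → I) × X := (consS i z.1, S.h i • z.2)

/-- backward map -/
def sg0 (z : (ℕ → I) × X) : (ℕ → I) × X := (fun n => z.1 (n + 1), (S.h (z.1 0))⁻¹ • z.2)

lemma sg0_T0 (i : I) (z : (ℕ → I) × X) : S.sg0 (S.T0 i z) = z := by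
  simp [sg0, T0, consS]

lemma T0_sg0 (z : (ℕ → I) × X) : S.T0 (z.1 0) (S.sg0 z) = z := by
  refine Prod.ext ?_ ?_
  · ext n
    cases n <;> simp [T0, sg0, consS]
  · simp [T0, sg0]

lemma continuous_T0 (i : I) : Continuous (S.T0 i) :=
  ((continuous_consS i).comp continuous_fst).prodMk (continuous_snd.const_smul _)

lemma continuous_sg0 : Continuous S.sg0 := by
  refine Continuous.prodMk (continuous_pi fun n => (continuous_apply _).comp continuous_fst) ?_
  refine Continuous.smul ?_ continuous_snd
  have : Continuous (fun i : I => (S.h i)⁻¹) := continuous_of_discreteTopology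
  exact this.comp ((continuous_apply 0).comp continuous_fst)

/-- the natural extension -/
def Om : Set ((ℕ → I) × X) := {z | ∀ k, (S.sg0^[k] z).2 ∈ S.Y}

lemma Om_snd {z : (ℕ → I) × X} (hz : z ∈ S.Om) : z.2 ∈ S.Y := hz 0

lemma sg0_Om {z : (ℕ → I) × X} (hz : z ∈ S.Om) : S.sg0 z ∈ S.Om := fun k => by
  rw [← Function.iterate_succ_apply]
  exact hz (k + 1)

lemma T0_Om (i : I) {z : (ℕ → I) × X} (hz : z ∈ S.Om) : S.T0 i z ∈ S.Om := fun k => by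
  cases k with
  | zero => exact S.Y_inv i _ (hz 0)
  | succ k =>
    rw [Function.iterate_succ_apply, sg0_T0]
    exact hz k

lemma isClosed_Om : IsClosed S.Om := by
  have : S.Om = ⋂ k, (fun z => (S.sg0^[k] z).2) ⁻¹' S.Y := by
    ext z; simp [Om]
  rw [this]
  exact isClosed_iInter fun k => S.Y_compact.isClosed.preimage
    (continuous_snd.comp (S.continuous_sg0.iterate k))

lemma isCompact_Om : IsCompact S.Om :=
  (isCompact_univ.prod S.Y_compact).of_isClosed_subset S.isClosed_Om
    fun z hz => ⟨trivial, S.Om_snd hz⟩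

/-- nonemptiness of the natural extension -/
lemma Om_nonempty (hY : S.Y.Nonempty) : S.Om.Nonempty := by
  -- points with first `k` backward iterates in `Y`
  set F : ℕ → Set ((ℕ → I) × X) := fun k => {z | ∀ j ≤ k, (S.sg0^[j] z).2 ∈ S.Y} with hF
  have hcl : ∀ k, IsClosed (F k) := fun k => by
    have : F k = ⋂ j ≤ k, (fun z => (S.sg0^[j] z).2) ⁻¹' S.Y := by
      ext z; simp [hF]
    rw [this]
    exact isClosed_biInter fun k _ => S.Y_compact.isClosed.preimage
      (continuous_snd.comp (S.continuous_sg0.iterate k))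
  have hne : ∀ k, (F k).Nonempty := by
    intro k
    induction k with
    | zero =>
      obtain ⟨y, hy⟩ := hY
      refine ⟨(fun _ => Classical.arbitrary I, y), fun j hj => ?_⟩
      obtain rfl : j = 0 := by omega
      exact hy
    | succ k ih =>
      obtain ⟨z, hz⟩ := ih
      refine ⟨S.T0 (Classical.arbitrary I) z, fun j hj => ?_⟩
      cases j with
      | zero => exact S.Y_inv _ _ (hz 0 (by omega))
      | succ j =>
        rw [Function.iterate_succ_apply, sg0_T0]
        exact hz j (by omega)
  have hF0 : IsCompact (F 0) := (isCompact_univ.prod S.Y_compact).of_isClosed_subset (hcl 0)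
    fun z hz => ⟨trivial, hz 0 le_rfl⟩
  obtain ⟨z, hz⟩ := IsCompact.nonempty_iInter_of_sequence_nonempty_isCompact_isClosed F
    (fun k z hz j hj => hz j (by omega)) hne hF0 hcl
  refine ⟨z, fun k => ?_⟩
  rw [Set.mem_iInter] at hz
  exact hz k k le_rfl

/-- the natural extension as a type -/
abbrev OmT := {z : (ℕ → I) × X // z ∈ S.Om}

instance : CompactSpace S.OmT := isCompact_iff_compactSpace.1 S.isCompact_Om
instance : TopologicalSpace.MetrizableSpace S.OmT :=
  Topology.IsEmbedding.subtypeVal.metrizableSpace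
instance : SecondCountableTopology S.OmT := by
  let _ := TopologicalSpace.metrizableSpaceMetric S.OmT
  infer_instance
instance instMS : MeasurableSpace S.OmT := borel _
instance instBS : BorelSpace S.OmT := ⟨rfl⟩

/-- forward maps on the natural extension -/
def T (i : I) (z : S.OmT) : S.OmT := ⟨S.T0 i z.1, S.T0_Om i z.2⟩

/-- backward map on the natural extension -/
def sg (z : S.OmT) : S.OmT := ⟨S.sg0 z.1, S.sg0_Om z.2⟩

lemma continuous_T (i : I) : Continuous (S.T i) :=
  ((S.continuous_T0 i).comp continuous_subtype_val).subtype_mk _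

lemma continuous_sg : Continuous S.sg :=
  (S.continuous_sg0.comp continuous_subtype_val).subtype_mk _

lemma sg_T (i : I) (z : S.OmT) : S.sg (S.T i z) = z := Subtype.ext (S.sg0_T0 i z.1)

/-- the base coordinate -/
def bb (z : S.OmT) : ℕ → I := z.1.1
/-- the fibre coordinate -/
def xx (z : S.OmT) : X := z.1.2

lemma continuous_bb : Continuous S.bb := continuous_fst.comp continuous_subtype_val
lemma continuous_xx : Continuous S.xx := continuous_snd.comp continuous_subtype_val
lemma xx_mem (z : S.OmT) : S.xx z ∈ S.Y := S.Om_snd z.2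
lemma xx_T (i : I) (z : S.OmT) : S.xx (S.T i z) = S.h i • S.xx z := rfl
lemma bb_T (i : I) (z : S.OmT) : S.bb (S.T i z) = consS i (S.bb z) := rfl

lemma xx_actw (l : List I) (z : S.OmT) : S.xx (actw S.T l z) = S.Hw l • S.xx z := by
  induction l with
  | nil => simp [actw]
  | cons i l ih => simp [actw, xx_T, ih, mul_smul]

/-! ### the Margulis function -/

open Classical in
/-- local distance -/
def nu (r : ℝ) (x x' : X) : ℝ :=
  if h : ∃ g, S.N g < r ∧ g • x = x' then S.N h.choose else r

lemma nu_eq_of {r r1 : ℝ} (hr : r ≤ r1)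
    (hinj : ∀ x ∈ S.Y, ∀ g g', S.N g < r1 → S.N g' < r1 → g • x = g' • x → g = g')
    {x : X} (hx : x ∈ S.Y) {g : G} (hg : S.N g < r1) : S.nu r x (g • x) = min r (S.N g) := by
  unfold nu
  split_ifs with h
  · have h1 := h.choose_spec
    have : h.choose = g := hinj x hx _ _ (h1.1.trans_le hr) hg h1.2
    rw [this] at h1 ⊢
    rw [min_eq_right h1.1.le]
  · rw [min_eq_left]
    by_contra hlt
    exact h ⟨g, not_le.1 hlt, rfl⟩

lemma nu_pos {r : ℝ} (hr : 0 < r) {x x' : X} (hx : x ≠ x') : 0 < S.nu r x x' := by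
  unfold nu
  split_ifs with h
  · have h1 := h.choose_spec
    refine lt_of_le_of_ne (S.N_nonneg _) fun h0 => ?_
    rw [(S.N_eq_zero _).1 h0.symm] at h1
    exact hx (by simpa using h1.2)
  · exact hr

lemma nu_ge {r : ℝ} {x x' : X} {s : ℝ} (hs : s ≤ r)
    (h : ∀ g, S.N g < r → g • x = x' → s ≤ S.N g) : s ≤ S.nu r x x' := by
  unfold nu
  split_ifs with h'
  · exact h _ h'.choose_spec.1 h'.choose_spec.2
  · exact hs

lemma nu_le {r : ℝ} (hr1 : ∀ x ∈ S.Y, ∀ g g', S.N g < r → S.N g' < r → g • x = g' • x → g = g')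
    {x : X} (hx : x ∈ S.Y) {g : G} (hg : S.N g < r) : S.nu r x (g • x) ≤ S.N g := by
  rw [S.nu_eq_of le_rfl hr1 hx hg]
  exact min_le_right _ _

theorem margulis : ∃ r κ a c : ℝ, 0 < r ∧ 0 < κ ∧ 0 ≤ a ∧ a < 1 ∧ 0 ≤ c ∧
    (∀ x ∈ S.Y, ∀ g g', S.N g < r → S.N g' < r → g • x = g' • x → g = g') ∧
    ∀ x ∈ S.Y, ∀ x' ∈ S.Y, x ≠ x' →
      (∑ i, (S.nu r (S.h i • x) (S.h i • x')) ^ (-κ)) / Fintype.card I ≤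
        a * (S.nu r x x') ^ (-κ) + c := by
  classical
  obtain ⟨r1, hr1, hinj⟩ := S.inj
  obtain ⟨C, hC1, hC⟩ := S.conj_bound
  obtain ⟨A, r3, hA, hr3, hexp⟩ := S.expand
  set r := min r3 (r1 / C) with hr
  have hC0 : 0 < C := by linarith
  have hrpos : 0 < r := lt_min hr3 (by positivity)
  have hrC : C * r ≤ r1 := by
    have : r ≤ r1 / C := min_le_right _ _
    rw [le_div_iff₀ hC0] at this
    linarith
  have hrr1 : r ≤ r1 := by nlinarith
  have hlogA : 0 < Real.log A := Real.log_pos hA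
  set κ := Real.log (6 / 5) / Real.log A with hκ
  have hκpos : 0 < κ := div_pos (Real.log_pos (by norm_num)) hlogA
  have hAκ : A ^ κ = 6 / 5 := by
    rw [Real.rpow_def_of_pos (by linarith), hκ, mul_div_cancel₀ _ hlogA.ne',
      Real.exp_log (by norm_num)]
  have hcard := card_pos' (I := I)
  refine ⟨r, κ, 197 / 200, (r / C) ^ (-κ), hrpos, hκpos, by norm_num, by norm_num,
    by positivity, fun x hx g g' hg hg' => hinj x hx g g' (hg.trans_le hrr1) (hg'.trans_le hrr1), ?_⟩
  intro x hx x' hx' hne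
  have hc_nonneg : 0 ≤ (r / C) ^ (-κ) := by positivity
  have hrC' : r / C ≤ r := div_le_self hrpos.le hC1
  have hanti : ∀ {p q : ℝ}, 0 < p → p ≤ q → q ^ (-κ) ≤ p ^ (-κ) := fun hp hpq =>
    Real.rpow_le_rpow_of_nonpos hp hpq (by linarith)
  by_cases hex : ∃ g, S.N g < r ∧ g • x = x'
  · obtain ⟨g, hg, rfl⟩ := hex
    have hg1 : g ≠ 1 := by rintro rfl; simp at hne
    have hNpos : 0 < S.N g := lt_of_le_of_ne (S.N_nonneg g) fun h0 =>
      hg1 ((S.N_eq_zero g).1 h0.symm)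
    obtain ⟨⟨good, hgood, hexp1⟩, hexp2⟩ := hexp g (hg.trans_le (min_le_left _ _))
    have hnu : S.nu r x (g • x) = S.N g := by
      rw [S.nu_eq_of hrr1 hinj hx (hg.trans_le hrr1), min_eq_right hg.le]
    rw [hnu]
    set p := (S.N g) ^ (-κ) with hp
    have hp0 : 0 ≤ p := by positivity
    have hnui : ∀ i, S.nu r (S.h i • x) (S.h i • (g • x)) =
        min r (S.N (S.h i * g * (S.h i)⁻¹)) := by
      intro i
      have : S.h i • (g • x) = (S.h i * g * (S.h i)⁻¹) • (S.h i • x) := by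
        simp [mul_smul]
      rw [this]
      refine S.nu_eq_of hrr1 hinj (S.Y_inv i x hx) ?_
      refine lt_of_le_of_lt (hC i g).1 (lt_of_lt_of_le ?_ hrC)
      exact mul_lt_mul_of_pos_left hg hC0
    have hmin : ∀ q : ℝ, (min r q) ^ (-κ) ≤ q ^ (-κ) + (r / C) ^ (-κ) ∨ q ≤ 0 := by
      intro q
      rcases le_or_gt q 0 with hq | hq
      · exact Or.inr hq
      left
      rcases le_total r q with h | h
      · rw [min_eq_left h]
        have h1 : r ^ (-κ) ≤ (r / C) ^ (-κ) := hanti (by positivity) hrC'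
        have h2 : 0 ≤ q ^ (-κ) := by positivity
        linarith
      · rw [min_eq_right h]
        linarith
    have hA0 : (0:ℝ) < A := by linarith
    have hterm : ∀ i, (S.nu r (S.h i • x) (S.h i • (g • x))) ^ (-κ) ≤
        (if i ∈ good then 5 / 6 * p else 36 / 25 * p) + (r / C) ^ (-κ) := by
      intro i
      rw [hnui]
      have hni : 0 < S.N (S.h i * g * (S.h i)⁻¹) := by
        have := hexp2 i
        by_contra h0
        have h1 := le_antisymm (not_lt.1 h0) (S.N_nonneg _)
        rw [h1] at this
        linarith
      have h1 := (hmin (S.N (S.h i * g * (S.h i)⁻¹))).resolve_right (not_le.2 hni)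
      refine h1.trans (add_le_add_left ?_ _)
      split_ifs with hi
      · have h2 := hanti (by positivity) (hexp1 i hi)
        refine h2.trans (le_of_eq ?_)
        rw [Real.mul_rpow hA0.le hNpos.le, Real.rpow_neg hA0.le, hAκ]
        norm_num
        try ring
      · have h3 : (A ^ 2)⁻¹ * S.N g ≤ S.N (S.h i * g * (S.h i)⁻¹) := by
          rw [inv_mul_le_iff₀ (by positivity)]
          exact hexp2 i
        have h2 := hanti (by positivity) h3
        refine h2.trans (le_of_eq ?_)
        rw [Real.mul_rpow (by positivity) hNpos.le, Real.rpow_neg (by positivity),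
          Real.inv_rpow (by positivity), inv_inv, ← Real.rpow_natCast, ← Real.rpow_mul hA0.le,
          mul_comm ((2:ℕ):ℝ) κ, Real.rpow_mul hA0.le, hAκ]
        norm_num
        try simp [hp]
    rw [div_le_iff₀ hcard]
    calc ∑ i, (S.nu r (S.h i • x) (S.h i • (g • x))) ^ (-κ)
        ≤ ∑ i, ((if i ∈ good then 5 / 6 * p else 36 / 25 * p) + (r / C) ^ (-κ)) :=
          Finset.sum_le_sum fun i _ => hterm i
      _ = ∑ i, ((36 / 25 * p + (r / C) ^ (-κ)) + (if i ∈ good then (5 / 6 - 36 / 25) * p else 0)) := by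
          refine Finset.sum_congr rfl fun i _ => ?_
          split_ifs <;> ring
      _ = (36 / 25 * p + (r / C) ^ (-κ)) * Fintype.card I + good.card * ((5 / 6 - 36 / 25) * p) := by
          rw [Finset.sum_add_distrib, ← Finset.sum_filter]
          simp only [Finset.sum_const, Finset.card_univ, nsmul_eq_mul, Finset.filter_mem_eq_inter, Finset.univ_inter]
          ring
      _ ≤ _ := by
          have := mul_le_mul_of_nonneg_right hgood hp0
          nlinarith
  · have hnu : S.nu r x x' = r := by
      unfold nu
      rw [dif_neg hex]
    have hterm : ∀ i, (S.nu r (S.h i • x) (S.h i • x')) ^ (-κ) ≤ (r / C) ^ (-κ) := by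
      intro i
      refine hanti (by positivity) (S.nu_ge hrC' fun g hg hgx => ?_)
      by_contra hlt
      refine hex ⟨(S.h i)⁻¹ * g * S.h i, ?_, ?_⟩
      · refine lt_of_le_of_lt (hC i g).2 ?_
        rw [not_le, lt_div_iff₀ hC0] at hlt
        linarith
      · rw [mul_smul, mul_smul, hgx, inv_smul_smul]
    have h0 : 0 ≤ 197 / 200 * (S.nu r x x') ^ (-κ) := by rw [hnu]; positivity
    rw [div_le_iff₀ hcard]
    calc ∑ i, (S.nu r (S.h i • x) (S.h i • x')) ^ (-κ)
        ≤ ∑ i : I, (r / C) ^ (-κ) := Finset.sum_le_sum fun i _ => hterm i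
      _ = (r / C) ^ (-κ) * Fintype.card I := by simp [mul_comm]
      _ ≤ _ := by gcongr; linarith

end Sys

end DriftBA

end

section

namespace DriftBA

set_option linter.unusedSectionVars false
set_option linter.unusedSimpArgs false
set_option linter.unusedVariables false
set_option linter.deprecated false

lemma Pop_iter_mono_on {I W : Type*} [Fintype I] [Nonempty I] (T : I → W → W) {S : Set W}
    (hS : ∀ i, ∀ w ∈ S, T i w ∈ S) {f g : W → ℝ}
    (h : ∀ w ∈ S, f w ≤ g w) (k : ℕ) : ∀ w ∈ S, (Pop T)^[k] f w ≤ (Pop T)^[k] g w := by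
  induction k with
  | zero => exact h
  | succ k ih =>
    intro w hw
    rw [Function.iterate_succ_apply', Function.iterate_succ_apply']
    exact Pop_mono_on T hS ih w hw

namespace Sys

variable {I G X V : Type*} [Fintype I] [Nonempty I] [TopologicalSpace I] [DiscreteTopology I]
  [Group G] [TopologicalSpace G] [IsTopologicalGroup G]
  [TopologicalSpace X] [T2Space X] [TopologicalSpace.MetrizableSpace X]
  [MulAction G X] [ContinuousSMul G X] [NormedAddCommGroup V] [NormedSpace ℝ V]
  [FiniteDimensional ℝ V]
  (S : Sys I G X V)

/-- pair maps -/
def T2 (i : I) (w : S.OmT × S.OmT) : S.OmT × S.OmT := (S.T i w.1, S.T i w.2)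

lemma continuous_T2 (i : I) : Continuous (S.T2 i) :=
  ((S.continuous_T i).comp continuous_fst).prodMk ((S.continuous_T i).comp continuous_snd)

open Classical in
/-- test function for disagreement at coordinate `j` -/
def dis (j : ℕ) (w : S.OmT × S.OmT) : ℝ := if S.bb w.1 j = S.bb w.2 j then 0 else 1

lemma continuous_dis (j : ℕ) : Continuous (S.dis j) := by
  classical
  have h1 : Continuous (fun p : I × I => if p.1 = p.2 then (0:ℝ) else 1) :=
    continuous_of_discreteTopology
  have h2 : Continuous (fun w : S.OmT × S.OmT => (S.bb w.1 j, S.bb w.2 j)) :=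
    ((continuous_apply j).comp (S.continuous_bb.comp continuous_fst)).prodMk
      ((continuous_apply j).comp (S.continuous_bb.comp continuous_snd))
  exact (h1.comp h2).congr fun w => by simp [dis]

lemma Pop_dis (j : ℕ) : (Pop S.T2)^[j + 1] (S.dis j) = fun _ => 0 := by
  have hc := (card_pos' (I := I)).ne'
  induction j with
  | zero =>
    ext w
    simp [Pop, T2, dis, bb_T, consS]
  | succ j ih =>
    rw [Function.iterate_succ_apply]
    have : Pop S.T2 (S.dis (j+1)) = S.dis j := by
      ext w
      have h1 : ∀ i, S.dis (j + 1) (S.T2 i w) = S.dis j w := by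
        intro i
        by_cases h : S.bb w.1 j = S.bb w.2 j
        · have h' : S.bb (S.T2 i w).1 (j + 1) = S.bb (S.T2 i w).2 (j + 1) := h
          simp only [dis, if_pos h, if_pos h']
        · have h' : ¬ S.bb (S.T2 i w).1 (j + 1) = S.bb (S.T2 i w).2 (j + 1) := h
          simp only [dis, if_neg h, if_neg h']
      simp only [Pop, h1]
      simp
    rw [this, ih]

/-- diagonal set -/
def Dg : Set (S.OmT × S.OmT) := {w | S.xx w.1 = S.xx w.2}

/-- local leaves -/
def Lf (r : ℝ) : Set (S.OmT × S.OmT) := {w | ∃ t : V, ‖t‖ ≤ r ∧ S.u t • S.xx w.1 = S.xx w.2}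

lemma isClosed_Lf (r : ℝ) : IsClosed (S.Lf r) := by
  have hcomp : CompactSpace (Metric.closedBall (0 : V) r) :=
    isCompact_iff_compactSpace.1 (isCompact_closedBall _ _)
  have : S.Lf r = Prod.snd '' {p : Metric.closedBall (0 : V) r × (S.OmT × S.OmT) |
      S.u p.1 • S.xx p.2.1 = S.xx p.2.2} := by
    ext w
    simp only [Lf, Set.mem_setOf_eq, Set.mem_image, Prod.exists, exists_eq_right]
    constructor
    · rintro ⟨t, ht, h⟩
      exact ⟨⟨t, by simpa using ht⟩, h⟩
    · rintro ⟨t, h⟩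
      exact ⟨t, mem_closedBall_zero_iff.1 t.2, h⟩
  rw [this]
  refine isClosedMap_snd_of_compactSpace _ (isClosed_eq ?_ ?_)
  · exact (S.u_cont.comp (continuous_subtype_val.comp continuous_fst)).smul
      (S.continuous_xx.comp (continuous_fst.comp continuous_snd))
  · exact S.continuous_xx.comp (continuous_snd.comp continuous_snd)

lemma T2_preimage_Lf (i : I) (r : ℝ) : S.T2 i ⁻¹' (S.Lf r) = S.Lf (r / S.lam) := by
  have hl : 0 < S.lam := by linarith [S.one_lt_lam]
  have key : ∀ (t : V) (x : X), S.u (S.lam • S.rot i t) • (S.h i • x) = S.h i • (S.u t • x) := by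
    intro t x
    rw [← S.h_u]
    simp [mul_smul]
  ext w
  simp only [Lf, Set.mem_preimage, Set.mem_setOf_eq, T2, xx_T]
  constructor
  · rintro ⟨t, ht, h⟩
    refine ⟨(S.rot i).symm (S.lam⁻¹ • t), ?_, ?_⟩
    · rw [LinearIsometryEquiv.norm_map, norm_smul, norm_inv, Real.norm_of_nonneg hl.le,
        div_eq_inv_mul]
      gcongr
    · have := key ((S.rot i).symm (S.lam⁻¹ • t)) (S.xx w.1)
      rw [LinearIsometryEquiv.apply_symm_apply, smul_inv_smul₀ hl.ne', h] at this
      exact (smul_left_cancel _ this).symm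
  · rintro ⟨t, ht, h⟩
    refine ⟨S.lam • S.rot i t, ?_, ?_⟩
    · rw [norm_smul, LinearIsometryEquiv.norm_map, Real.norm_of_nonneg hl.le, mul_comm]
      exact (le_div_iff₀ hl).1 ht
    · rw [key, h]

lemma iInter_Lf (R : ℝ) : ⋂ n : ℕ, S.Lf (R / S.lam ^ n) ⊆ S.Dg := by
  intro w hw
  rw [Set.mem_iInter] at hw
  choose t ht h using hw
  have h0 : Tendsto (fun n : ℕ => R / S.lam ^ n) atTop (𝓝 0) :=
    tendsto_const_nhds.div_atTop (tendsto_pow_atTop_atTop_of_one_lt S.one_lt_lam)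
  have ht0 : Tendsto t atTop (𝓝 0) := squeeze_zero_norm ht h0
  have h1 : Tendsto (fun n => S.u (t n) • S.xx w.1) atTop (𝓝 (S.u 0 • S.xx w.1)) :=
    ((S.u_cont.tendsto 0).comp ht0).smul_const _
  simp only [h] at h1
  rw [S.u_zero, one_smul] at h1
  exact (tendsto_nhds_unique h1 tendsto_const_nhds)

theorem pair_Dg (z1 z2 : S.OmT) (hne : S.xx z1 ≠ S.xx z2)
    (ζ : Measure (S.OmT × S.OmT)) [IsProbabilityMeasure ζ]
    (hζ : ∀ f : S.OmT × S.OmT → ℝ, Continuous f →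
      ∫ w, f w ∂ζ = BL (fun k => (Pop S.T2)^[k] f (z1, z2))) : ζ S.Dg = 0 := by
  obtain ⟨r, κ, a, c, hr, hκ, ha0, ha1, hc, hinj, hM⟩ := S.margulis
  have hclosed : IsClosed S.Dg := isClosed_eq (S.continuous_xx.comp continuous_fst)
    (S.continuous_xx.comp continuous_snd)
  set Sne : Set (S.OmT × S.OmT) := {w | S.xx w.1 ≠ S.xx w.2} with hSne
  have hSinv : ∀ i, ∀ w ∈ Sne, S.T2 i w ∈ Sne := by
    intro i w hw h
    exact hw (smul_left_cancel _ h)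
  set M := (S.nu r (S.xx z1) (S.xx z2)) ^ (-κ) + c / (1 - a) with hMdef
  have key : ∀ ρ, 0 < ρ → ρ ≤ r → ζ.real S.Dg ≤ ρ ^ κ * M := by
    intro ρ hρ hρr
    choose C hCo hCx hC using S.locTrans ρ hρ
    set O : Set (S.OmT × S.OmT) := ⋃ x, {w | S.xx w.1 ∈ C x ∧ S.xx w.2 ∈ C x} with hO
    have hOo : IsOpen O := isOpen_iUnion fun x =>
      ((hCo x).preimage (S.continuous_xx.comp continuous_fst)).inter
        ((hCo x).preimage (S.continuous_xx.comp continuous_snd))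
    have hdisj : Disjoint Oᶜ S.Dg := by
      rw [Set.disjoint_left]
      intro w hw hw'
      refine hw (Set.mem_iUnion.2 ⟨S.xx w.1, hCx _, ?_⟩)
      have : S.xx w.1 = S.xx w.2 := hw'
      rw [← this]
      exact hCx _
    obtain ⟨χ, hχ0, hχ1, hχ⟩ := exists_continuous_zero_one_of_isClosed hOo.isClosed_compl hclosed hdisj
    have hle : ∀ w ∈ Sne, χ w ≤ ρ ^ κ * (S.nu r (S.xx w.1) (S.xx w.2)) ^ (-κ) := by
      intro w hw
      have hnu := S.nu_pos hr hw
      by_cases hwO : w ∈ O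
      · obtain ⟨x, hx1, hx2⟩ := Set.mem_iUnion.1 hwO
        obtain ⟨g, hg, hgx⟩ := hC x _ hx1 _ hx2
        have h1 : S.nu r (S.xx w.1) (S.xx w.2) ≤ ρ := by
          rw [← hgx]
          exact (S.nu_le hinj (S.xx_mem _) (hg.trans_le hρr)).trans hg.le
        refine (hχ w).2.trans ?_
        have h2 : ρ ^ (-κ) ≤ (S.nu r (S.xx w.1) (S.xx w.2)) ^ (-κ) :=
          Real.rpow_le_rpow_of_nonpos hnu h1 (by linarith)
        have h3 : ρ ^ κ * ρ ^ (-κ) = 1 := by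
          rw [← Real.rpow_add hρ]; simp
        rw [← h3]
        gcongr
      · rw [hχ0 hwO]
        simp only [Pi.zero_apply]
        positivity
    have hb : Bdd (fun k => (Pop S.T2)^[k] χ (z1, z2)) := bdd_Pop_iter S.T2 χ.continuous _
    have hiter : ∀ k, (Pop S.T2)^[k] χ (z1, z2) ≤ ρ ^ κ * M := by
      intro k
      refine (Pop_iter_mono_on S.T2 hSinv hle k (z1, z2) hne).trans ?_
      have := Pop_iter_margulis S.T2 hSinv (f := fun w => ρ ^ κ * (S.nu r (S.xx w.1) (S.xx w.2)) ^ (-κ))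
        (a := a) (c := ρ ^ κ * c) ha0 ha1 (by positivity) (fun w hw => by
          have := S.nu_pos hr hw
          positivity) (fun w hw => by
          have h := hM _ (S.xx_mem w.1) _ (S.xx_mem w.2) hw
          unfold Pop
          rw [← Finset.mul_sum, mul_div_assoc]
          have h2 := mul_le_mul_of_nonneg_left h (by positivity : 0 ≤ ρ ^ κ)
          refine le_trans h2 (le_of_eq (by ring))) k (z1, z2) hne
      refine this.trans (le_of_eq ?_)
      rw [hMdef]
      ring
    have hInt : ∫ w, χ w ∂ζ ≤ ρ ^ κ * M := by
      rw [hζ _ χ.continuous, ← BL_const (ρ ^ κ * M)]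
      exact BL_mono hb ⟨|ρ ^ κ * M|, fun _ => le_rfl⟩ hiter
    refine le_trans ?_ hInt
    rw [← integral_indicator_one hclosed.measurableSet]
    refine integral_mono_of_nonneg (Eventually.of_forall fun w =>
      Set.indicator_nonneg (fun _ _ => by simp) w) ?_ (Eventually.of_forall fun w => ?_)
    · exact Integrable.of_bound χ.continuous.aestronglyMeasurable 1 (Eventually.of_forall fun w => by
        rw [Real.norm_eq_abs, abs_le]
        exact ⟨by linarith [(hχ w).1], (hχ w).2⟩)
    · by_cases hw : w ∈ S.Dg
      · simp [hw, hχ1 hw]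
      · simp [hw, (hχ w).1]
  have hlim : Tendsto (fun ρ : ℝ => ρ ^ κ * M) (𝓝[>] 0) (𝓝 (0 ^ κ * M)) :=
    (((Real.continuousAt_rpow_const 0 κ (Or.inr hκ.le)).tendsto.mono_left
      nhdsWithin_le_nhds).mul_const M)
  rw [Real.zero_rpow hκ.ne', zero_mul] at hlim
  have h0 : ζ.real S.Dg ≤ 0 := by
    refine ge_of_tendsto hlim ?_
    filter_upwards [Ioo_mem_nhdsGT hr] with ρ hρ
    exact key ρ hρ.1 hρ.2.le
  have h1 : ζ.real S.Dg = 0 := le_antisymm h0 measureReal_nonneg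
  exact (measureReal_eq_zero_iff).1 h1

theorem pair_lemma (z1 z2 : S.OmT) (hne : S.xx z1 ≠ S.xx z2)
    (ζ : Measure (S.OmT × S.OmT)) [IsProbabilityMeasure ζ]
    (hζ : ∀ f : S.OmT × S.OmT → ℝ, Continuous f →
      ∫ w, f w ∂ζ = BL (fun k => (Pop S.T2)^[k] f (z1, z2))) (R : ℝ) :
    ∀ᵐ w ∂ζ, S.bb w.1 = S.bb w.2 ∧ w ∉ S.Lf R := by
  have hb : ∀ j, ∀ᵐ w ∂ζ, S.bb w.1 j = S.bb w.2 j := by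
    intro j
    have hcont := S.continuous_dis j
    have h1 : ∫ w, S.dis j w ∂ζ = 0 := by
      rw [hζ _ hcont, ← BL_shift (bdd_Pop_iter S.T2 hcont _) (j + 1)]
      have : ∀ k, (Pop S.T2)^[k + (j + 1)] (S.dis j) (z1, z2) = 0 := by
        intro k
        rw [Function.iterate_add_apply, Pop_dis]
        have : ∀ k, (Pop S.T2)^[k] (fun _ => (0:ℝ)) = fun _ => 0 := by
          intro k
          induction k with
          | zero => rfl
          | succ k ih => rw [Function.iterate_succ_apply', ih, Pop_const]
        rw [this]
      simp only [this]
      exact BL_const 0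
    have h2 : 0 ≤ᵐ[ζ] S.dis j := Eventually.of_forall fun w => by
      simp only [dis, Pi.zero_apply]; split_ifs <;> norm_num
    have hI : Integrable (S.dis j) ζ :=
      Integrable.of_bound hcont.aestronglyMeasurable 1 (Eventually.of_forall fun w => by
        simp only [dis]; split_ifs <;> norm_num)
    rw [integral_eq_zero_iff_of_nonneg_ae h2 hI] at h1
    filter_upwards [h1] with w hw
    by_contra h
    simp [dis, h] at hw
  have hDg := S.pair_Dg z1 z2 hne ζ hζ
  have hst := stationary_measurable S.T2 S.continuous_T2 ζ (z1, z2) hζ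
  have hcard : (Fintype.card I : ENNReal) ≠ 0 := by
    have : 0 < Fintype.card I := Fintype.card_pos
    exact_mod_cast this.ne'
  have hL : ∀ r, ζ (S.Lf r) = ζ (S.Lf (r / S.lam)) := by
    intro r
    have h1 : (∑ i, ζ.map (S.T2 i)) (S.Lf r) = ((Fintype.card I : ENNReal) • ζ) (S.Lf r) := by
      rw [hst]
    rw [Measure.finsetSum_apply, Measure.smul_apply, smul_eq_mul] at h1
    have h2 : ∀ i, ζ.map (S.T2 i) (S.Lf r) = ζ (S.Lf (r / S.lam)) := by
      intro i
      rw [Measure.map_apply (S.continuous_T2 i).measurable (S.isClosed_Lf r).measurableSet,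
        T2_preimage_Lf]
    simp only [h2, Finset.sum_const, Finset.card_univ, nsmul_eq_mul] at h1
    exact ((ENNReal.mul_right_inj hcard (ENNReal.natCast_ne_top _)).1 h1).symm
  have hLn : ∀ n : ℕ, ζ (S.Lf (R / S.lam ^ n)) = ζ (S.Lf R) := by
    intro n
    induction n with
    | zero => simp
    | succ n ih => rw [← ih, hL (R / S.lam ^ n), pow_succ, div_div]
  have hLR : ζ (S.Lf R) = 0 := by
    rcases lt_or_ge R 0 with hR | hR
    · have : S.Lf R = ∅ := by
        ext w
        simp only [Lf, Set.mem_setOf_eq, Set.mem_empty_iff_false, iff_false, not_exists, not_and]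
        intro t ht
        exact absurd ht (by linarith [norm_nonneg t])
      simp [this]
    have hanti : Antitone fun n : ℕ => S.Lf (R / S.lam ^ n) := by
      refine antitone_nat_of_succ_le fun n w => ?_
      rintro ⟨t, ht, h⟩
      refine ⟨t, ht.trans ?_, h⟩
      have := S.one_lt_lam
      gcongr
      · linarith
      · omega
    have h3 := tendsto_measure_iInter_atTop (μ := ζ)
      (fun n => (S.isClosed_Lf (R / S.lam ^ n)).measurableSet.nullMeasurableSet) hanti
      ⟨0, measure_ne_top _ _⟩
    have h4 : ζ (⋂ n : ℕ, S.Lf (R / S.lam ^ n)) = 0 := measure_mono_null (S.iInter_Lf R) hDg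
    rw [h4] at h3
    have h5 : Tendsto (fun n : ℕ => ζ (S.Lf (R / S.lam ^ n))) atTop (𝓝 0) := h3
    simp only [hLn] at h5
    exact (tendsto_nhds_unique h5 tendsto_const_nhds).symm
  filter_upwards [ae_all_iff.2 hb, measure_eq_zero_iff_ae_notMem.1 hLR] with w h1 h2
  exact ⟨funext h1, h2⟩

end Sys

end DriftBA

end

section

namespace DriftBA

set_option linter.unusedSectionVars false
set_option linter.unusedSimpArgs false
set_option linter.unusedVariables false
set_option linter.deprecated false

namespace Sys

variable {I G X V : Type*} [Fintype I] [Nonempty I] [TopologicalSpace I] [DiscreteTopology I]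
  [Group G] [TopologicalSpace G] [IsTopologicalGroup G] [T2Space G]
  [TopologicalSpace X] [T2Space X] [TopologicalSpace.MetrizableSpace X]
  [MulAction G X] [ContinuousSMul G X] [NormedAddCommGroup V] [NormedSpace ℝ V]
  [FiniteDimensional ℝ V]
  (S : Sys I G X V)

/-- freeness of the semigroup action on points -/
def Free : Prop := ∀ z : S.OmT, ∀ l l' : List I, l.length = l'.length →
  S.Hw l • S.xx z = S.Hw l' • S.xx z → l = l'

/-- A set without non-leafwise companions is null. -/
theorem companion (hfree : S.Free) (hcard : 2 ≤ Fintype.card I) (z0 : S.OmT) (m : Measure S.OmT)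
    [IsProbabilityMeasure m]
    (hm : ∀ f : S.OmT → ℝ, Continuous f → ∫ w, f w ∂m = BL (fun k => (Pop S.T)^[k] f z0))
    (r : ℝ) (hr : 0 < r) (D0 : Set S.OmT) (hD0 : MeasurableSet D0)
    (hD : ∀ z ∈ D0, ∀ z' ∈ D0, S.bb z = S.bb z' → ∀ g, S.N g < r → g • S.xx z = S.xx z' →
      g ∈ Set.range S.u) : m D0 = 0 := by
  classical
  obtain ⟨C0, hC0⟩ := S.N_u
  choose C hCo hCx hC using S.locTrans r hr
  obtain ⟨cells, -, hcells⟩ := S.Y_compact.elim_nhds_subcover C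
    (fun x _ => (hCo x).mem_nhds (hCx x))
  have main : ∀ K : ℕ, (Fintype.card I : ENNReal) ^ K * m D0 ≤ cells.card := by
    intro K
    set w0 : (Fin K → I) → S.OmT := fun α => actw S.T (List.ofFn α) z0 with hw0
    obtain ⟨η, hηp, hη⟩ := exists_stationary (diagT S.T (Fin K → I)) w0
    have hmarg := tuple_marginal S.T S.continuous_T z0 m hm K η hη
    have hpair : ∀ α α' : Fin K → I, α ≠ α' → ∀ᵐ w ∂η,
        S.bb (w α) = S.bb (w α') ∧ (w α, w α') ∉ S.Lf (|C0| * r) := by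
      intro α α' hne
      set F : ((Fin K → I) → S.OmT) → S.OmT × S.OmT := fun w => (w α, w α') with hF
      have hFc : Continuous F := (continuous_apply α).prodMk (continuous_apply α')
      have : IsProbabilityMeasure (η.map F) := Measure.isProbabilityMeasure_map hFc.measurable.aemeasurable
      have h1 := S.pair_lemma (w0 α) (w0 α') (by
        rw [hw0]
        simp only [xx_actw]
        intro h
        have := hfree z0 _ _ (by simp) h
        exact hne (List.ofFn_injective this)) (η.map F) (by
        intro f hf
        rw [integral_map hFc.measurable.aemeasurable hf.aestronglyMeasurable]
        refine (hη _ (hf.comp hFc)).trans ?_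
        congr 1
        ext k
        exact Pop_iter_comp (diagT S.T (Fin K → I)) S.T2 F (fun i w => rfl) f k w0) (|C0| * r)
      exact ae_of_ae_map hFc.measurable.aemeasurable h1
    have hall : ∀ᵐ w ∂η, ∀ α α' : Fin K → I, α ≠ α' →
        S.bb (w α) = S.bb (w α') ∧ (w α, w α') ∉ S.Lf (|C0| * r) := by
      rw [ae_all_iff]; intro α
      rw [ae_all_iff]; intro α'
      by_cases h : α = α'
      · exact Eventually.of_forall fun w h' => absurd h h'
      · filter_upwards [hpair α α' h] with w hw _ using hw
    have hcount : ∀ᵐ w ∂η, ∑ α : Fin K → I, D0.indicator (1 : S.OmT → ENNReal) (w α) ≤ cells.card := by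
      filter_upwards [hall] with w hw
      have h1 : ∑ α : Fin K → I, D0.indicator (1 : S.OmT → ENNReal) (w α) =
          ((Finset.univ.filter fun α : Fin K → I => w α ∈ D0).card : ENNReal) := by
        simp [Set.indicator_apply, Finset.sum_ite]
      rw [h1]
      have h2 : ∀ α : Fin K → I, ∃ x ∈ cells, S.xx (w α) ∈ C x := by
        intro α
        simpa using hcells (S.xx_mem (w α))
      choose c hc hcw using h2
      norm_cast
      refine Finset.card_le_card_of_injOn c (fun α _ => hc α) ?_
      intro α hα α' hα' hcc
      by_contra hne
      obtain ⟨hb, hL⟩ := hw α α' hne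
      have hα1 : w α ∈ D0 := by simpa using hα
      have hα2 : w α' ∈ D0 := by simpa using hα'
      obtain ⟨g, hg, hgx⟩ := hC (c α) _ (hcw α) _ (hcc ▸ hcw α')
      obtain ⟨t, rfl⟩ := hD _ hα1 _ hα2 hb g hg hgx
      refine hL ⟨t, ?_, hgx⟩
      refine (hC0 t).trans ?_
      calc C0 * S.N (S.u t) ≤ |C0| * S.N (S.u t) :=
            mul_le_mul_of_nonneg_right (le_abs_self _) (S.N_nonneg _)
        _ ≤ _ := by gcongr
    have h3 : ∫⁻ w, ∑ α : Fin K → I, D0.indicator (1 : S.OmT → ENNReal) (w α) ∂η ≤ cells.card := by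
      calc _ ≤ ∫⁻ w, (cells.card : ENNReal) ∂η := lintegral_mono_ae hcount
        _ = _ := by simp
    have hmeas : ∀ α : Fin K → I, Measurable (fun w : (Fin K → I) → S.OmT => w α) :=
      fun α => measurable_pi_apply α
    have hmi : ∀ α : Fin K → I, Measurable (fun w : (Fin K → I) → S.OmT =>
        D0.indicator (1 : S.OmT → ENNReal) (w α)) :=
      fun α => (measurable_one.indicator hD0).comp (hmeas α)
    rw [lintegral_finsetSum _ (fun α _ => hmi α)] at h3
    have h4 : ∀ α : Fin K → I, ∫⁻ w, D0.indicator (1 : S.OmT → ENNReal) (w α) ∂η =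
        η.map (fun w => w α) D0 := by
      intro α
      rw [← lintegral_map (f := D0.indicator (1 : S.OmT → ENNReal)) (measurable_one.indicator hD0) (hmeas α),
        lintegral_indicator_one hD0]
    simp only [h4] at h3
    rw [← Measure.finsetSum_apply, hmarg, Measure.smul_apply, smul_eq_mul] at h3
    exact h3
  by_contra hne
  have h2 : Tendsto (fun K : ℕ => (2 : ENNReal) ^ K) atTop (𝓝 ⊤) :=
    ENNReal.tendsto_pow_atTop_nhds_top_iff.2 (by norm_num)
  have h3 : Tendsto (fun K : ℕ => (2 : ENNReal) ^ K * m D0) atTop (𝓝 (⊤ * m D0)) :=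
    ENNReal.Tendsto.mul_const h2 (Or.inl (by simp))
  rw [ENNReal.top_mul hne] at h3
  have h4 : (⊤ : ENNReal) ≤ cells.card := by
    refine le_of_tendsto' h3 fun K => le_trans ?_ (main K)
    gcongr
    exact_mod_cast hcard
  simp at h4

/-! ### translation sets -/

/-- points with many approximate return times -/
def D (j : ℕ) (s : ℕ → V) (e : ℝ) : Set S.OmT :=
  {z | ∀ J ⊆ Finset.range j, ∃ t : V, ‖t‖ ≤ e ∧ (S.bb z, S.u (∑ i ∈ J, s i + t) • S.xx z) ∈ S.Om}

lemma isClosed_D (j : ℕ) (e : ℝ) : IsClosed {p : (ℕ → V) × S.OmT | p.2 ∈ S.D j p.1 e} := by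
  have hcomp : CompactSpace (Metric.closedBall (0 : V) e) :=
    isCompact_iff_compactSpace.1 (isCompact_closedBall _ _)
  have : {p : (ℕ → V) × S.OmT | p.2 ∈ S.D j p.1 e} = ⋂ J ∈ {J | J ⊆ Finset.range j},
      Prod.snd '' {q : Metric.closedBall (0 : V) e × ((ℕ → V) × S.OmT) |
        (S.bb q.2.2, S.u (∑ i ∈ J, q.2.1 i + q.1) • S.xx q.2.2) ∈ S.Om} := by
    ext p
    simp only [D, Set.mem_setOf_eq, Set.mem_iInter, Set.mem_image, Prod.exists, exists_eq_right,
      exists_eq_right_right]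
    refine forall_congr' fun J => forall_congr' fun hJ => ?_
    constructor
    · rintro ⟨t, ht, h⟩
      exact ⟨⟨t, mem_closedBall_zero_iff.2 ht⟩, h⟩
    · rintro ⟨t, h⟩
      exact ⟨t, mem_closedBall_zero_iff.1 t.2, h⟩
  rw [this]
  refine isClosed_biInter fun J _ => isClosedMap_snd_of_compactSpace _ (S.isClosed_Om.preimage ?_)
  have hc1 : Continuous fun q : Metric.closedBall (0 : V) e × ((ℕ → V) × S.OmT) =>
      ∑ i ∈ J, q.2.1 i + (q.1 : V) := by
    refine Continuous.add (continuous_finsetSum _ fun i _ => ?_) (by fun_prop)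
    fun_prop
  exact (S.continuous_bb.comp (by fun_prop)).prodMk
    ((S.u_cont.comp hc1).smul (S.continuous_xx.comp (by fun_prop)))

lemma isClosed_D' (j : ℕ) (s : ℕ → V) (e : ℝ) : IsClosed (S.D j s e) :=
  (S.isClosed_D j e).preimage (by fun_prop : Continuous fun z : S.OmT => (s, z))

/-- the shell -/
def shell (a b : ℝ) : Set V := {t | a ≤ ‖t‖ ∧ ‖t‖ ≤ b}

lemma isCompact_shell (a b : ℝ) : IsCompact (shell (V := V) a b) := by
  refine (isCompact_closedBall (0 : V) b).of_isClosed_subset ?_ fun t ht => by simpa using ht.2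
  exact (isClosed_le continuous_const continuous_norm).inter
    (isClosed_le continuous_norm continuous_const)

/-- sequences in the shell -/
def shells (a b : ℝ) : Set (ℕ → V) := Set.pi Set.univ fun _ => shell a b

lemma isCompact_shells (a b : ℝ) : IsCompact (shells (V := V) a b) :=
  isCompact_univ_pi fun _ => isCompact_shell a b

/-- witness set -/
def Wit (a b : ℝ) (j : ℕ) (e : ℝ) : Set (((ℕ → V) × V × G) × (S.OmT × S.OmT)) :=
  {p | p.1.1 ∈ shells a b ∧ p.1.2.1 ∈ shell a b ∧ p.2.1 ∈ S.D j p.1.1 e ∧ p.2.2 ∈ S.D j p.1.1 e ∧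
    S.bb p.2.1 = S.bb p.2.2 ∧ S.xx p.2.2 = (p.1.2.2 * S.u p.1.2.1) • S.xx p.2.1}

lemma isClosed_Wit (a b : ℝ) (j : ℕ) (e : ℝ) : IsClosed (S.Wit a b j e) := by
  refine IsClosed.inter ((isCompact_shells a b).isClosed.preimage (by fun_prop)) ?_
  refine IsClosed.inter ((isCompact_shell a b).isClosed.preimage (by fun_prop)) ?_
  refine IsClosed.inter ((S.isClosed_D j e).preimage
    (by fun_prop : Continuous fun p : (((ℕ → V) × V × G) × (S.OmT × S.OmT)) => (p.1.1, p.2.1))) ?_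
  refine IsClosed.inter ((S.isClosed_D j e).preimage
    (by fun_prop : Continuous fun p : (((ℕ → V) × V × G) × (S.OmT × S.OmT)) => (p.1.1, p.2.2))) ?_
  refine IsClosed.inter (isClosed_eq (S.continuous_bb.comp (by fun_prop))
    (S.continuous_bb.comp (by fun_prop))) (isClosed_eq (S.continuous_xx.comp (by fun_prop)) ?_)
  refine Continuous.smul (Continuous.mul (by fun_prop) (S.u_cont.comp (by fun_prop)))
    (S.continuous_xx.comp (by fun_prop))

lemma isCompact_Wit (a b : ℝ) (j : ℕ) (e ρ : ℝ) :
    IsCompact {p ∈ S.Wit a b j e | S.N p.1.2.2 ≤ ρ} := by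
  have hK : IsCompact ((shells (V := V) a b ×ˢ (shell (V := V) a b ×ˢ {g | S.N g ≤ ρ})) ×ˢ
      (Set.univ : Set (S.OmT × S.OmT))) :=
    ((isCompact_shells (V := V) a b).prod ((isCompact_shell a b).prod (S.N_compact ρ))).prod isCompact_univ
  refine hK.of_isClosed_subset ((S.isClosed_Wit a b j e).inter
    (isClosed_le (S.N_cont.comp (by fun_prop)) continuous_const)) ?_
  rintro p ⟨h1, h2⟩
  exact ⟨⟨h1.1, h1.2.1, h2⟩, trivial⟩

/-- the drift sets -/
def Ed (a b : ℝ) (j : ℕ) (e ρ : ℝ) : Set S.OmT :=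
  (fun p => p.2.1) '' {p ∈ S.Wit a b j e | S.N p.1.2.2 ≤ ρ}

lemma isClosed_Ed (a b : ℝ) (j : ℕ) (e ρ : ℝ) : IsClosed (S.Ed a b j e ρ) :=
  ((S.isCompact_Wit a b j e ρ).image (by fun_prop)).isClosed

lemma Ed_mono (a b : ℝ) (j : ℕ) (e : ℝ) {ρ ρ' : ℝ} (h : ρ ≤ ρ') :
    S.Ed a b j e ρ ⊆ S.Ed a b j e ρ' :=
  Set.image_mono fun p hp => ⟨hp.1, hp.2.trans h⟩

lemma iInter_Ed (a b : ℝ) (j : ℕ) (e : ℝ) :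
    ⋂ n : ℕ, S.Ed a b j e (1 / (n + 1)) ⊆ ⋃ s ∈ shells (V := V) a b, S.D (j + 1) s e := by
  intro z hz
  rw [Set.mem_iInter] at hz
  set F : ℕ → Set (((ℕ → V) × V × G) × (S.OmT × S.OmT)) := fun n =>
    {p ∈ S.Wit a b j e | S.N p.1.2.2 ≤ 1 / ((n : ℝ) + 1)} ∩ {p | p.2.1 = z} with hF
  have hcl : IsClosed {p : (((ℕ → V) × V × G) × (S.OmT × S.OmT)) | p.2.1 = z} :=
    isClosed_eq (by fun_prop) continuous_const
  have hFc : ∀ n, IsCompact (F n) := fun n => (S.isCompact_Wit a b j e _).inter_right hcl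
  obtain ⟨p, hp⟩ := IsCompact.nonempty_iInter_of_sequence_nonempty_isCompact_isClosed F
    (fun n p hp => ⟨⟨hp.1.1, hp.1.2.trans (by
      push_cast
      gcongr
      linarith)⟩, hp.2⟩)
    (fun n => by
      obtain ⟨p, hp, h⟩ := hz n
      exact ⟨p, hp, h⟩) (hFc 0) (fun n => (hFc n).isClosed)
  rw [Set.mem_iInter] at hp
  obtain ⟨⟨s, τ, g⟩, ⟨z1, z'⟩⟩ := p
  obtain rfl : z1 = z := (hp 0).2
  obtain ⟨hs, hτ, hz1, hz', hbb, hxx⟩ := (hp 0).1.1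
  have hg : g = 1 := by
    rw [← S.N_eq_zero]
    refine le_antisymm ?_ (S.N_nonneg g)
    refine ge_of_tendsto' tendsto_one_div_add_atTop_nhds_zero_nat fun n => (hp n).1.2
  subst hg
  simp only [one_mul] at hs hτ hz1 hz' hbb hxx
  refine Set.mem_biUnion (x := Function.update s j τ) ?_ ?_
  · intro i _
    by_cases h : i = j
    · subst h; simpa using hτ
    · simpa [h] using hs i trivial
  · intro J hJ
    have hsum : ∀ J' ⊆ Finset.range j, ∑ i ∈ J', Function.update s j τ i = ∑ i ∈ J', s i := by
      intro J' hJ'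
      refine Finset.sum_congr rfl fun i hi => ?_
      have := Finset.mem_range.1 (hJ' hi)
      rw [Function.update_of_ne (by omega)]
    by_cases hj : j ∈ J
    · have hJ' : J.erase j ⊆ Finset.range j := by
        intro i hi
        have h1 := Finset.mem_erase.1 hi
        have h2 := Finset.mem_range.1 (hJ h1.2)
        exact Finset.mem_range.2 (by omega)
      obtain ⟨t, ht, h⟩ := hz' _ hJ'
      refine ⟨t, ht, ?_⟩
      rw [← Finset.sum_erase_add _ _ hj, hsum _ hJ', Function.update_self]
      rw [hbb]
      rw [hxx, ← mul_smul, ← S.u_add] at h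
      convert h using 4
      abel
    · have hJ' : J ⊆ Finset.range j := by
        intro i hi
        have h2 := Finset.mem_range.1 (hJ hi)
        have : i ≠ j := fun h => hj (h ▸ hi)
        exact Finset.mem_range.2 (by omega)
      rw [hsum _ hJ']
      exact hz1 J hJ'

end Sys

end DriftBA

end

section

namespace DriftBA

set_option linter.unusedSectionVars false
set_option linter.unusedSimpArgs false
set_option linter.unusedVariables false
set_option linter.deprecated false

namespace Sys

variable {I G X V : Type*} [Fintype I] [Nonempty I] [TopologicalSpace I] [DiscreteTopology I]
  [Group G] [TopologicalSpace G] [IsTopologicalGroup G] [T2Space G]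
  [TopologicalSpace X] [T2Space X] [TopologicalSpace.MetrizableSpace X]
  [MulAction G X] [ContinuousSMul G X] [NormedAddCommGroup V] [NormedSpace ℝ V]
  [FiniteDimensional ℝ V]
  (S : Sys I G X V)

/-- rotation along a word -/
def rotw : List I → (V ≃ₗᵢ[ℝ] V)
  | [] => LinearIsometryEquiv.refl ℝ V
  | i :: l => (rotw l).trans (S.rot i)

lemma Hw_u (l : List I) (t : V) :
    S.Hw l * S.u t * (S.Hw l)⁻¹ = S.u (S.lam ^ l.length • S.rotw l t) := by
  induction l with
  | nil => simp [rotw]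
  | cons i l ih =>
    have : S.Hw (i :: l) * S.u t * (S.Hw (i :: l))⁻¹ =
        S.h i * (S.Hw l * S.u t * (S.Hw l)⁻¹) * (S.h i)⁻¹ := by
      simp [mul_assoc]
    rw [this, ih, S.h_u]
    simp [rotw, pow_succ', mul_smul]

/-- the past of a sequence as a word -/
def past (β : ℕ → I) (k : ℕ) : List I := (List.range k).map β

lemma length_past (β : ℕ → I) (k : ℕ) : (past β k).length = k := by simp [past]

lemma bb_sg_iter (z : S.OmT) (k n : ℕ) : S.bb (S.sg^[k] z) n = S.bb z (n + k) := by
  induction k generalizing n with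
  | zero => rfl
  | succ k ih =>
    rw [Function.iterate_succ_apply']
    have : S.bb (S.sg (S.sg^[k] z)) n = S.bb (S.sg^[k] z) (n + 1) := rfl
    rw [this, ih]
    congr 1
    ring

lemma xx_back (z : S.OmT) (k : ℕ) : S.xx z = S.Hw (past (S.bb z) k) • S.xx (S.sg^[k] z) := by
  induction k with
  | zero => simp [past]
  | succ k ih =>
    rw [Function.iterate_succ_apply', past, List.range_succ, List.map_append, Hw_append, mul_smul]
    have h1 : S.xx (S.sg^[k] z) = S.h (S.bb z k) • S.xx (S.sg (S.sg^[k] z)) := by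
      have : S.xx (S.sg (S.sg^[k] z)) = (S.h (S.bb (S.sg^[k] z) 0))⁻¹ • S.xx (S.sg^[k] z) := rfl
      rw [this, bb_sg_iter, zero_add, smul_inv_smul]
    simp only [List.map_cons, List.map_nil, Hw_cons, Hw_nil, mul_one]
    rw [← h1]
    exact ih

lemma bb_sg_congr {z z' : S.OmT} (h : S.bb z = S.bb z') (k : ℕ) :
    S.bb (S.sg^[k] z) = S.bb (S.sg^[k] z') := by
  ext n; rw [bb_sg_iter, bb_sg_iter, h]

lemma bb_actw_congr {z z' : S.OmT} (h : S.bb z = S.bb z') (l : List I) :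
    S.bb (actw S.T l z) = S.bb (actw S.T l z') := by
  induction l with
  | nil => exact h
  | cons i l ih => simp only [actw, bb_T, ih]

lemma xx_jump (z : S.OmT) (k : ℕ) (w : List I) :
    S.xx (actw S.T w (S.sg^[k] z)) = (S.Hw w * (S.Hw (past (S.bb z) k))⁻¹) • S.xx z := by
  rw [xx_actw, mul_smul]
  congr 1
  conv_rhs => rw [S.xx_back z k]
  rw [inv_smul_smul]

/-- rotation of a jump -/
def rotj (β : ℕ → I) (w : List I) : V ≃ₗᵢ[ℝ] V := (S.rotw (past β w.length)).symm.trans (S.rotw w)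

lemma jump_u (β : ℕ → I) (w : List I) (t : V) :
    S.Hw w * (S.Hw (past β w.length))⁻¹ * S.u t =
      S.u (S.rotj β w t) * (S.Hw w * (S.Hw (past β w.length))⁻¹) := by
  have hl : S.lam ^ w.length ≠ 0 := pow_ne_zero _ (by linarith [S.one_lt_lam])
  set t' := (S.lam ^ w.length)⁻¹ • (S.rotw (past β w.length)).symm t with ht'
  have h1 := S.Hw_u (past β w.length) t'
  have h2 := S.Hw_u w t'
  rw [length_past] at h1
  have e1 : S.lam ^ w.length • S.rotw (past β w.length) t' = t := by
    rw [ht', map_smul, LinearIsometryEquiv.apply_symm_apply, smul_inv_smul₀ hl]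
  have e2 : S.lam ^ w.length • S.rotw w t' = S.rotj β w t := by
    rw [ht', map_smul, smul_inv_smul₀ hl]
    rfl
  rw [e1] at h1
  rw [e2] at h2
  rw [← h1, ← h2]
  group

lemma transport (z : S.OmT) (t : V) (w : List I) (h : (S.bb z, S.u t • S.xx z) ∈ S.Om) :
    (S.bb (actw S.T w (S.sg^[w.length] z)),
      S.u (S.rotj (S.bb z) w t) • S.xx (actw S.T w (S.sg^[w.length] z))) ∈ S.Om := by
  set z2 : S.OmT := ⟨(S.bb z, S.u t • S.xx z), h⟩ with hz2
  have hbb : S.bb z2 = S.bb z := rfl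
  have hxx : S.xx z2 = S.u t • S.xx z := rfl
  have h1 := (actw S.T w (S.sg^[w.length] z2)).2
  have h2 : (actw S.T w (S.sg^[w.length] z2)).1 = (S.bb (actw S.T w (S.sg^[w.length] z)),
      S.u (S.rotj (S.bb z) w t) • S.xx (actw S.T w (S.sg^[w.length] z))) := by
    refine Prod.ext ?_ ?_
    · exact S.bb_actw_congr (S.bb_sg_congr hbb _) w
    · change S.xx (actw S.T w (S.sg^[w.length] z2)) = _
      rw [xx_jump, xx_jump, hbb, hxx, ← mul_smul, ← mul_smul, jump_u]
  rwa [h2] at h1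

lemma D_transport {z : S.OmT} {j : ℕ} {s : ℕ → V} {e : ℝ} (hz : z ∈ S.D j s e) (w : List I) :
    actw S.T w (S.sg^[w.length] z) ∈ S.D j (fun i => S.rotj (S.bb z) w (s i)) e := by
  intro J hJ
  obtain ⟨t, ht, h⟩ := hz J hJ
  refine ⟨S.rotj (S.bb z) w t, by rwa [LinearIsometryEquiv.norm_map], ?_⟩
  have := S.transport z _ w h
  rwa [map_add, map_sum] at this

/-- the drift hypothesis -/
def Drift (a b : ℝ) : Prop := ∀ ρ, 0 < ρ → ∃ r, 0 < r ∧ ∀ g, g ∉ Set.range S.u → S.N g < r →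
  ∀ β : ℕ → I, ∃ k, ∃ good : Finset I, (3 / 4 : ℝ) * Fintype.card I ≤ good.card ∧
    ∀ i ∈ good, ∀ l : List I, l.length = k → ∃ g' τ,
      S.Hw (l ++ [i]) * (S.Hw (past β (k + 1)))⁻¹ * g * S.Hw (past β (k + 1)) *
        (S.Hw (l ++ [i]))⁻¹ = g' * S.u τ ∧ S.N g' ≤ ρ ∧ a ≤ ‖τ‖ ∧ ‖τ‖ ≤ b

theorem drift_step {a b : ℝ} (hdr : S.Drift a b) (hfree : S.Free) (hcard : 2 ≤ Fintype.card I)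
    (z0 : S.OmT) (m : Measure S.OmT) [IsProbabilityMeasure m]
    (hm : ∀ f : S.OmT → ℝ, Continuous f → ∫ w, f w ∂m = BL (fun k => (Pop S.T)^[k] f z0))
    (j : ℕ) (s : ℕ → V) (hs : s ∈ shells a b) (e ρ : ℝ) (hρ : 0 < ρ) :
    ENNReal.ofReal (3 / 4) * m (S.D j s e) ≤ m (S.Ed a b j e ρ) := by
  have hst : Stat S.T m := stationary_measurable S.T S.continuous_T m z0 hm
  obtain ⟨hHm, hH⟩ := doob S.T S.continuous_T S.sg S.continuous_sg.measurable S.sg_T hst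
    (S.isClosed_Ed a b j e ρ).measurableSet (3 / 4) (by norm_num)
  set H := {z | ∃ k, (3 / 4 : ℝ) ≤ (Pop S.T)^[k] ((S.Ed a b j e ρ).indicator 1) (S.sg^[k] z)} with hHdef
  obtain ⟨r, hr, hdr'⟩ := hdr ρ hρ
  have hnull : m (S.D j s e \ H) = 0 := by
    refine S.companion hfree hcard z0 m hm r hr _
      ((S.isClosed_D' j s e).measurableSet.diff hHm) ?_
    rintro z ⟨hz, hzH⟩ z' ⟨hz', -⟩ hbb g hg hgx
    by_contra hgu
    apply hzH
    obtain ⟨k, good, hgood, hgood'⟩ := hdr' g hgu hg (S.bb z)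
    refine ⟨k + 1, ?_⟩
    refine Pop_iter_indicator_ge S.T _ k _ good _ hgood ?_
    intro i hi l hl
    obtain ⟨g', τ, heq, hg', hτ⟩ := hgood' i hi l hl
    set w := l ++ [i] with hw
    have hwl : w.length = k + 1 := by simp [hw, hl]
    have h1 := S.D_transport hz w
    have h2 := S.D_transport hz' w
    rw [hwl] at h1 h2
    rw [← hbb] at h2
    refine ⟨((fun i => S.rotj (S.bb z) w (s i), τ, g'),
      (actw S.T w (S.sg^[k+1] z), actw S.T w (S.sg^[k+1] z'))), ⟨⟨?_, hτ, h1, h2, ?_, ?_⟩, hg'⟩, rfl⟩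
    · intro i' _
      have := hs i' trivial
      simpa [shell] using this
    · exact S.bb_actw_congr (S.bb_sg_congr hbb _) w
    · change S.xx (actw S.T w (S.sg^[k+1] z')) = (g' * S.u τ) • S.xx (actw S.T w (S.sg^[k+1] z))
      rw [xx_jump, xx_jump, ← heq, ← hbb, ← hgx]
      simp only [← mul_smul]
      congr 1
      group
  calc ENNReal.ofReal (3 / 4) * m (S.D j s e) ≤ ENNReal.ofReal (3 / 4) * m H := by
        gcongr ENNReal.ofReal (3 / 4) * ?_
        exact (measure_le_inter_add_diff m _ H).trans (by
          rw [hnull, add_zero]; exact measure_mono Set.inter_subset_right)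
    _ ≤ _ := hH

lemma D_subset {j : ℕ} {s s' : ℕ → V} {e e' : ℝ} (h : ∀ i < j, ‖s i - s' i‖ ≤ e' / (j + 1))
    (he' : 0 ≤ e') :
    S.D j s e ⊆ S.D j s' (e + e') := by
  intro z hz J hJ
  obtain ⟨t, ht, hO⟩ := hz J hJ
  refine ⟨∑ i ∈ J, (s i - s' i) + t, ?_, ?_⟩
  · have h1 : ‖∑ i ∈ J, (s i - s' i)‖ ≤ J.card * (e' / (j + 1)) := by
      refine (norm_sum_le _ _).trans ?_
      rw [← nsmul_eq_mul]
      exact Finset.sum_le_card_nsmul _ _ _ fun i hi => h i (Finset.mem_range.1 (hJ hi))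
    have h2 : (J.card : ℝ) ≤ j := by
      have := Finset.card_le_card hJ
      rw [Finset.card_range] at this
      exact_mod_cast this
    have h3 : (J.card : ℝ) * (e' / (j + 1)) ≤ e' := by
      rw [mul_div_assoc', div_le_iff₀ (by positivity)]
      nlinarith
    exact (norm_add_le _ _).trans (by linarith)
  · convert hO using 4
    rw [Finset.sum_sub_distrib]
    abel

theorem D_pos {a b : ℝ} (hab : (shell (V := V) a b).Nonempty)
    (hdr : S.Drift a b) (hfree : S.Free) (hcard : 2 ≤ Fintype.card I)
    (z0 : S.OmT) (m : Measure S.OmT) [IsProbabilityMeasure m]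
    (hm : ∀ f : S.OmT → ℝ, Continuous f → ∫ w, f w ∂m = BL (fun k => (Pop S.T)^[k] f z0))
    (j : ℕ) : ∀ e, 0 < e → m (⋃ s ∈ shells (V := V) a b, S.D j s e) ≠ 0 := by
  induction j with
  | zero =>
    intro e he
    obtain ⟨t0, ht0⟩ := hab
    have : (⋃ s ∈ shells (V := V) a b, S.D 0 s e) = Set.univ := by
      refine Set.eq_univ_of_forall fun z => Set.mem_biUnion (x := fun _ => t0) (fun _ _ => ht0) ?_
      intro J hJ
      refine ⟨0, by simpa using he.le, ?_⟩
      obtain rfl : J = ∅ := by simpa using hJ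
      simp only [Finset.sum_empty, add_zero, S.u_zero, one_smul]
      exact z.2
    rw [this, measure_univ]
    exact one_ne_zero
  | succ j ih =>
    intro e he
    have h1 := ih (e / 2) (by positivity)
    have hopen : ∀ s0 ∈ shells (V := V) a b,
        {s : ℕ → V | ∀ i < j, ‖s i - s0 i‖ < (e / 2) / (j + 1)} ∈ 𝓝 s0 := by
      intro s0 _
      have : {s : ℕ → V | ∀ i < j, ‖s i - s0 i‖ < (e / 2) / (j + 1)} =
          ⋂ i ∈ Set.Iio j, {s : ℕ → V | ‖s i - s0 i‖ < (e / 2) / (j + 1)} := by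
        ext s; simp
      rw [this]
      refine (Set.finite_Iio j).isOpen_biInter (fun i _ => ?_) |>.mem_nhds ?_
      · exact isOpen_lt (by fun_prop) continuous_const
      · simp only [Set.mem_iInter, Set.mem_setOf_eq, sub_self, norm_zero]
        intros; positivity
    obtain ⟨net, hnet, hcov⟩ := (isCompact_shells (V := V) a b).elim_nhds_subcover _ hopen
    have h2 : (⋃ s ∈ shells (V := V) a b, S.D j s (e / 2)) ⊆ ⋃ s0 ∈ net, S.D j s0 e := by
      refine Set.iUnion₂_subset fun s hs => ?_
      obtain ⟨s0, hs0, hss⟩ := Set.mem_iUnion₂.1 (hcov hs)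
      refine (S.D_subset (e := e / 2) (e' := e / 2) (fun i hi => (hss i hi).le) (by positivity)).trans ?_
      rw [add_halves]
      exact Set.subset_biUnion_of_mem (u := fun s0 => S.D j s0 e) hs0
    have h3 : ∃ s0 ∈ net, m (S.D j s0 e) ≠ 0 := by
      by_contra hcon
      push Not at hcon
      refine h1 (measure_mono_null h2 ?_)
      exact (measure_biUnion_null_iff net.countable_toSet).2 hcon
    obtain ⟨s0, hs0, hpos⟩ := h3
    have h4 : ∀ n : ℕ, ENNReal.ofReal (3 / 4) * m (S.D j s0 e) ≤ m (S.Ed a b j e (1 / (n + 1))) :=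
      fun n => S.drift_step hdr hfree hcard z0 m hm j s0 (hnet s0 hs0) e _ (by positivity)
    have h5 := tendsto_measure_iInter_atTop (μ := m) (s := fun n : ℕ => S.Ed a b j e (1 / (n + 1)))
      (fun n => (S.isClosed_Ed a b j e _).measurableSet.nullMeasurableSet)
      (antitone_nat_of_succ_le fun n => S.Ed_mono a b j e (by
        push_cast
        gcongr
        linarith)) ⟨0, measure_ne_top _ _⟩
    have h6 : ENNReal.ofReal (3 / 4) * m (S.D j s0 e) ≤ m (⋂ n : ℕ, S.Ed a b j e (1 / (n + 1))) :=
      ge_of_tendsto' h5 h4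
    intro h0
    have h7 := measure_mono_null (S.iInter_Ed a b j e) h0
    rw [h7] at h6
    have h8 := le_antisymm h6 bot_le
    rw [mul_eq_zero] at h8
    rcases h8 with h8 | h8
    · norm_num at h8
    · exact hpos h8

/-- Abstract conclusion, first form: all finite sums are return times. -/
theorem exists_sums {a b : ℝ} (hab : (shell (V := V) a b).Nonempty)
    (hdr : S.Drift a b) (hfree : S.Free) (hcard : 2 ≤ Fintype.card I) (hY : S.Y.Nonempty) :
    ∃ s ∈ shells (V := V) a b, ∃ z : S.OmT, ∀ J : Finset ℕ,
      (S.bb z, S.u (∑ i ∈ J, s i) • S.xx z) ∈ S.Om := by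
  obtain ⟨z00, hz00⟩ := S.Om_nonempty hY
  set z0 : S.OmT := ⟨z00, hz00⟩
  obtain ⟨m, hmp, hm⟩ := exists_stationary S.T z0
  set Q : ℕ → Set ((ℕ → V) × S.OmT) := fun n =>
    (shells a b ×ˢ Set.univ) ∩ {p | p.2 ∈ S.D n p.1 (1 / ((n : ℝ) + 1))} with hQ
  have hQc : ∀ n, IsCompact (Q n) := fun n =>
    ((isCompact_shells a b).prod isCompact_univ).inter_right (S.isClosed_D n _)
  obtain ⟨p, hp⟩ := IsCompact.nonempty_iInter_of_sequence_nonempty_isCompact_isClosed Q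
    (fun n p hp => ⟨hp.1, fun J hJ => by
      obtain ⟨t, ht, h⟩ := hp.2 J (hJ.trans (Finset.range_mono (by omega)))
      refine ⟨t, ht.trans ?_, h⟩
      push_cast
      gcongr
      linarith⟩)
    (fun n => by
      have h1 := S.D_pos hab hdr hfree hcard z0 m hm n (1 / ((n:ℝ) + 1)) (by positivity)
      obtain ⟨z, hz⟩ := nonempty_of_measure_ne_zero h1
      obtain ⟨s, hs, hz⟩ := Set.mem_iUnion₂.1 hz
      exact ⟨(s, z), ⟨hs, trivial⟩, hz⟩) (hQc 0) (fun n => (hQc n).isClosed)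
  rw [Set.mem_iInter] at hp
  obtain ⟨s, z⟩ := p
  refine ⟨s, (hp 0).1.1, z, fun J => ?_⟩
  obtain ⟨n0, hn0⟩ : ∃ n0, J ⊆ Finset.range n0 := Finset.exists_nat_subset_range J
  have h1 : ∀ n, ∃ t : V, ‖t‖ ≤ 1 / (((n + n0 : ℕ) : ℝ) + 1) ∧
      (S.bb z, S.u (∑ i ∈ J, s i + t) • S.xx z) ∈ S.Om := fun n =>
    (hp (n + n0)).2 J (hn0.trans (Finset.range_mono (by omega)))
  choose t ht h using h1
  have ht0 : Tendsto t atTop (𝓝 0) := by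
    refine squeeze_zero_norm ht ?_
    exact (tendsto_add_atTop_iff_nat (f := fun n : ℕ => 1 / ((n:ℝ) + 1)) n0).2
      tendsto_one_div_add_atTop_nhds_zero_nat
  have hc : Continuous fun t : V => (S.bb z, S.u (∑ i ∈ J, s i + t) • S.xx z) :=
    continuous_const.prodMk ((S.u_cont.comp (by fun_prop)).smul continuous_const)
  have h2 := S.isClosed_Om.mem_of_tendsto ((hc.tendsto 0).comp ht0) (Eventually.of_forall h)
  simpa using h2

/-- Abstract conclusion. -/
theorem exists_line {a b : ℝ} (hab : (shell (V := V) a b).Nonempty)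
    (hdr : S.Drift a b) (hfree : S.Free) (hcard : 2 ≤ Fintype.card I) (hY : S.Y.Nonempty) :
    ∃ s : V, a ≤ ‖s‖ ∧ ‖s‖ ≤ b ∧ ∃ (β : ℕ → I) (x : X), ∀ k : ℤ,
      (β, S.u ((k : ℝ) • s) • x) ∈ S.Om := by
  obtain ⟨s, hs, z, hz⟩ := S.exists_sums hab hdr hfree hcard hY
  obtain ⟨s0, hs0, φ, hφ, hlim⟩ := (isCompact_shell (V := V) a b).tendsto_subseq
    (fun n => hs n trivial)
  have hsum : ∀ p m : ℕ, (S.bb z, S.u (∑ i ∈ Finset.range p, s (φ (m + i))) • S.xx z) ∈ S.Om := by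
    intro p m
    have := hz ((Finset.range p).map ⟨fun i => φ (m + i), fun i i' h => by
      have := hφ.injective h
      omega⟩)
    rwa [Finset.sum_map] at this
  set y : ℕ → (ℕ → I) × X := fun m =>
    (S.bb z, S.u (∑ i ∈ Finset.range m, s (φ (m + i))) • S.xx z) with hy
  obtain ⟨y0, hy0, ψ, hψ, hylim⟩ : ∃ y0 ∈ S.Om, ∃ ψ : ℕ → ℕ, StrictMono ψ ∧
      Tendsto (y ∘ ψ) atTop (𝓝 y0) := by
    let _ := TopologicalSpace.metrizableSpaceMetric ((ℕ → I) × X)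
    exact S.isCompact_Om.tendsto_subseq (fun m => hsum m m)
  have hy1 : y0.1 = S.bb z := by
    have h1 : Tendsto (fun m => (y (ψ m)).1) atTop (𝓝 y0.1) :=
      (continuous_fst.tendsto _).comp hylim
    exact tendsto_nhds_unique h1 tendsto_const_nhds
  -- differences
  have hdiff : ∀ k : ℤ, ∃ p : ℕ → ℕ, Tendsto (fun m => ∑ i ∈ Finset.range (p m), s (φ (m + i)) -
      ∑ i ∈ Finset.range m, s (φ (m + i))) atTop (𝓝 ((k : ℝ) • s0)) := by
    have hshift : ∀ (f : ℕ → ℕ), Tendsto f atTop atTop →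
        Tendsto (fun m => s (φ (f m))) atTop (𝓝 s0) := fun f hf => hlim.comp hf
    intro k
    obtain ⟨n, rfl | rfl⟩ := k.eq_nat_or_neg
    · refine ⟨fun m => m + n, ?_⟩
      have h1 : Tendsto (fun m => ∑ j ∈ Finset.range n, s (φ (m + (m + j)))) atTop
          (𝓝 (∑ j ∈ Finset.range n, s0)) := by
        refine tendsto_finsetSum _ fun j _ => hshift _ ?_
        exact tendsto_atTop_mono (fun m => (by omega : m ≤ m + (m + j))) tendsto_id
      have h2 : ∑ j ∈ Finset.range n, s0 = (((n : ℕ) : ℤ) : ℝ) • s0 := by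
        simp [← Nat.cast_smul_eq_nsmul ℝ]
      rw [h2] at h1
      refine h1.congr fun m => ?_
      rw [Finset.sum_range_add, add_sub_cancel_left]
    · refine ⟨fun m => m - n, ?_⟩
      have h1 : Tendsto (fun m => - ∑ j ∈ Finset.range n, s (φ (m + ((m - n) + j)))) atTop
          (𝓝 (- ∑ j ∈ Finset.range n, s0)) := by
        refine (tendsto_finsetSum _ fun j _ => hshift _ ?_).neg
        exact tendsto_atTop_mono (fun m => (by omega : m ≤ m + ((m - n) + j))) tendsto_id
      have h2 : - ∑ j ∈ Finset.range n, s0 = ((-((n : ℕ) : ℤ) : ℤ) : ℝ) • s0 := by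
        simp [← Nat.cast_smul_eq_nsmul ℝ]
      rw [h2] at h1
      refine h1.congr' ?_
      filter_upwards [eventually_ge_atTop n] with m hm
      have h3 := Finset.sum_range_add (fun i => s (φ (m + i))) (m - n) n
      rw [Nat.sub_add_cancel hm] at h3
      rw [h3]
      abel
  refine ⟨s0, hs0.1, hs0.2, S.bb z, y0.2, fun k => ?_⟩
  obtain ⟨p, hp⟩ := hdiff k
  have hp' := hp.comp hψ.tendsto_atTop
  have hlim2 : Tendsto (fun m => (S.bb z, S.u (∑ i ∈ Finset.range (p (ψ m)), s (φ (ψ m + i)) -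
      ∑ i ∈ Finset.range (ψ m), s (φ (ψ m + i))) • (y (ψ m)).2)) atTop
      (𝓝 (S.bb z, S.u ((k:ℝ) • s0) • y0.2)) := by
    refine Tendsto.prodMk_nhds tendsto_const_nhds (Tendsto.smul ?_ ?_)
    · exact (S.u_cont.tendsto _).comp hp'
    · exact (continuous_snd.tendsto _).comp hylim
  refine S.isClosed_Om.mem_of_tendsto hlim2 (Eventually.of_forall fun m => ?_)
  have := hsum (p (ψ m)) (ψ m)
  simp only [hy, ← mul_smul, ← S.u_add, sub_add_cancel]
  exact this

end Sys

end DriftBA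

end

section

namespace DriftBA

set_option linter.unusedSectionVars false
set_option linter.unusedSimpArgs false
set_option linter.unusedVariables false
set_option linter.deprecated false

section Lattice

variable {ι : Type*} [Fintype ι] [DecidableEq ι]

/-- integer vector as a real vector -/
def zv (v : ι → ℤ) : ι → ℝ := fun i => (v i : ℝ)

lemma zv_ne_zero {v : ι → ℤ} (h : v ≠ 0) : zv v ≠ 0 := by
  intro h0
  apply h
  ext i
  have := congrFun h0 i
  simpa [zv] using this

lemma minkowski (A : Matrix ι ι ℝ) (h0 : A.det ≠ 0) (h1 : |A.det| < 1) :
    ∃ v : ι → ℤ, v ≠ 0 ∧ ‖A.mulVec (zv v)‖ ≤ 1 := by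
  set b := Pi.basisFun ℝ ι with hb
  set L : AddSubgroup (ι → ℝ) := (Submodule.span ℤ (Set.range b)).toAddSubgroup with hL
  have hfund := ZSpan.isAddFundamentalDomain' b volume
  have hcount : Countable L := by
    change Countable (Submodule.span ℤ (Set.range b))
    infer_instance
  set s : Set (ι → ℝ) := (Matrix.toLin' A) ⁻¹' Metric.closedBall 0 1 with hs
  have hdet : LinearMap.det (Matrix.toLin' A) ≠ 0 := by rwa [LinearMap.det_toLin']
  have hvolF : volume (ZSpan.fundamentalDomain b) = 1 := by
    rw [ZSpan.volume_fundamentalDomain]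
    have : Matrix.of (b : ι → ι → ℝ) = 1 := by
      ext i j
      simp [hb, Matrix.one_apply, Pi.single_apply, eq_comm]
    simp [this]
  have hvols : volume s = ENNReal.ofReal |(A.det)⁻¹| * 2 ^ Fintype.card ι := by
    rw [hs, Measure.addHaar_preimage_linearMap volume hdet, LinearMap.det_toLin',
      Real.volume_pi_closedBall _ zero_le_one]
    simp
  obtain ⟨x, hx0, hx⟩ := exists_ne_zero_mem_lattice_of_measure_mul_two_pow_lt_measure (s := s) hfund
    (fun x hx => by
      simp only [hs, Set.mem_preimage, map_neg, mem_closedBall_zero_iff, norm_neg] at hx ⊢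
      exact hx)
    ((convex_closedBall 0 1).linear_preimage _) (by
      rw [hvolF, hvols, one_mul, Module.finrank_fintype_fun_eq_card]
      have h2 : (1 : ENNReal) < ENNReal.ofReal |(A.det)⁻¹| := by
        rw [ENNReal.one_lt_ofReal, abs_inv]
        exact (one_lt_inv₀ (abs_pos.2 h0)).2 h1
      calc (2 : ENNReal) ^ Fintype.card ι = 1 * 2 ^ Fintype.card ι := (one_mul _).symm
        _ < _ := ENNReal.mul_lt_mul_left (by simp) (by simp) h2)
  have hmem : (x : ι → ℝ) ∈ Submodule.span ℤ (Set.range b) := x.2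
  rw [b.mem_span_iff_repr_mem ℤ] at hmem
  choose v hv using hmem
  have hxv : (x : ι → ℝ) = zv v := by
    ext i
    have := hv i
    simp [hb] at this
    simp [zv, this]
  refine ⟨v, ?_, ?_⟩
  · rintro rfl
    apply hx0
    ext i
    rw [hxv]
    simp [zv]
  · rw [← hxv]
    simpa [hs] using hx

/-- Minkowski tube. -/
lemma tube (ε : ℝ) (hε : 0 < ε) : ∃ T : ℝ, 0 < T ∧ ∀ (g : Matrix ι ι ℝ), |g.det| = 1 →
    ∀ ω : ι → ℝ, ω ⬝ᵥ ω = 1 → ∃ v : ι → ℤ, v ≠ 0 ∧ ∃ y : ι → ℝ, ‖y‖ ≤ 1 ∧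
      g.mulVec (zv v) = ε • y + (ε * T * (ω ⬝ᵥ y)) • ω := by
  set T : ℝ := (ε ^ Fintype.card ι)⁻¹ with hT
  have hTpos : 0 < T := by positivity
  refine ⟨T, hTpos, fun g hg ω hω => ?_⟩
  set P : Matrix ι ι ℝ := 1 + Matrix.replicateCol Unit (T • ω) * Matrix.replicateRow Unit ω with hP
  set D : Matrix ι ι ℝ := ε • P with hD
  have hPdet : P.det = 1 + T := by
    rw [hP, Matrix.det_one_add_replicateCol_mul_replicateRow, dotProduct_smul, hω]
    simp
  have hDdet : D.det = ε ^ Fintype.card ι * (1 + T) := by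
    rw [hD, Matrix.det_smul, hPdet]
  have hDpos : 1 < D.det := by
    rw [hDdet, mul_add, hT, mul_inv_cancel₀ (by positivity)]
    have : 0 < ε ^ Fintype.card ι := by positivity
    linarith
  have hDu : IsUnit D.det := (by linarith : D.det ≠ 0).isUnit
  have hg0 : g.det ≠ 0 := by
    intro h; rw [h] at hg; simp at hg
  obtain ⟨v, hv0, hv⟩ := minkowski (D⁻¹ * g) (by
    rw [Matrix.det_mul, Matrix.det_nonsing_inv]
    simp [hg0]
    linarith) (by
    rw [Matrix.det_mul, Matrix.det_nonsing_inv, abs_mul, hg, mul_one, Ring.inverse_eq_inv', abs_inv]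
    rw [abs_of_pos (by linarith)]
    exact inv_lt_one_of_one_lt₀ hDpos)
  refine ⟨v, hv0, (D⁻¹ * g).mulVec (zv v), hv, ?_⟩
  set y := (D⁻¹ * g).mulVec (zv v) with hy
  have h1 : g.mulVec (zv v) = D.mulVec y := by
    rw [hy, Matrix.mulVec_mulVec, ← Matrix.mul_assoc, Matrix.mul_nonsing_inv _ hDu, Matrix.one_mul]
  rw [h1, hD, Matrix.smul_mulVec, hP, Matrix.add_mulVec, Matrix.one_mulVec, smul_add]
  congr 1
  ext i
  simp only [Matrix.mulVec, dotProduct, Matrix.mul_apply, Matrix.replicateCol_apply,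
    Matrix.replicateRow_apply, Pi.smul_apply, smul_eq_mul, Finset.univ_unique, Finset.sum_const,
    Finset.card_singleton, one_smul, Finset.mul_sum, Finset.sum_mul]
  exact Finset.sum_congr rfl fun x _ => by ring

end Lattice

end DriftBA

end

section

namespace DriftBA

set_option linter.unusedSectionVars false
set_option linter.unusedSimpArgs false
set_option linter.unusedVariables false
set_option linter.deprecated false

section Mahler

variable {ι : Type*} [Fintype ι] [DecidableEq ι]

/-- sum norm of a matrix -/
def mn (A : Matrix ι ι ℝ) : ℝ := ∑ i, ∑ j, |A i j|

lemma mn_nonneg (A : Matrix ι ι ℝ) : 0 ≤ mn A :=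
  Finset.sum_nonneg fun _ _ => Finset.sum_nonneg fun _ _ => abs_nonneg _

lemma le_mn (A : Matrix ι ι ℝ) (i j : ι) : |A i j| ≤ mn A :=
  (Finset.single_le_sum (f := fun j => |A i j|) (fun _ _ => abs_nonneg _) (Finset.mem_univ j)).trans
    (Finset.single_le_sum (f := fun i => ∑ j, |A i j|)
      (fun _ _ => Finset.sum_nonneg fun _ _ => abs_nonneg _) (Finset.mem_univ i))

lemma mn_add (A B : Matrix ι ι ℝ) : mn (A + B) ≤ mn A + mn B := by
  simp only [mn, ← Finset.sum_add_distrib]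
  exact Finset.sum_le_sum fun i _ => Finset.sum_le_sum fun j _ => abs_add_le _ _

lemma mn_smul (c : ℝ) (A : Matrix ι ι ℝ) : mn (c • A) = |c| * mn A := by
  simp only [mn, Finset.mul_sum, Matrix.smul_apply, smul_eq_mul, abs_mul]

lemma mn_neg (A : Matrix ι ι ℝ) : mn (-A) = mn A := by
  simp [mn]

lemma mn_sub (A B : Matrix ι ι ℝ) : mn (A - B) ≤ mn A + mn B := by
  rw [sub_eq_add_neg, ← mn_neg B]; exact mn_add _ _

lemma mn_zero : mn (0 : Matrix ι ι ℝ) = 0 := by simp [mn]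

lemma mn_eq_zero {A : Matrix ι ι ℝ} : mn A = 0 ↔ A = 0 := by
  refine ⟨fun h => ?_, fun h => by rw [h, mn_zero]⟩
  ext i j
  have := le_mn A i j
  rw [h] at this
  simpa using this

lemma mn_continuous : Continuous (mn : Matrix ι ι ℝ → ℝ) := by
  unfold mn; fun_prop

lemma mn_mul (A B : Matrix ι ι ℝ) : mn (A * B) ≤ mn A * mn B := by
  calc mn (A * B) ≤ ∑ i, ∑ j, ∑ k, |A i k| * |B k j| := by
        refine Finset.sum_le_sum fun i _ => Finset.sum_le_sum fun j _ => ?_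
        rw [Matrix.mul_apply]
        refine (Finset.abs_sum_le_sum_abs _ _).trans (le_of_eq ?_)
        simp [abs_mul]
    _ = ∑ i, ∑ k, |A i k| * ∑ j, |B k j| := by
        refine Finset.sum_congr rfl fun i _ => ?_
        rw [Finset.sum_comm]
        simp [Finset.mul_sum]
    _ ≤ ∑ i, ∑ k, |A i k| * mn B := by
        refine Finset.sum_le_sum fun i _ => Finset.sum_le_sum fun k _ => ?_
        refine mul_le_mul_of_nonneg_left ?_ (abs_nonneg _)
        exact Finset.single_le_sum (f := fun i => ∑ j, |B i j|)
          (fun _ _ => Finset.sum_nonneg fun _ _ => abs_nonneg _) (Finset.mem_univ k)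
    _ = mn A * mn B := by simp [mn, Finset.sum_mul]

lemma mn_mulVec (A : Matrix ι ι ℝ) (v : ι → ℝ) : ‖A.mulVec v‖ ≤ mn A * ‖v‖ := by
  refine (pi_norm_le_iff_of_nonneg (mul_nonneg (mn_nonneg _) (norm_nonneg _))).2 fun i => ?_
  rw [Matrix.mulVec, dotProduct, Real.norm_eq_abs]
  calc |∑ j, A i j * v j| ≤ ∑ j, |A i j| * ‖v‖ := by
        refine (Finset.abs_sum_le_sum_abs _ _).trans (Finset.sum_le_sum fun j _ => ?_)
        rw [abs_mul]
        exact mul_le_mul_of_nonneg_left (norm_le_pi_norm v j) (abs_nonneg _)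
    _ = (∑ j, |A i j|) * ‖v‖ := by rw [Finset.sum_mul]
    _ ≤ _ := mul_le_mul_of_nonneg_right (Finset.single_le_sum (f := fun i => ∑ j, |A i j|)
          (fun _ _ => Finset.sum_nonneg fun _ _ => abs_nonneg _) (Finset.mem_univ i)) (norm_nonneg _)

lemma mn_le_of_entries {A : Matrix ι ι ℝ} {R : ℝ} (h : ∀ i j, |A i j| ≤ R) :
    mn A ≤ Fintype.card ι * (Fintype.card ι * R) := by
  calc mn A ≤ ∑ i : ι, ∑ j : ι, R := Finset.sum_le_sum fun i _ => Finset.sum_le_sum fun j _ => h i j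
    _ = _ := by simp

lemma mn_compact (r : ℝ) : IsCompact {A : Matrix ι ι ℝ | mn A ≤ r} := by
  refine IsCompact.of_isClosed_subset (isCompact_univ_pi (s := fun _ : ι => Set.univ.pi
    fun _ : ι => Metric.closedBall (0 : ℝ) r) fun i => isCompact_univ_pi fun j => isCompact_closedBall _ _)
    (isClosed_le mn_continuous continuous_const) ?_
  intro A hA i _ j _
  simp only [mem_closedBall_zero_iff, Real.norm_eq_abs]
  exact (le_mn A i j).trans hA

/-- all nonzero lattice vectors have norm at least `ε`. -/
def good (ε : ℝ) (g : Matrix ι ι ℝ) : Prop := ∀ v : ι → ℤ, v ≠ 0 → ε ≤ ‖g.mulVec (zv v)‖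

lemma zv_col_mul (m : Matrix ι ι ℤ) (g : Matrix ι ι ℝ) (i j : ι) :
    (g * m.map (Int.cast : ℤ → ℝ)) i j = g.mulVec (zv (fun k => m k j)) i := by
  simp [Matrix.mul_apply, Matrix.mulVec, dotProduct, zv]

lemma short_basis [Nonempty ι] (ε : ℝ) (hε : 0 < ε) : ∃ R : ℝ, 0 < R ∧ ∀ g : Matrix ι ι ℝ, g.det = 1 → good ε g →
    ∃ m : Matrix ι ι ℤ, m.det ≠ 0 ∧ ∀ i j, |(g * m.map (Int.cast : ℤ → ℝ)) i j| ≤ R := by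
  obtain ⟨T, hT, htube⟩ := tube (ι := ι) (ε / 2) (by linarith)
  set n : ℝ := (Fintype.card ι : ℝ) with hn
  have hn0 : 0 ≤ n := by positivity
  set R : ℝ := ε / 2 * (1 + T * n) with hR
  have hRpos : 0 < R := by positivity
  refine ⟨R, hRpos, fun g hg hgood => ?_⟩
  set s : Set (ι → ℝ) := {w | ‖w‖ ≤ R ∧ ∃ v : ι → ℤ, w = g.mulVec (zv v)} with hs
  have htop : ⊤ ≤ Submodule.span ℝ s := by
    by_contra hlt
    have hlt' : Submodule.span ℝ s < ⊤ := lt_top_iff_ne_top.2 fun h => hlt (le_of_eq h.symm)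
    obtain ⟨f, hf0, hf⟩ := Submodule.exists_le_ker_of_lt_top _ hlt'
    set ω0 : ι → ℝ := fun i => f (Pi.single i 1) with hω0
    have hfω : ∀ x, f x = ω0 ⬝ᵥ x := by
      intro x
      conv_lhs => rw [pi_eq_sum_univ' x]
      simp only [map_sum, dotProduct, hω0]
      refine Finset.sum_congr rfl fun i _ => ?_
      have : (fun j => if i = j then (1:ℝ) else 0) = Pi.single i 1 := by
        ext j; simp [Pi.single_apply, eq_comm]
      rw [map_smul, smul_eq_mul, mul_comm]
    have hω0ne : ω0 ≠ 0 := by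
      intro h
      apply hf0
      ext i
      simp [hfω, h]
    have hpos : 0 < ω0 ⬝ᵥ ω0 := by
      obtain ⟨i, hi⟩ := Function.ne_iff.1 hω0ne
      exact Finset.sum_pos' (fun j _ => mul_self_nonneg _) ⟨i, Finset.mem_univ i, by
        exact mul_self_pos.2 hi⟩
    set c : ℝ := (Real.sqrt (ω0 ⬝ᵥ ω0))⁻¹ with hc
    set ω : ι → ℝ := c • ω0 with hω
    have hωω : ω ⬝ᵥ ω = 1 := by
      rw [hω, smul_dotProduct, dotProduct_smul, smul_eq_mul, smul_eq_mul, ← mul_assoc, hc, ← mul_inv,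
        Real.mul_self_sqrt hpos.le, inv_mul_cancel₀ hpos.ne']
    have hωle : ∀ i, |ω i| ≤ 1 := by
      intro i
      have : ω i * ω i ≤ 1 := by
        rw [← hωω]
        exact Finset.single_le_sum (f := fun i => ω i * ω i) (fun j _ => mul_self_nonneg _) (Finset.mem_univ i)
      exact abs_le_one_iff_mul_self_le_one.2 this
    obtain ⟨v, hv0, y, hy, hgv⟩ := htube g (by rw [hg]; simp) ω hωω
    have hωy : |ω ⬝ᵥ y| ≤ n := by
      calc |∑ i, ω i * y i| ≤ ∑ i : ι, (1:ℝ) := by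
            refine (Finset.abs_sum_le_sum_abs _ _).trans (Finset.sum_le_sum fun i _ => ?_)
            rw [abs_mul]
            exact mul_le_one₀ (hωle i) (abs_nonneg _) ((norm_le_pi_norm y i).trans hy)
        _ = n := by simp [hn]
    have hωn : ‖ω‖ ≤ 1 := (pi_norm_le_iff_of_nonneg zero_le_one).2 fun i => hωle i
    have hshort : ‖g.mulVec (zv v)‖ ≤ R := by
      rw [hgv]
      refine (norm_add_le _ _).trans ?_
      rw [norm_smul, norm_smul, Real.norm_eq_abs, Real.norm_eq_abs, abs_mul, abs_mul, abs_of_pos hT,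
        abs_of_pos (by linarith : 0 < ε/2), hR, mul_add, mul_one, ← mul_assoc]
      refine add_le_add ?_ ?_
      · exact mul_le_of_le_one_right (by linarith) hy
      · exact (mul_le_of_le_one_right (by positivity) hωn).trans
          (mul_le_mul_of_nonneg_left hωy (by positivity))
    have hker : f (g.mulVec (zv v)) = 0 := by
      have : g.mulVec (zv v) ∈ Submodule.span ℝ s := Submodule.subset_span ⟨hshort, v, rfl⟩
      exact hf this
    have h0 : ω ⬝ᵥ g.mulVec (zv v) = 0 := by
      rw [hω, smul_dotProduct, ← hfω, hker, smul_zero]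
    rw [hgv, dotProduct_add, dotProduct_smul, dotProduct_smul, hωω, smul_eq_mul, smul_eq_mul] at h0
    have hy0 : ω ⬝ᵥ y = 0 := by
      have h1 : (ω ⬝ᵥ y) * (ε / 2 * (1 + T)) = 0 := by linarith
      rcases mul_eq_zero.1 h1 with h | h
      · exact h
      · have : 0 < ε / 2 * (1 + T) := by positivity
        linarith
    have := hgood v hv0
    rw [hgv, hy0, mul_zero, zero_smul, add_zero, norm_smul, Real.norm_eq_abs,
      abs_of_pos (by linarith : 0 < ε/2)] at this
    nlinarith
  set b0 := Module.Basis.ofSpan htop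
  let e := b0.indexEquiv (Pi.basisFun ℝ ι)
  set b := b0.reindex e with hb
  have hbs : ∀ i, b i ∈ s := by
    intro i
    apply Module.Basis.ofSpan_subset htop
    exact ⟨e.symm i, by simp [hb, b0]⟩
  choose hbn v hv using hbs
  refine ⟨Matrix.of fun i j => v j i, ?_, fun i j => ?_⟩
  · intro hdet
    set m : Matrix ι ι ℤ := Matrix.of fun i j => v j i with hm
    have h1 : (g * m.map (Int.cast : ℤ → ℝ)) = (Pi.basisFun ℝ ι).toMatrix b := by
      ext i j
      rw [zv_col_mul, Module.Basis.toMatrix_apply, Pi.basisFun_repr, hv j]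
      rfl
    have h2 : (g * m.map (Int.cast : ℤ → ℝ)).det = 0 := by
      rw [Matrix.det_mul]
      have : (m.map (Int.cast : ℤ → ℝ)).det = ((m.det : ℤ) : ℝ) := by
        simpa using (RingHom.map_det (Int.castRingHom ℝ) m).symm
      rw [this, hdet]; simp
    rw [h1] at h2
    have h3 := (Pi.basisFun ℝ ι).toMatrix_mul_toMatrix_flip b
    have h4 := congrArg Matrix.det h3
    rw [Matrix.det_mul, h2] at h4
    simp at h4
  · rw [zv_col_mul]
    have := hbn j
    rw [hv j] at this
    exact (norm_le_pi_norm _ i).trans this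

lemma finite_reps (D0 : ℕ) : ∃ B : ℝ, 0 ≤ B ∧ ∀ m : Matrix ι ι ℤ, m.det ≠ 0 → m.det.natAbs ≤ D0 →
    ∃ (γ : Matrix.SpecialLinearGroup ι ℤ) (W : Matrix ι ι ℝ), mn W ≤ B ∧
      (γ : Matrix ι ι ℤ).map (Int.cast : ℤ → ℝ) = m.map (Int.cast : ℤ → ℝ) * W := by
  classical
  set M := D0.factorial with hM
  haveI : NeZero M := ⟨Nat.factorial_ne_zero _⟩
  let Key := (Finset.Icc (-(D0:ℤ)) D0) × Matrix ι ι (ZMod M)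
  have key : ∀ k : Key, ∃ B : ℝ, 0 ≤ B ∧ ∀ m : Matrix ι ι ℤ, m.det ≠ 0 → m.det = k.1 →
      m.map (Int.cast : ℤ → ZMod M) = k.2 →
      ∃ (γ : Matrix.SpecialLinearGroup ι ℤ) (W : Matrix ι ι ℝ), mn W ≤ B ∧
      (γ : Matrix ι ι ℤ).map (Int.cast : ℤ → ℝ) = m.map (Int.cast : ℤ → ℝ) * W := by
    intro k
    by_cases hex : ∃ m0 : Matrix ι ι ℤ, m0.det ≠ 0 ∧ m0.det = k.1 ∧ m0.map (Int.cast : ℤ → ZMod M) = k.2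
    · obtain ⟨m0, h00, h0d, h0m⟩ := hex
      refine ⟨mn ((m0.map (Int.cast : ℤ → ℝ))⁻¹), mn_nonneg _, fun m hm hd hmm => ?_⟩
      set D := m0.det with hD
      have hDM : D ∣ (M : ℤ) := by
        have h1 : D.natAbs ≤ D0 := by
          have := k.1.2
          rw [← h0d, Finset.mem_Icc] at this
          omega
        have h2 : D.natAbs ∣ M := Nat.dvd_factorial (Int.natAbs_pos.2 h00) h1
        exact Int.natAbs_dvd.1 (Int.natCast_dvd_natCast.2 h2)
      have hcong : ∀ i j, D ∣ m i j - m0 i j := by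
        intro i j
        have h1 := congrFun (congrFun (hmm.trans h0m.symm) i) j
        simp only [Matrix.map_apply] at h1
        rw [ZMod.intCast_eq_intCast_iff_dvd_sub] at h1
        have := hDM.trans h1
        rw [← dvd_neg, neg_sub] at this
        exact this
      have hdiv : ∀ i j, D ∣ (m * m0.adjugate) i j := by
        intro i j
        have h1 : m * m0.adjugate = (m - m0) * m0.adjugate + D • (1 : Matrix ι ι ℤ) := by
          rw [Matrix.sub_mul, Matrix.mul_adjugate, ← hD, sub_add_cancel]
        rw [h1, Matrix.add_apply, Matrix.mul_apply]
        refine dvd_add (Finset.dvd_sum fun l _ => ?_) ?_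
        · exact Dvd.dvd.mul_right (hcong i l) _
        · simp [Matrix.smul_apply]
      choose γ hγ using hdiv
      have hγ' : D • (Matrix.of γ) = m * m0.adjugate := by
        ext i j
        rw [hγ i j]; simp
      have hγm : Matrix.of γ * m0 = m := by
        have h1 : D • (Matrix.of γ * m0) = D • m := by
          rw [← Matrix.smul_mul, hγ', Matrix.mul_assoc, Matrix.adjugate_mul, Matrix.mul_smul,
            Matrix.mul_one]
        ext i j
        have h2 := congrFun (congrFun h1 i) j
        simp only [Matrix.smul_apply, smul_eq_mul] at h2
        exact mul_left_cancel₀ h00 h2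
      have hdetγ : (Matrix.of γ).det = 1 := by
        have h1 := congrArg Matrix.det hγm
        rw [Matrix.det_mul, hd, ← h0d] at h1
        exact mul_right_cancel₀ h00 (by rw [h1, one_mul])
      refine ⟨⟨Matrix.of γ, hdetγ⟩, _, le_rfl, ?_⟩
      have hR : (Matrix.of γ).map (Int.cast : ℤ → ℝ) * m0.map (Int.cast : ℤ → ℝ) = m.map (Int.cast : ℤ → ℝ) := by
        conv_rhs => rw [← hγm]
        ext i j
        simp [Matrix.mul_apply]
      have hu : IsUnit (m0.map (Int.cast : ℤ → ℝ)).det := by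
        have : (m0.map (Int.cast : ℤ → ℝ)).det = ((m0.det : ℤ) : ℝ) := by
          simpa using (RingHom.map_det (Int.castRingHom ℝ) m0).symm
        rw [this]
        exact (Int.cast_ne_zero.2 h00).isUnit
      rw [← hR, Matrix.mul_assoc, Matrix.mul_nonsing_inv _ hu, Matrix.mul_one]
    · exact ⟨0, le_rfl, fun m h1 h2 h3 => (hex ⟨m, h1, h2, h3⟩).elim⟩
  choose B hB0 hB using key
  refine ⟨∑ k, B k, Finset.sum_nonneg fun k _ => hB0 k, fun m hm hmD => ?_⟩
  obtain ⟨γ, W, hW, h⟩ := hB (⟨m.det, by rw [Finset.mem_Icc]; omega⟩, m.map (Int.cast : ℤ → ZMod M)) m hm rfl rfl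
  exact ⟨γ, W, hW.trans (Finset.single_le_sum (f := B) (fun k _ => hB0 k) (Finset.mem_univ _)), h⟩

lemma mahler [Nonempty ι] (ε : ℝ) (hε : 0 < ε) : ∃ R : ℝ, 0 < R ∧ ∀ g : Matrix ι ι ℝ, g.det = 1 → good ε g →
    ∃ γ : Matrix.SpecialLinearGroup ι ℤ, mn (g * (γ : Matrix ι ι ℤ).map (Int.cast : ℤ → ℝ)) ≤ R := by
  obtain ⟨R, hR, h⟩ := short_basis (ι := ι) ε hε
  set n := Fintype.card ι with hn
  obtain ⟨B, hB0, hB⟩ := finite_reps (ι := ι) ⌈(n.factorial : ℝ) * R ^ n⌉₊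
  refine ⟨n * (n * R) * B + 1, by positivity, fun g hg hgood => ?_⟩
  obtain ⟨m, hm0, hm⟩ := h g hg hgood
  have hdet : (g * m.map (Int.cast : ℤ → ℝ)).det = ((m.det : ℤ) : ℝ) := by
    rw [Matrix.det_mul, hg, one_mul]
    simpa using (RingHom.map_det (Int.castRingHom ℝ) m).symm
  have hle : (m.det.natAbs : ℝ) ≤ n.factorial * R ^ n := by
    have := Matrix.det_le (A := g * m.map (Int.cast : ℤ → ℝ)) (abv := IsAbsoluteValue.toAbsoluteValue (abs : ℝ → ℝ)) (x := R) hm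
    simp only [IsAbsoluteValue.toAbsoluteValue_apply, hdet, nsmul_eq_mul] at this
    rw [Nat.cast_natAbs, Int.cast_abs]
    exact this
  obtain ⟨γ, W, hW, hγ⟩ := hB m hm0 (by exact_mod_cast hle.trans (Nat.le_ceil _))
  refine ⟨γ, ?_⟩
  rw [hγ, ← Matrix.mul_assoc]
  have h1 := mn_mul (g * m.map (Int.cast : ℤ → ℝ)) W
  have h2 := mn_le_of_entries hm
  have h3 := mul_le_mul h2 hW (mn_nonneg _) (by positivity)
  linarith

end Mahler

end DriftBA

end

section

namespace DriftBA

set_option linter.unusedSectionVars false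
set_option linter.unusedSimpArgs false
set_option linter.unusedVariables false
set_option linter.deprecated false

section Space

variable {ι : Type*} [Fintype ι] [DecidableEq ι]

/-- The integral subgroup. -/
def Gam (ι : Type*) [Fintype ι] [DecidableEq ι] : Subgroup (Matrix.SpecialLinearGroup ι ℝ) :=
  (Matrix.SpecialLinearGroup.map (Int.castRingHom ℝ)).range

/-- The space of lattices. -/
abbrev XX (ι : Type*) [Fintype ι] [DecidableEq ι] := Matrix.SpecialLinearGroup ι ℝ ⧸ Gam ι

/-- distance to the identity -/
def NN (g : Matrix.SpecialLinearGroup ι ℝ) : ℝ := mn ((g : Matrix ι ι ℝ) - 1)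

instance : T2Space (Matrix.SpecialLinearGroup ι ℝ) :=
  Matrix.SpecialLinearGroup.isClosedEmbedding_val.isEmbedding.t2Space

instance : LocallyCompactSpace (Matrix ι ι ℝ) :=
  inferInstanceAs (LocallyCompactSpace (ι → ι → ℝ))

instance : SecondCountableTopology (Matrix ι ι ℝ) :=
  inferInstanceAs (SecondCountableTopology (ι → ι → ℝ))

instance : LocallyCompactSpace (Matrix.SpecialLinearGroup ι ℝ) :=
  Matrix.SpecialLinearGroup.isClosedEmbedding_val.locallyCompactSpace

instance : SecondCountableTopology (Matrix.SpecialLinearGroup ι ℝ) :=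
  Matrix.SpecialLinearGroup.isClosedEmbedding_val.isEmbedding.secondCountableTopology

lemma Gam_closed : IsClosed (Gam ι : Set (Matrix.SpecialLinearGroup ι ℝ)) := by
  have h : IsClosedEmbedding (Int.castRingHom ℝ : ℤ → ℝ) := Int.isClosedEmbedding_coe_real
  have := (IsClosedEmbedding.specialLinearGroup_map (n := ι) h).isClosed_range
  rwa [Gam, MonoidHom.coe_range]

instance : T2Space (XX ι) := by
  rw [t2Space_iff_of_isOpenQuotientMap (QuotientGroup.isOpenQuotientMap_mk (N := Gam ι))]
  have : {q : Matrix.SpecialLinearGroup ι ℝ × Matrix.SpecialLinearGroup ι ℝ |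
      (QuotientGroup.mk q.1 : XX ι) = QuotientGroup.mk q.2} =
      (fun q : Matrix.SpecialLinearGroup ι ℝ × Matrix.SpecialLinearGroup ι ℝ => q.1⁻¹ * q.2) ⁻¹' (Gam ι : Set _) := by
    ext q
    simp [QuotientGroup.eq]
  rw [this]
  exact Gam_closed.preimage (by fun_prop)

instance : TopologicalSpace.MetrizableSpace (XX ι) :=
  TopologicalSpace.metrizableSpace_of_t3_secondCountable _

lemma coe_cont : Continuous (fun g : Matrix.SpecialLinearGroup ι ℝ => (g : Matrix ι ι ℝ)) :=
  Matrix.SpecialLinearGroup.isClosedEmbedding_val.continuous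

lemma NN_cont : Continuous (NN : Matrix.SpecialLinearGroup ι ℝ → ℝ) :=
  mn_continuous.comp (coe_cont.sub continuous_const)

lemma NN_eq_zero (g : Matrix.SpecialLinearGroup ι ℝ) : NN g = 0 ↔ g = 1 := by
  rw [NN, mn_eq_zero, sub_eq_zero]
  exact ⟨fun h => Subtype.ext h, fun h => by rw [h]; rfl⟩

lemma NN_nonneg (g : Matrix.SpecialLinearGroup ι ℝ) : 0 ≤ NN g := mn_nonneg _

lemma SL_compact (R : ℝ) : IsCompact {g : Matrix.SpecialLinearGroup ι ℝ | mn (g : Matrix ι ι ℝ) ≤ R} :=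
  Matrix.SpecialLinearGroup.isClosedEmbedding_val.isCompact_preimage (mn_compact R)

lemma mn_le_NN (g : Matrix.SpecialLinearGroup ι ℝ) : mn (g : Matrix ι ι ℝ) ≤ NN g + mn (1 : Matrix ι ι ℝ) := by
  have := mn_add ((g : Matrix ι ι ℝ) - 1) 1
  rwa [sub_add_cancel] at this

lemma NN_compact (r : ℝ) : IsCompact {g : Matrix.SpecialLinearGroup ι ℝ | NN g ≤ r} := by
  refine (SL_compact (ι := ι) (r + mn (1 : Matrix ι ι ℝ))).of_isClosed_subset (isClosed_le NN_cont continuous_const) ?_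
  intro g hg
  have := mn_le_NN g
  simp only [Set.mem_setOf_eq] at hg ⊢
  linarith

lemma inv_bound (R : ℝ) : ∃ R' : ℝ, 0 < R' ∧ ∀ g : Matrix.SpecialLinearGroup ι ℝ, mn (g : Matrix ι ι ℝ) ≤ R →
    mn ((g⁻¹ : Matrix.SpecialLinearGroup ι ℝ) : Matrix ι ι ℝ) ≤ R' := by
  obtain ⟨C, hC⟩ := (SL_compact (ι := ι) R).bddAbove_image
    (f := fun g => mn ((g⁻¹ : Matrix.SpecialLinearGroup ι ℝ) : Matrix ι ι ℝ))
    (mn_continuous.comp (coe_cont.comp continuous_inv)).continuousOn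
  exact ⟨max C 1, by positivity, fun g hg => (hC ⟨g, hg, rfl⟩).trans (le_max_left _ _)⟩

lemma zv_mulVec (γ : Matrix ι ι ℤ) (v : ι → ℤ) :
    (γ.map (Int.cast : ℤ → ℝ)).mulVec (zv v) = zv (γ.mulVec v) := by
  ext i
  simp [Matrix.mulVec, dotProduct, zv]

lemma coe_map_int (γ : Matrix.SpecialLinearGroup ι ℤ) :
    ((Matrix.SpecialLinearGroup.map (Int.castRingHom ℝ) γ : Matrix.SpecialLinearGroup ι ℝ) : Matrix ι ι ℝ) =
      (γ : Matrix ι ι ℤ).map (Int.cast : ℤ → ℝ) := by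
  ext i j
  simp

lemma good_mul (ε : ℝ) (g : Matrix ι ι ℝ) (γ : Matrix.SpecialLinearGroup ι ℤ) (h : good ε g) :
    good ε (g * (γ : Matrix ι ι ℤ).map (Int.cast : ℤ → ℝ)) := by
  intro v hv
  rw [← Matrix.mulVec_mulVec, zv_mulVec]
  refine h _ fun h0 => hv ?_
  have h1 := congrArg ((γ⁻¹ : Matrix.SpecialLinearGroup ι ℤ) : Matrix ι ι ℤ).mulVec h0
  rw [Matrix.mulVec_mulVec, ← Matrix.SpecialLinearGroup.coe_mul, inv_mul_cancel] at h1
  simpa using h1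

lemma good_of_mk {ε : ℝ} {g g' : Matrix.SpecialLinearGroup ι ℝ}
    (h : (QuotientGroup.mk g : XX ι) = QuotientGroup.mk g') (hg : good ε (g : Matrix ι ι ℝ)) :
    good ε (g' : Matrix ι ι ℝ) := by
  rw [QuotientGroup.eq] at h
  obtain ⟨γ, hγ⟩ := h
  have : g' = g * Matrix.SpecialLinearGroup.map (Int.castRingHom ℝ) γ := by
    rw [hγ]; group
  rw [this, Matrix.SpecialLinearGroup.coe_mul, coe_map_int]
  exact good_mul ε _ γ hg

/-- lattices all of whose nonzero vectors have length at least `ε` -/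
def Cset (ι : Type*) [Fintype ι] [DecidableEq ι] (ε : ℝ) : Set (XX ι) :=
  {x | ∃ g : Matrix.SpecialLinearGroup ι ℝ, QuotientGroup.mk g = x ∧ good ε (g : Matrix ι ι ℝ)}

lemma mk_mem_Cset {ε : ℝ} {g : Matrix.SpecialLinearGroup ι ℝ} :
    (QuotientGroup.mk g : XX ι) ∈ Cset ι ε ↔ good ε (g : Matrix ι ι ℝ) :=
  ⟨fun ⟨g', h, hg⟩ => good_of_mk h hg, fun h => ⟨g, rfl, h⟩⟩

lemma Cset_closed (ε : ℝ) : IsClosed (Cset ι ε) := by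
  rw [← (QuotientGroup.isOpenQuotientMap_mk (N := Gam ι)).isQuotientMap.isClosed_preimage]
  have : (QuotientGroup.mk : _ → XX ι) ⁻¹' (Cset ι ε) = ⋂ (v : ι → ℤ) (hv : v ≠ 0),
      {g : Matrix.SpecialLinearGroup ι ℝ | ε ≤ ‖(g : Matrix ι ι ℝ).mulVec (zv v)‖} := by
    ext g
    simp [mk_mem_Cset, good]
  rw [this]
  refine isClosed_iInter fun v => isClosed_iInter fun hv => isClosed_le continuous_const ?_
  exact (Continuous.matrix_mulVec coe_cont continuous_const).norm

lemma Cset_rep [Nonempty ι] {ε : ℝ} (hε : 0 < ε) : ∃ R : ℝ, 0 < R ∧ ∀ x ∈ Cset ι ε,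
    ∃ k : Matrix.SpecialLinearGroup ι ℝ, QuotientGroup.mk k = x ∧ mn (k : Matrix ι ι ℝ) ≤ R := by
  obtain ⟨R, hR, h⟩ := mahler (ι := ι) ε hε
  refine ⟨R, hR, ?_⟩
  rintro x ⟨g, rfl, hg⟩
  obtain ⟨γ, hγ⟩ := h g g.2 hg
  refine ⟨g * Matrix.SpecialLinearGroup.map (Int.castRingHom ℝ) γ, ?_, ?_⟩
  · rw [QuotientGroup.eq]
    refine (Gam ι).mem_carrier.1 ⟨γ⁻¹, ?_⟩
    simp
  · rwa [Matrix.SpecialLinearGroup.coe_mul, coe_map_int]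

lemma Cset_compact [Nonempty ι] {ε : ℝ} (hε : 0 < ε) : IsCompact (Cset ι ε) := by
  obtain ⟨R, hR, h⟩ := Cset_rep (ι := ι) hε
  refine ((SL_compact (ι := ι) R).image (f := (QuotientGroup.mk : _ → XX ι))
    QuotientGroup.continuous_mk).of_isClosed_subset (Cset_closed ε) ?_
  intro x hx
  obtain ⟨k, hk, hkR⟩ := h x hx
  exact ⟨k, hkR, hk⟩

lemma Cset_inj [Nonempty ι] {ε : ℝ} (hε : 0 < ε) : ∃ r : ℝ, 0 < r ∧ ∀ x ∈ Cset ι ε,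
    ∀ g g' : Matrix.SpecialLinearGroup ι ℝ, NN g < r → NN g' < r → g • x = g' • x → g = g' := by
  obtain ⟨R, hR, h⟩ := Cset_rep (ι := ι) hε
  obtain ⟨R1, hR1, h1⟩ := inv_bound (ι := ι) R
  obtain ⟨R2, hR2, h2⟩ := inv_bound (ι := ι) (1 + mn (1 : Matrix ι ι ℝ))
  set r : ℝ := min 1 (1 / (4 * (R1 * R2 * R))) with hr
  have hrpos : 0 < r := by positivity
  refine ⟨r, hrpos, fun x hx g g' hg hg' heq => ?_⟩
  obtain ⟨k, rfl, hkR⟩ := h x hx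
  have hgi := h2 g (by
    have := mn_le_NN g
    have := min_le_left 1 (1 / (4 * (R1 * R2 * R)))
    linarith)
  have hki := h1 k hkR
  have heq' : (QuotientGroup.mk (g * k) : XX ι) = QuotientGroup.mk (g' * k) := heq
  rw [QuotientGroup.eq] at heq'
  obtain ⟨γ, hγ⟩ := heq'
  have hγ1 : (γ : Matrix ι ι ℤ).map (Int.cast : ℤ → ℝ) - 1 =
      ((k⁻¹ : Matrix.SpecialLinearGroup ι ℝ) : Matrix ι ι ℝ) * ((g⁻¹ : Matrix.SpecialLinearGroup ι ℝ) : Matrix ι ι ℝ)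
        * ((g' : Matrix ι ι ℝ) - g) * k := by
    rw [← coe_map_int, hγ, Matrix.mul_sub, Matrix.sub_mul]
    have e1 : (((k⁻¹ : Matrix.SpecialLinearGroup ι ℝ) : Matrix ι ι ℝ) * ((g⁻¹ : Matrix.SpecialLinearGroup ι ℝ) : Matrix ι ι ℝ)
        * (g : Matrix ι ι ℝ) * k) = 1 := by
      rw [← Matrix.SpecialLinearGroup.coe_mul, ← Matrix.SpecialLinearGroup.coe_mul, ← Matrix.SpecialLinearGroup.coe_mul]
      have : k⁻¹ * g⁻¹ * g * k = 1 := by group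
      rw [this]; simp
    rw [e1]
    rw [← Matrix.SpecialLinearGroup.coe_mul, ← Matrix.SpecialLinearGroup.coe_mul, ← Matrix.SpecialLinearGroup.coe_mul]
    rw [mul_inv_rev, mul_assoc (k⁻¹ * g⁻¹) g' k]
  have hd : mn ((g' : Matrix ι ι ℝ) - (g : Matrix ι ι ℝ)) < 2 * r := by
    have : (g' : Matrix ι ι ℝ) - (g : Matrix ι ι ℝ) = ((g' : Matrix ι ι ℝ) - 1) - ((g : Matrix ι ι ℝ) - 1) := by abel
    rw [this]
    refine (mn_sub _ _).trans_lt ?_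
    have e1 : mn ((g' : Matrix ι ι ℝ) - 1) < r := hg'
    have e2 : mn ((g : Matrix ι ι ℝ) - 1) < r := hg
    linarith
  have hlt : mn ((γ : Matrix ι ι ℤ).map (Int.cast : ℤ → ℝ) - 1) < 1 := by
    rw [hγ1]
    calc _ ≤ R1 * R2 * mn ((g' : Matrix ι ι ℝ) - (g : Matrix ι ι ℝ)) * R := by
          refine (mn_mul _ _).trans (mul_le_mul ?_ hkR (mn_nonneg _) (by
            have := mn_nonneg ((g' : Matrix ι ι ℝ) - (g : Matrix ι ι ℝ)); positivity))
          refine (mn_mul _ _).trans (mul_le_mul_of_nonneg_right ?_ (mn_nonneg _))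
          exact (mn_mul _ _).trans (mul_le_mul hki hgi (mn_nonneg _) hR1.le)
      _ ≤ R1 * R2 * (2 * r) * R := by gcongr
      _ ≤ R1 * R2 * (2 * (1 / (4 * (R1 * R2 * R)))) * R := by
          have := min_le_right 1 (1 / (4 * (R1 * R2 * R)))
          gcongr
      _ < 1 := by
          field_simp
          norm_num
  have hγ2 : (γ : Matrix ι ι ℤ) = 1 := by
    ext i j
    have e := (le_mn _ i j).trans_lt hlt
    have e2 : (((γ : Matrix ι ι ℤ).map (Int.cast : ℤ → ℝ) - 1) i j) = (((γ : Matrix ι ι ℤ) i j - (1 : Matrix ι ι ℤ) i j : ℤ) : ℝ) := by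
      by_cases hij : i = j <;> simp [Matrix.one_apply, hij]
    rw [e2] at e
    have e3 : |(γ : Matrix ι ι ℤ) i j - (1 : Matrix ι ι ℤ) i j| < 1 := by exact_mod_cast e
    rw [Int.abs_lt_one_iff, sub_eq_zero] at e3
    exact e3
  have hγ3 : γ = 1 := Subtype.ext hγ2
  rw [hγ3, map_one] at hγ
  have : g * k = g' * k := by
    rw [eq_comm, inv_mul_eq_one] at hγ
    exact hγ
  exact mul_right_cancel this

lemma X_locTrans (r : ℝ) (hr : 0 < r) (x : XX ι) : ∃ C : Set (XX ι), IsOpen C ∧ x ∈ C ∧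
    ∀ y ∈ C, ∀ y' ∈ C, ∃ g : Matrix.SpecialLinearGroup ι ℝ, NN g < r ∧ g • y = y' := by
  obtain ⟨k, rfl⟩ := QuotientGroup.mk_surjective x
  have hc : Continuous fun p : Matrix.SpecialLinearGroup ι ℝ × Matrix.SpecialLinearGroup ι ℝ => NN (p.2 * p.1⁻¹) :=
    NN_cont.comp (by fun_prop)
  have hopen : IsOpen {p : Matrix.SpecialLinearGroup ι ℝ × Matrix.SpecialLinearGroup ι ℝ | NN (p.2 * p.1⁻¹) < r} :=
    isOpen_lt hc continuous_const
  have hmem : ((1 : Matrix.SpecialLinearGroup ι ℝ), (1 : Matrix.SpecialLinearGroup ι ℝ)) ∈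
      {p : Matrix.SpecialLinearGroup ι ℝ × Matrix.SpecialLinearGroup ι ℝ | NN (p.2 * p.1⁻¹) < r} := by
    have : NN (1 : Matrix.SpecialLinearGroup ι ℝ) = 0 := (NN_eq_zero _).2 rfl
    simpa [this] using hr
  obtain ⟨U, V, hU, hV, h1U, h1V, hUV⟩ := isOpen_prod_iff.1 hopen _ _ hmem
  refine ⟨(fun w : Matrix.SpecialLinearGroup ι ℝ => (QuotientGroup.mk (w * k) : XX ι)) '' (U ∩ V), ?_, ⟨1, ⟨h1U, h1V⟩, by simp⟩, ?_⟩
  · have : (fun w : Matrix.SpecialLinearGroup ι ℝ => (QuotientGroup.mk (w * k) : XX ι)) = QuotientGroup.mk ∘ (Homeomorph.mulRight k) := rfl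
    rw [this]
    exact ((QuotientGroup.isOpenMap_coe (N := Gam ι)).comp (Homeomorph.mulRight k).isOpenMap) _ (hU.inter hV)
  · rintro _ ⟨w, hw, rfl⟩ _ ⟨w', hw', rfl⟩
    have hlt : NN (w' * w⁻¹) < r := by
      have := hUV (Set.mk_mem_prod hw.1 hw'.2)
      simpa only [Set.mem_setOf_eq] using this
    refine ⟨w' * w⁻¹, hlt, ?_⟩
    change (QuotientGroup.mk (w' * w⁻¹ * (w * k)) : XX ι) = _
    congr 1
    group

lemma NN_conj (h g : Matrix.SpecialLinearGroup ι ℝ) :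
    NN (h * g * h⁻¹) ≤ (mn (h : Matrix ι ι ℝ) * mn ((h⁻¹ : Matrix.SpecialLinearGroup ι ℝ) : Matrix ι ι ℝ)) * NN g := by
  have : ((h * g * h⁻¹ : Matrix.SpecialLinearGroup ι ℝ) : Matrix ι ι ℝ) - 1 =
      (h : Matrix ι ι ℝ) * ((g : Matrix ι ι ℝ) - 1) * ((h⁻¹ : Matrix.SpecialLinearGroup ι ℝ) : Matrix ι ι ℝ) := by
    rw [Matrix.mul_sub, Matrix.sub_mul, Matrix.mul_one, ← Matrix.SpecialLinearGroup.coe_mul,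
      ← Matrix.SpecialLinearGroup.coe_mul, ← Matrix.SpecialLinearGroup.coe_mul, mul_inv_cancel]
    simp
  rw [NN, this]
  refine (mn_mul _ _).trans ?_
  rw [mul_right_comm]
  exact mul_le_mul_of_nonneg_right (mn_mul _ _) (mn_nonneg _)

lemma NN_conj_bound {I : Type*} [Fintype I] (h : I → Matrix.SpecialLinearGroup ι ℝ) :
    ∃ C : ℝ, 1 ≤ C ∧ ∀ i g, NN (h i * g * (h i)⁻¹) ≤ C * NN g ∧ NN ((h i)⁻¹ * g * h i) ≤ C * NN g := by
  set f : I → ℝ := fun i => mn (h i : Matrix ι ι ℝ) * mn (((h i)⁻¹ : Matrix.SpecialLinearGroup ι ℝ) : Matrix ι ι ℝ) with hf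
  have hf0 : ∀ i, 0 ≤ f i := fun i => mul_nonneg (mn_nonneg _) (mn_nonneg _)
  have hle : ∀ i, f i ≤ 1 + ∑ i, f i := fun i => by
    have := Finset.single_le_sum (f := f) (fun i _ => hf0 i) (Finset.mem_univ i)
    linarith
  refine ⟨1 + ∑ i, f i, by linarith [Finset.sum_nonneg fun i (_ : i ∈ Finset.univ) => hf0 i], fun i g => ⟨?_, ?_⟩⟩
  · exact (NN_conj _ _).trans (mul_le_mul_of_nonneg_right (hle i) (NN_nonneg _))
  · have := NN_conj (h i)⁻¹ g
    rw [inv_inv, mul_comm (mn _) (mn _)] at this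
    exact this.trans (mul_le_mul_of_nonneg_right (hle i) (NN_nonneg _))

end Space

end DriftBA

end

section

namespace DriftBA

set_option linter.unusedSectionVars false
set_option linter.unusedSimpArgs false
set_option linter.unusedVariables false
set_option linter.deprecated false

section Conc

/-- Euclidean space -/
abbrev VV (d : ℕ) := EuclideanSpace ℝ (Fin d)
/-- Euclidean space plus a line -/
abbrev WW (d : ℕ) := VV d × ℝ
/-- index type -/
abbrev JJ (d : ℕ) := Fin d ⊕ Unit
/-- the group -/
abbrev GG (d : ℕ) := Matrix.SpecialLinearGroup (JJ d) ℝ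

variable {d : ℕ}

/-- basis -/
def bW (d : ℕ) : Module.Basis (JJ d) ℝ (WW d) :=
  (EuclideanSpace.basisFun (Fin d) ℝ).toBasis.prod (Module.Basis.singleton Unit ℝ)

lemma bW_repr_inl (x : WW d) (i : Fin d) : (bW d).repr x (Sum.inl i) = x.1 i := by
  simp [bW, Module.Basis.prod]

lemma bW_repr_inr (x : WW d) (i : Unit) : (bW d).repr x (Sum.inr i) = x.2 := by
  simp [bW, Module.Basis.prod]

/-- coordinates to vectors -/
def tow (x : JJ d → ℝ) : WW d := (bW d).equivFun.symm x

lemma tow_fst (x : JJ d → ℝ) (i : Fin d) : (tow x).1 i = x (Sum.inl i) := by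
  rw [← bW_repr_inl, ← Module.Basis.equivFun_apply, tow, LinearEquiv.apply_symm_apply]

lemma tow_snd (x : JJ d → ℝ) : (tow x).2 = x (Sum.inr ()) := by
  rw [← bW_repr_inr _ (), ← Module.Basis.equivFun_apply, tow, LinearEquiv.apply_symm_apply]

lemma tow_add (x y : JJ d → ℝ) : tow (x + y) = tow x + tow y := map_add _ _ _
lemma tow_smul (c : ℝ) (x : JJ d → ℝ) : tow (c • x) = c • tow x := map_smul _ _ _

lemma norm_le_tow (x : JJ d → ℝ) : ‖x‖ ≤ ‖tow x‖ := by
  refine (pi_norm_le_iff_of_nonneg (norm_nonneg _)).2 fun i => ?_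
  rcases i with i | i
  · rw [← tow_fst x i]
    exact (PiLp.norm_apply_le _ i).trans (norm_fst_le _)
  · rw [← tow_snd x]
    exact norm_snd_le _

lemma tow_bound : ∃ C : ℝ, 0 < C ∧ ∀ x : JJ d → ℝ, ‖tow x‖ ≤ C * ‖x‖ := by
  set L : (JJ d → ℝ) →L[ℝ] WW d := LinearMap.toContinuousLinearMap ((bW d).equivFun.symm : (JJ d → ℝ) →ₗ[ℝ] WW d)
  refine ⟨‖L‖ + 1, by positivity, fun x => ?_⟩
  have : ‖tow x‖ ≤ ‖L‖ * ‖x‖ := L.le_opNorm x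
  nlinarith [norm_nonneg x]

/-- operators to matrices -/
def toMat : (WW d →L[ℝ] WW d) ≃ₗ[ℝ] Matrix (JJ d) (JJ d) ℝ :=
  LinearMap.toContinuousLinearMap.symm.trans (LinearMap.toMatrixAlgEquiv (bW d)).toLinearEquiv

lemma toMat_apply (L : WW d →L[ℝ] WW d) :
    toMat L = LinearMap.toMatrixAlgEquiv (bW d) (L : WW d →ₗ[ℝ] WW d) := rfl

lemma toMat_mul (L L' : WW d →L[ℝ] WW d) : toMat (L * L') = toMat L * toMat L' := by
  rw [toMat_apply, toMat_apply, toMat_apply, ← map_mul]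
  rfl

lemma toMat_one : toMat (1 : WW d →L[ℝ] WW d) = 1 := by
  rw [toMat_apply, ← map_one (LinearMap.toMatrixAlgEquiv (bW d))]
  rfl

/-- matrices act as operators -/
def Lg (g : GG d) : WW d →L[ℝ] WW d := toMat.symm (g : Matrix (JJ d) (JJ d) ℝ)

lemma toMat_Lg (g : GG d) : toMat (Lg g) = (g : Matrix (JJ d) (JJ d) ℝ) := by simp [Lg]

lemma Lg_mul (g g' : GG d) : Lg (g * g') = Lg g * Lg g' := by
  apply toMat.injective
  rw [toMat_mul, toMat_Lg, toMat_Lg, toMat_Lg, Matrix.SpecialLinearGroup.coe_mul]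

lemma Lg_one : Lg (1 : GG d) = 1 := by
  apply toMat.injective
  rw [toMat_Lg, toMat_one, Matrix.SpecialLinearGroup.coe_one]

lemma Lg_inj {g g' : GG d} (h : Lg g = Lg g') : g = g' := by
  apply Subtype.ext
  have := congrArg toMat h
  rwa [toMat_Lg, toMat_Lg] at this

lemma Lg_inv_apply (g : GG d) (x : WW d) : Lg g⁻¹ (Lg g x) = x := by
  have : Lg g⁻¹ * Lg g = 1 := by rw [← Lg_mul, inv_mul_cancel, Lg_one]
  exact congrArg (fun L : WW d →L[ℝ] WW d => L x) this

lemma Lg_apply_inv (g : GG d) (x : WW d) : Lg g (Lg g⁻¹ x) = x := by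
  have := Lg_inv_apply g⁻¹ x
  rwa [inv_inv] at this

/-- element from an operator -/
def ofL (L : WW d →L[ℝ] WW d) (h : LinearMap.det (L : WW d →ₗ[ℝ] WW d) = 1) : GG d :=
  ⟨toMat L, by
    rw [toMat_apply]
    have := LinearMap.det_toMatrix (bW d) (L : WW d →ₗ[ℝ] WW d)
    rw [h] at this
    exact this⟩

lemma Lg_ofL (L : WW d →L[ℝ] WW d) (h) : Lg (ofL L h) = L := by
  simp [Lg, ofL]

lemma Lg_tow (g : GG d) (x : JJ d → ℝ) : Lg g (tow x) = tow ((g : Matrix (JJ d) (JJ d) ℝ).mulVec x) := by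
  have h := LinearMap.toMatrix_mulVec_repr (bW d) (bW d) (Lg g : WW d →ₗ[ℝ] WW d) (tow x)
  have h1 : LinearMap.toMatrix (bW d) (bW d) (Lg g : WW d →ₗ[ℝ] WW d) = (g : Matrix (JJ d) (JJ d) ℝ) := toMat_Lg g
  have h2 : ((bW d).repr (tow x) : JJ d → ℝ) = x := by
    rw [← Module.Basis.equivFun_apply, tow, LinearEquiv.apply_symm_apply]
  rw [h1, h2] at h
  rw [h]
  refine (LinearEquiv.eq_symm_apply _).2 ?_
  rw [Module.Basis.equivFun_apply]
  rfl

lemma mn_toMat : ∃ C : ℝ, 0 < C ∧ ∀ L : WW d →L[ℝ] WW d, mn (toMat L) ≤ C * ‖L‖ ∧ ‖L‖ ≤ C * mn (toMat L) := by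
  set F : JJ d → JJ d → (WW d →L[ℝ] WW d) →L[ℝ] ℝ := fun i j => LinearMap.toContinuousLinearMap
    ((Matrix.entryLinearMap ℝ ℝ i j) ∘ₗ (toMat (d := d)).toLinearMap) with hF
  have hFa : ∀ i j L, F i j L = toMat L i j := fun i j L => rfl
  set D : ℝ := ∑ i : JJ d, ∑ j : JJ d, ‖toMat.symm (Matrix.single i j (1:ℝ) : Matrix (JJ d) (JJ d) ℝ)‖ with hD
  set E : ℝ := ∑ i : JJ d, ∑ j : JJ d, ‖F i j‖ with hE
  have hD0 : 0 ≤ D := Finset.sum_nonneg fun _ _ => Finset.sum_nonneg fun _ _ => norm_nonneg _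
  have hE0 : 0 ≤ E := Finset.sum_nonneg fun i _ => Finset.sum_nonneg fun j _ => norm_nonneg (F i j)
  refine ⟨D + E + 1, by positivity, fun L => ⟨?_, ?_⟩⟩
  · calc mn (toMat L) ≤ ∑ i : JJ d, ∑ j : JJ d, ‖F i j‖ * ‖L‖ :=
          Finset.sum_le_sum fun i _ => Finset.sum_le_sum fun j _ => by
            have := (F i j).le_opNorm L
            rwa [hFa] at this
      _ = E * ‖L‖ := by simp only [hE, Finset.sum_mul]
      _ ≤ _ := mul_le_mul_of_nonneg_right (by linarith) (norm_nonneg _)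
  · have h1 : L = ∑ i, ∑ j, (toMat L i j) • toMat.symm (Matrix.single i j (1:ℝ) : Matrix (JJ d) (JJ d) ℝ) := by
      apply toMat.injective
      conv_lhs => rw [Matrix.matrix_eq_sum_single (toMat L)]
      simp only [map_sum, map_smul, LinearEquiv.apply_symm_apply, Matrix.smul_single, smul_eq_mul, mul_one]
    have hn := mn_nonneg (toMat L)
    calc ‖L‖ ≤ ∑ i, ∑ j, ‖(toMat L i j) • toMat.symm (Matrix.single i j (1:ℝ) : Matrix (JJ d) (JJ d) ℝ)‖ := by
          conv_lhs => rw [h1]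
          exact (norm_sum_le _ _).trans (Finset.sum_le_sum fun i _ => norm_sum_le _ _)
      _ ≤ ∑ i, ∑ j, mn (toMat L) * ‖toMat.symm (Matrix.single i j (1:ℝ) : Matrix (JJ d) (JJ d) ℝ)‖ := by
          refine Finset.sum_le_sum fun i _ => Finset.sum_le_sum fun j _ => ?_
          rw [norm_smul]
          exact mul_le_mul_of_nonneg_right (le_mn _ i j) (norm_nonneg _)
      _ = D * mn (toMat L) := by simp only [hD, Finset.sum_mul, mul_comm]
      _ ≤ _ := mul_le_mul_of_nonneg_right (by linarith) hn

/-- operator-norm distance to the identity -/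
def NW (g : GG d) : ℝ := ‖Lg g - 1‖

lemma NN_eq (g : GG d) : NN g = mn (toMat (Lg g - 1)) := by
  rw [NN, map_sub, toMat_Lg, toMat_one]

lemma NW_NN : ∃ C : ℝ, 0 < C ∧ ∀ g : GG d, NN g ≤ C * NW g ∧ NW g ≤ C * NN g := by
  obtain ⟨C, hC, h⟩ := mn_toMat (d := d)
  exact ⟨C, hC, fun g => by rw [NN_eq]; exact h _⟩

lemma Lg_cont : Continuous (Lg : GG d → (WW d →L[ℝ] WW d)) := by
  have h : Continuous (toMat.symm : Matrix (JJ d) (JJ d) ℝ → (WW d →L[ℝ] WW d)) := by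
    have : (toMat.symm : Matrix (JJ d) (JJ d) ℝ → (WW d →L[ℝ] WW d)) = fun A => ∑ i, ∑ j,
        (A i j) • toMat.symm (Matrix.single i j (1:ℝ) : Matrix (JJ d) (JJ d) ℝ) := by
      ext1 A
      apply toMat.injective
      rw [LinearEquiv.apply_symm_apply]
      conv_lhs => rw [Matrix.matrix_eq_sum_single A]
      simp only [map_sum, map_smul, LinearEquiv.apply_symm_apply, Matrix.smul_single, smul_eq_mul, mul_one]
    rw [this]
    refine continuous_finset_sum _ fun i _ => continuous_finset_sum _ fun j _ => ?_
    exact Continuous.smul (continuous_id.matrix_elem i j) continuous_const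
  exact h.comp coe_cont

lemma NW_cont : Continuous (NW : GG d → ℝ) := (Lg_cont.sub continuous_const).norm

lemma NW_nonneg (g : GG d) : 0 ≤ NW g := norm_nonneg _

lemma NW_eq_zero (g : GG d) : NW g = 0 ↔ g = 1 := by
  rw [NW, norm_eq_zero, sub_eq_zero, ← Lg_one]
  exact ⟨Lg_inj, fun h => by rw [h]⟩

lemma NW_compact (r : ℝ) : IsCompact {g : GG d | NW g ≤ r} := by
  obtain ⟨C, hC, h⟩ := NW_NN (d := d)
  refine (NN_compact (ι := JJ d) (C * r)).of_isClosed_subset (isClosed_le NW_cont continuous_const) fun g hg => ?_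
  exact (h g).1.trans (mul_le_mul_of_nonneg_left hg hC.le)

lemma NW_inj {ε : ℝ} (hε : 0 < ε) : ∃ r : ℝ, 0 < r ∧ ∀ x ∈ Cset (JJ d) ε,
    ∀ g g' : GG d, NW g < r → NW g' < r → g • x = g' • x → g = g' := by
  obtain ⟨C, hC, h⟩ := NW_NN (d := d)
  obtain ⟨r, hr, h2⟩ := Cset_inj (ι := JJ d) hε
  refine ⟨r / C, by positivity, fun x hx g g' hg hg' => h2 x hx g g' ?_ ?_⟩
  · refine (h g).1.trans_lt ?_
    rwa [lt_div_iff₀' hC] at hg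
  · refine (h g').1.trans_lt ?_
    rwa [lt_div_iff₀' hC] at hg'

lemma NW_locTrans (r : ℝ) (hr : 0 < r) (x : XX (JJ d)) : ∃ C : Set (XX (JJ d)), IsOpen C ∧ x ∈ C ∧
    ∀ y ∈ C, ∀ y' ∈ C, ∃ g : GG d, NW g < r ∧ g • y = y' := by
  obtain ⟨C, hC, h⟩ := NW_NN (d := d)
  obtain ⟨U, hU, hx, h2⟩ := X_locTrans (ι := JJ d) (r / C) (by positivity) x
  refine ⟨U, hU, hx, fun y hy y' hy' => ?_⟩
  obtain ⟨g, hg, hgy⟩ := h2 y hy y' hy'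
  refine ⟨g, (h g).2.trans_lt ?_, hgy⟩
  rwa [lt_div_iff₀' hC] at hg

lemma Lg_conj_sub (h g : GG d) : Lg (h * g * h⁻¹) - 1 = Lg h * (Lg g - 1) * Lg h⁻¹ := by
  rw [mul_sub, sub_mul, mul_one, ← Lg_mul, ← Lg_mul, ← Lg_mul, mul_inv_cancel, Lg_one]

lemma NW_conj (h g : GG d) : NW (h * g * h⁻¹) ≤ (‖Lg h‖ * ‖Lg h⁻¹‖) * NW g := by
  rw [NW, Lg_conj_sub]
  refine (norm_mul_le _ _).trans ?_
  rw [mul_right_comm]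
  exact mul_le_mul_of_nonneg_right (norm_mul_le _ _) (norm_nonneg _)

lemma NW_conj_bound {I : Type*} [Fintype I] (h : I → GG d) :
    ∃ C : ℝ, 1 ≤ C ∧ ∀ i g, NW (h i * g * (h i)⁻¹) ≤ C * NW g ∧ NW ((h i)⁻¹ * g * h i) ≤ C * NW g := by
  set f : I → ℝ := fun i => ‖Lg (h i)‖ * ‖Lg (h i)⁻¹‖ with hf
  have hf0 : ∀ i, 0 ≤ f i := fun i => mul_nonneg (norm_nonneg _) (norm_nonneg _)
  have hle : ∀ i, f i ≤ 1 + ∑ i, f i := fun i => by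
    have := Finset.single_le_sum (f := f) (fun i _ => hf0 i) (Finset.mem_univ i)
    linarith
  refine ⟨1 + ∑ i, f i, by linarith [Finset.sum_nonneg fun i (_ : i ∈ Finset.univ) => hf0 i], fun i g => ⟨?_, ?_⟩⟩
  · exact (NW_conj _ _).trans (mul_le_mul_of_nonneg_right (hle i) (NW_nonneg _))
  · have := NW_conj (h i)⁻¹ g
    rw [inv_inv, mul_comm ‖_‖ ‖_‖] at this
    exact this.trans (mul_le_mul_of_nonneg_right (hle i) (NW_nonneg _))

end Conc

end DriftBA

end

section

namespace DriftBA

set_option linter.unusedSectionVars false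
set_option linter.unusedSimpArgs false
set_option linter.unusedVariables false
set_option linter.deprecated false

section Conc2

variable {d : ℕ}

/-- unipotent -/
def uL (t : VV d) : WW d →L[ℝ] WW d :=
  ContinuousLinearMap.id ℝ (WW d) + (ContinuousLinearMap.snd ℝ (VV d) ℝ).smulRight ((t, 0) : WW d)

@[simp] lemma uL_apply (t : VV d) (x : WW d) : uL t x = (x.1 + x.2 • t, x.2) := by
  ext <;> simp [uL]

lemma det_uL (t : VV d) : LinearMap.det (uL t : WW d →ₗ[ℝ] WW d) = 1 := by
  have h1 := LinearMap.transvection.det (LinearMap.snd ℝ (VV d) ℝ) ((t, 0) : WW d)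
  have h2 : (uL t : WW d →ₗ[ℝ] WW d) = LinearMap.transvection (LinearMap.snd ℝ (VV d) ℝ) ((t, 0) : WW d) := by
    refine LinearMap.ext fun x => ?_
    rfl
  rw [h2, h1]; simp

/-- renormalisation -/
def hL (m : ℝ) (R : VV d ≃ₗᵢ[ℝ] VV d) (θ : VV d) : WW d →L[ℝ] WW d :=
  ((m • (R.toContinuousLinearEquiv : VV d →L[ℝ] VV d)).prodMap
    ((m ^ d)⁻¹ • ContinuousLinearMap.id ℝ ℝ)) ∘L uL (-θ)

@[simp] lemma hL_apply (m : ℝ) (R : VV d ≃ₗᵢ[ℝ] VV d) (θ : VV d) (x : WW d) :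
    hL m R θ x = (m • R (x.1 - x.2 • θ), (m ^ d)⁻¹ * x.2) := by
  simp [hL, sub_eq_add_neg]

lemma det_hL (m : ℝ) (hm : 0 < m) (R : VV d ≃ₗᵢ[ℝ] VV d) (θ : VV d) :
    LinearMap.det (hL m R θ : WW d →ₗ[ℝ] WW d) = LinearMap.det (R.toLinearEquiv : VV d →ₗ[ℝ] VV d) := by
  have h1 : (hL m R θ : WW d →ₗ[ℝ] WW d) = (LinearMap.prodMap (m • (R.toLinearEquiv : VV d →ₗ[ℝ] VV d))
    ((m ^ d)⁻¹ • LinearMap.id)) ∘ₗ (uL (-θ) : WW d →ₗ[ℝ] WW d) := rfl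
  rw [h1, LinearMap.det_comp, det_uL, LinearMap.det_prodMap, LinearMap.det_smul, LinearMap.det_smul]
  simp
  field_simp

lemma hL_mul {m m' : ℝ} (hm : 0 < m) (hm' : 0 < m') (R R' : VV d ≃ₗᵢ[ℝ] VV d) (θ θ' : VV d) :
    hL m R θ * hL m' R' θ' = hL (m * m') (R'.trans R) (θ' + (m' ^ (d + 1))⁻¹ • R'.symm θ) := by
  refine ContinuousLinearMap.ext fun x => ?_
  rw [ContinuousLinearMap.mul_apply, hL_apply, hL_apply, hL_apply]
  refine Prod.ext ?_ ?_
  · simp only [LinearIsometryEquiv.trans_apply]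
    have h1 : (m * m') * (x.2 * (m' ^ (d + 1))⁻¹) = m * ((m' ^ d)⁻¹ * x.2) := by
      rw [pow_succ]; field_simp
    simp only [map_sub, map_add, map_smul, LinearIsometryEquiv.apply_symm_apply, smul_sub, smul_add, smul_smul]
    rw [h1, mul_assoc m m' x.2]
    abel
  · simp only [mul_pow]
    field_simp

lemma uL_hL {m : ℝ} (hm : 0 < m) (R : VV d ≃ₗᵢ[ℝ] VV d) (θ t : VV d) :
    hL m R θ * uL t = uL (m ^ (d + 1) • R t) * hL m R θ := by
  refine ContinuousLinearMap.ext fun x => ?_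
  rw [ContinuousLinearMap.mul_apply, ContinuousLinearMap.mul_apply, hL_apply, hL_apply, uL_apply, uL_apply]
  refine Prod.ext ?_ ?_
  · simp only [map_sub, map_add, map_smul, smul_sub, smul_add, smul_smul]
    have : (m ^ d)⁻¹ * x.2 * m ^ (d + 1) = m * x.2 := by
      rw [pow_succ]; field_simp
    rw [this]
    abel
  · simp

/-- inverse of `hL` -/
lemma hL_inv {m : ℝ} (hm : 0 < m) (R : VV d ≃ₗᵢ[ℝ] VV d) (θ : VV d) (y : WW d) :
    hL m R θ (m⁻¹ • R.symm y.1 + (m ^ d * y.2) • θ, m ^ d * y.2) = y := by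
  rw [hL_apply]
  refine Prod.ext ?_ ?_
  · simp [hm.ne']
  · simp [hm.ne']

lemma norm_hL_le {m : ℝ} (hm : 1 ≤ m) (R : VV d ≃ₗᵢ[ℝ] VV d) (θ : VV d) : ‖hL m R θ‖ ≤ m * (1 + ‖θ‖) := by
  refine ContinuousLinearMap.opNorm_le_bound _ (by positivity) fun x => ?_
  rw [hL_apply, Prod.norm_def]
  have h1 := norm_fst_le x
  have h2 := norm_snd_le x
  refine max_le ?_ ?_
  · simp only [norm_smul, LinearIsometryEquiv.norm_map, Real.norm_eq_abs, abs_of_pos (zero_lt_one.trans_le hm)]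
    rw [mul_assoc]
    refine mul_le_mul_of_nonneg_left ?_ (by linarith)
    refine (norm_sub_le _ _).trans ?_
    rw [norm_smul]
    nlinarith [norm_nonneg θ]
  · simp only [norm_mul]
    have h3 : ‖(m ^ d)⁻¹‖ ≤ 1 := by
      rw [norm_inv, norm_pow, Real.norm_eq_abs, abs_of_pos (zero_lt_one.trans_le hm)]
      exact inv_le_one_of_one_le₀ (one_le_pow₀ hm)
    calc ‖(m ^ d)⁻¹‖ * ‖x.2‖ ≤ 1 * ‖x‖ := mul_le_mul h3 h2 (norm_nonneg _) zero_le_one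
      _ ≤ m * (1 + ‖θ‖) * ‖x‖ := mul_le_mul_of_nonneg_right (by nlinarith [norm_nonneg θ]) (norm_nonneg _)

/-- bound for the inverse -/
lemma norm_hL_inv_le {m : ℝ} (hm : 1 ≤ m) (R : VV d ≃ₗᵢ[ℝ] VV d) (θ : VV d) (L : WW d →L[ℝ] WW d)
    (hL' : ∀ x, hL m R θ (L x) = x) : ‖L‖ ≤ m ^ d * (1 + ‖θ‖) := by
  have hm0 : 0 < m := zero_lt_one.trans_le hm
  refine ContinuousLinearMap.opNorm_le_bound _ (by positivity) fun x => ?_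
  have h := hL' x
  rw [hL_apply] at h
  have f1 : m • R ((L x).1 - (L x).2 • θ) = x.1 := congrArg Prod.fst h
  have f2 : (m ^ d)⁻¹ * (L x).2 = x.2 := congrArg Prod.snd h
  have e2 : (L x).2 = m ^ d * x.2 := by
    rw [← f2]; field_simp
  have e1 : (L x).1 = m⁻¹ • R.symm x.1 + (m ^ d * x.2) • θ := by
    rw [← e2, ← f1]
    simp [hm0.ne', smul_smul]
  have h1 := norm_fst_le x
  have h2 := norm_snd_le x
  have hmd : 1 ≤ m ^ d := one_le_pow₀ hm
  rw [Prod.norm_def, e1, e2]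
  refine max_le ?_ ?_
  · refine (norm_add_le _ _).trans ?_
    rw [norm_smul, norm_smul, LinearIsometryEquiv.norm_map, norm_mul, norm_inv, norm_pow, Real.norm_eq_abs,
      abs_of_pos hm0]
    have h3 : m⁻¹ ≤ 1 := inv_le_one_of_one_le₀ hm
    calc m⁻¹ * ‖x.1‖ + m ^ d * ‖x.2‖ * ‖θ‖ ≤ m ^ d * ‖x‖ + m ^ d * ‖x‖ * ‖θ‖ := by
          gcongr
          exact h3.trans hmd
      _ = _ := by ring
  · rw [norm_mul, norm_pow, Real.norm_eq_abs, abs_of_pos hm0, mul_assoc]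
    gcongr
    nlinarith [norm_nonneg θ, norm_nonneg x]

/-- the quadratic map -/
def qq (N : WW d →L[ℝ] WW d) (θ : VV d) : VV d := (N (θ, 1)).1 - (N (θ, 1)).2 • θ

/-- effect of conjugation on the last basis vector -/
lemma conj_last {m : ℝ} (hm : 0 < m) (R : VV d ≃ₗᵢ[ℝ] VV d) (θ : VV d) (L N : WW d →L[ℝ] WW d)
    (hL' : ∀ x, L (hL m R θ x) = x) :
    (hL m R θ * N * L) (0, 1) = (m ^ (d + 1) • R (qq N θ), (N (θ, 1)).2) := by
  have h1 : L (0, 1) = m ^ d • ((θ, 1) : WW d) := by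
    have h := hL' (m ^ d • ((θ, 1) : WW d))
    rw [hL_apply] at h
    rw [← h]
    congr 1
    simp [hm.ne']
  rw [ContinuousLinearMap.mul_apply, ContinuousLinearMap.mul_apply, h1, map_smul, map_smul, hL_apply]
  refine Prod.ext ?_ ?_
  · simp only [Prod.smul_mk, smul_smul, qq]
    congr 1
  · simp [hm.ne']

lemma norm_pair_le (θ : VV d) : ‖((θ, 1) : WW d)‖ ≤ 1 + ‖θ‖ := by
  rw [Prod.norm_def]
  refine max_le ?_ ?_
  · simp
  · simp

lemma norm_qq_le (N : WW d →L[ℝ] WW d) (θ : VV d) : ‖qq N θ‖ ≤ (1 + ‖θ‖) ^ 2 * ‖N‖ := by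
  have h0 : ‖N (θ, 1)‖ ≤ ‖N‖ * (1 + ‖θ‖) :=
    (N.le_opNorm _).trans (mul_le_mul_of_nonneg_left (norm_pair_le θ) (norm_nonneg _))
  have h1 := (norm_fst_le (N (θ, 1))).trans h0
  have h2 := (norm_snd_le (N (θ, 1))).trans h0
  calc ‖qq N θ‖ ≤ ‖(N (θ, 1)).1‖ + ‖(N (θ, 1)).2‖ * ‖θ‖ := by
        rw [qq, ← norm_smul]; exact norm_sub_le _ _
    _ ≤ ‖N‖ * (1 + ‖θ‖) + ‖N‖ * (1 + ‖θ‖) * ‖θ‖ := by gcongr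
    _ = _ := by ring

lemma inv_horiz {m : ℝ} (hm : 0 < m) (R : VV d ≃ₗᵢ[ℝ] VV d) (θ : VV d) {h : GG d} (hh : Lg h = hL m R θ)
    (p : VV d) : Lg h⁻¹ (p, 0) = (m⁻¹ • R.symm p, 0) := by
  have h1 := Lg_inv_apply h (m⁻¹ • R.symm p, 0)
  rw [hh, hL_apply] at h1
  rw [← h1]
  congr 1
  simp [hm.ne']

/-- conjugation on horizontal vectors -/
lemma conj_horiz {m : ℝ} (hm : 1 ≤ m) (R : VV d ≃ₗᵢ[ℝ] VV d) (θ : VV d) {h : GG d} (hh : Lg h = hL m R θ)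
    (g : GG d) (p : VV d) : ‖(Lg (h * g * h⁻¹) - 1) (p, 0)‖ ≤ (1 + ‖θ‖) * NW g * ‖p‖ := by
  have hm0 : 0 < m := zero_lt_one.trans_le hm
  rw [Lg_conj_sub, ContinuousLinearMap.mul_apply, ContinuousLinearMap.mul_apply, inv_horiz hm0 R θ hh, hh]
  have h1 : ‖((m⁻¹ • R.symm p, 0) : WW d)‖ = m⁻¹ * ‖p‖ := by
    rw [Prod.norm_def]
    simp only [norm_smul, norm_inv, Real.norm_eq_abs, abs_of_pos hm0, LinearIsometryEquiv.norm_map, norm_zero]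
    exact max_eq_left (by positivity)
  calc _ ≤ ‖hL m R θ‖ * (‖Lg g - 1‖ * ‖((m⁻¹ • R.symm p, 0) : WW d)‖) :=
        (ContinuousLinearMap.le_opNorm _ _).trans
          (mul_le_mul_of_nonneg_left (ContinuousLinearMap.le_opNorm _ _) (norm_nonneg _))
    _ ≤ (m * (1 + ‖θ‖)) * (NW g * (m⁻¹ * ‖p‖)) := by
        rw [h1]
        exact mul_le_mul_of_nonneg_right (norm_hL_le hm R θ) (mul_nonneg (norm_nonneg _) (by positivity))
    _ = _ := by field_simp

lemma conj_vert {m : ℝ} (hm : 0 < m) (R : VV d ≃ₗᵢ[ℝ] VV d) (θ : VV d) {h : GG d} (hh : Lg h = hL m R θ)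
    (g : GG d) : (Lg (h * g * h⁻¹) - 1) (0, 1) =
      (m ^ (d + 1) • R (qq (Lg g - 1) θ), ((Lg g - 1) (θ, 1)).2) := by
  rw [Lg_conj_sub, hh]
  refine conj_last hm R θ _ _ fun x => ?_
  rw [← hh]
  exact Lg_inv_apply h x

lemma snd_le (N : WW d →L[ℝ] WW d) (θ : VV d) : ‖(N (θ, 1)).2‖ ≤ (1 + ‖θ‖) * ‖N‖ := by
  have h0 : ‖N (θ, 1)‖ ≤ ‖N‖ * (1 + ‖θ‖) :=
    (N.le_opNorm _).trans (mul_le_mul_of_nonneg_left (norm_pair_le θ) (norm_nonneg _))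
  rw [mul_comm]
  exact (norm_snd_le (N (θ, 1))).trans h0

lemma hL_theta_inj {m m' : ℝ} (hm' : 0 < m') {R R' : VV d ≃ₗᵢ[ℝ] VV d} {θ θ' : VV d}
    (h : hL m R θ = hL m' R' θ') : θ = θ' := by
  have h1 := congrArg (fun L : WW d →L[ℝ] WW d => (L (θ, 1)).1) h
  simp only [hL_apply, one_smul, sub_self, map_zero, smul_zero] at h1
  have h2 := (smul_eq_zero.1 h1.symm).resolve_left hm'.ne'
  rw [LinearIsometryEquiv.map_eq_zero_iff] at h2
  exact sub_eq_zero.1 h2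

end Conc2

end DriftBA

end

section

namespace DriftBA

set_option linter.unusedSectionVars false
set_option linter.unusedSimpArgs false
set_option linter.unusedVariables false
set_option linter.deprecated false

/-- the concrete data -/
structure Conc (d : ℕ) (I : Type*) [Fintype I] where
  m : ℝ
  R : I → VV d ≃ₗᵢ[ℝ] VV d
  θ : I → VV d
  R0 : ℝ
  B : I → Set (VV d)
  r3 : ℝ
  c1 : ℝ
  one_lt_m : 1 < m
  detR : ∀ i, LinearMap.det ((R i).toLinearEquiv : VV d →ₗ[ℝ] VV d) = 1
  R0_nonneg : 0 ≤ R0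
  disj : ∀ i j, i ≠ j → Disjoint (B i) (B j)
  maps : ∀ i x, ‖x‖ ≤ R0 → ‖θ i + (m ^ (d + 1))⁻¹ • (R i).symm x‖ ≤ R0 ∧
    θ i + (m ^ (d + 1))⁻¹ • (R i).symm x ∈ B i
  r3_pos : 0 < r3
  c1_pos : 0 < c1
  lemN : ∀ g : GG d, NW g < r3 → ∃ good : Finset I, (3 / 4 : ℝ) * Fintype.card I ≤ good.card ∧
    ∀ i ∈ good, ∀ x ∈ B i, c1 * NW g ≤ ‖qq (Lg g - 1) x‖
  hlam1 : 1 < m ^ (d + 1) * c1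
  hlam2 : (1 + R0) ^ 2 * m ^ (d + 1) ≤ (m ^ (d + 1) * c1) ^ 2

namespace Conc

variable {d : ℕ} {I : Type*} [Fintype I] (C : Conc d I)

lemma m_pos : 0 < C.m := zero_lt_one.trans C.one_lt_m

/-- the contraction maps -/
def psi (i : I) (x : VV d) : VV d := C.θ i + (C.m ^ (d + 1))⁻¹ • (C.R i).symm x

lemma psi_zero (i : I) : C.psi i 0 = C.θ i := by simp [psi]

lemma theta_mem (i : I) : C.θ i ∈ C.B i := by
  rw [← psi_zero]; exact (C.maps i 0 (by simpa using C.R0_nonneg)).2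

lemma norm_theta_le (i : I) : ‖C.θ i‖ ≤ C.R0 := by
  rw [← psi_zero]; exact (C.maps i 0 (by simpa using C.R0_nonneg)).1

/-- group elements -/
def h (i : I) : GG d := ofL (hL C.m (C.R i) (C.θ i)) (by rw [det_hL _ C.m_pos, C.detR])

lemma Lg_h (i : I) : Lg (C.h i) = hL C.m (C.R i) (C.θ i) := Lg_ofL _ _

/-- the unipotent group -/
def _root_.DriftBA.uu (t : VV d) : GG d := ofL (uL t) (det_uL t)

lemma _root_.DriftBA.Lg_uu (t : VV d) : Lg (uu t) = uL t := Lg_ofL _ _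

lemma _root_.DriftBA.uu_add (s t : VV d) : uu (s + t) = uu s * uu t := by
  apply Lg_inj
  rw [Lg_mul, Lg_uu, Lg_uu, Lg_uu]
  refine ContinuousLinearMap.ext fun x => ?_
  simp [smul_add, add_assoc, add_comm, add_left_comm]

lemma _root_.DriftBA.toMat_cont : Continuous (toMat (d := d)) :=
  LinearMap.continuous_of_finiteDimensional (toMat (d := d)).toLinearMap

lemma _root_.DriftBA.uu_cont : Continuous (uu (d := d)) := by
  refine Continuous.subtype_mk ?_ _
  refine toMat_cont.comp ?_
  refine continuous_const.add ?_
  have : Continuous fun t : VV d => (ContinuousLinearMap.smulRightL ℝ (WW d) (WW d)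
      (ContinuousLinearMap.snd ℝ (VV d) ℝ)) ((t, 0) : WW d) := by fun_prop
  exact this

lemma h_uu (i : I) (t : VV d) : C.h i * uu t * (C.h i)⁻¹ = uu (C.m ^ (d + 1) • C.R i t) := by
  rw [mul_inv_eq_iff_eq_mul]
  apply Lg_inj
  rw [Lg_mul, Lg_mul, Lg_uu, Lg_uu, Lg_h, uL_hL C.m_pos]

lemma _root_.DriftBA.NW_uu (t : VV d) : ‖t‖ ≤ NW (uu t) := by
  have h1 := (Lg (uu t) - 1).le_opNorm (0, 1)
  have h2 : (Lg (uu t) - 1) ((0, 1) : WW d) = (t, 0) := by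
    rw [Lg_uu, ContinuousLinearMap.sub_apply, uL_apply]; ext <;> simp
  have h3 : ‖((0, 1) : WW d)‖ = 1 := by rw [Prod.norm_def]; simp
  have h4 : ‖((t, 0) : WW d)‖ = ‖t‖ := by rw [Prod.norm_def]; simp
  rw [h2, h3, h4, mul_one] at h1
  exact h1

lemma one_lt_lam : 1 < C.m ^ (d + 1) := one_lt_pow₀ C.one_lt_m (by omega)

lemma norm_h_le (i : I) : ‖Lg (C.h i)‖ ≤ C.m * (1 + C.R0) := by
  rw [Lg_h]
  refine (norm_hL_le C.one_lt_m.le _ _).trans ?_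
  have := C.norm_theta_le i
  have := C.m_pos
  gcongr

lemma norm_h_inv_le (i : I) : ‖Lg (C.h i)⁻¹‖ ≤ C.m ^ d * (1 + C.R0) := by
  refine (norm_hL_inv_le C.one_lt_m.le (C.R i) (C.θ i) _ fun x => ?_).trans ?_
  · rw [← Lg_h]; exact Lg_apply_inv _ _
  have := C.norm_theta_le i
  have := C.m_pos
  gcongr

lemma vert_lower {g : GG d} (i : I) (hg : C.c1 * NW g ≤ ‖qq (Lg g - 1) (C.θ i)‖) :
    (C.m ^ (d + 1) * C.c1) * NW g ≤ NW (C.h i * g * (C.h i)⁻¹) := by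
  have h1 := (Lg (C.h i * g * (C.h i)⁻¹) - 1).le_opNorm (0, 1)
  have h3 : ‖((0, 1) : WW d)‖ = 1 := by rw [Prod.norm_def]; simp
  rw [h3, mul_one, conj_vert C.m_pos _ _ (C.Lg_h i)] at h1
  have h2 := (norm_fst_le _).trans h1
  simp only [norm_smul, LinearIsometryEquiv.norm_map, norm_pow, Real.norm_eq_abs, abs_of_pos C.m_pos] at h2
  refine le_trans ?_ h2
  rw [mul_assoc]
  exact mul_le_mul_of_nonneg_left hg (pow_pos C.m_pos _).le

/-- the abstract system -/
def sys (Y : Set (XX (JJ d))) (hYc : IsCompact Y) (hYi : ∀ i, ∀ x ∈ Y, C.h i • x ∈ Y)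
    (hYs : ∃ ε, 0 < ε ∧ Y ⊆ Cset (JJ d) ε) : Sys I (GG d) (XX (JJ d)) (VV d) where
  h := C.h
  u := uu
  N := NW
  Y := Y
  lam := C.m ^ (d + 1)
  rot := C.R
  one_lt_lam := C.one_lt_lam
  u_cont := uu_cont
  u_add := uu_add
  h_u := C.h_uu
  N_cont := NW_cont
  N_eq_zero := NW_eq_zero
  N_nonneg := NW_nonneg
  N_compact := NW_compact
  N_u := ⟨1, fun t => by rw [one_mul]; exact NW_uu t⟩
  Y_compact := hYc
  Y_inv := hYi
  inj := by
    obtain ⟨ε, hε, hs⟩ := hYs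
    obtain ⟨r, hr, H⟩ := NW_inj (d := d) hε
    exact ⟨r, hr, fun x hx => H x (hs hx)⟩
  locTrans := NW_locTrans
  conj_bound := NW_conj_bound C.h
  expand := by
    refine ⟨C.m ^ (d + 1) * C.c1, C.r3, C.hlam1, C.r3_pos, fun g hg => ⟨?_, fun i => ?_⟩⟩
    · obtain ⟨good, hc, H⟩ := C.lemN g hg
      exact ⟨good, hc, fun i hi => C.vert_lower i (H i hi _ (C.theta_mem i))⟩
    · have h1 := NW_conj (C.h i)⁻¹ (C.h i * g * (C.h i)⁻¹)
      have h2 : (C.h i)⁻¹ * (C.h i * g * (C.h i)⁻¹) * (C.h i)⁻¹⁻¹ = g := by group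
      rw [h2, inv_inv] at h1
      refine h1.trans (mul_le_mul_of_nonneg_right (le_trans ?_ C.hlam2) (NW_nonneg _))
      calc _ ≤ (C.m ^ d * (1 + C.R0)) * (C.m * (1 + C.R0)) :=
            mul_le_mul (C.norm_h_inv_le i) (C.norm_h_le i) (norm_nonneg _)
              (mul_nonneg (pow_pos C.m_pos _).le (by linarith [C.R0_nonneg]))
        _ = _ := by ring

/-- products -/
def Hw (l : List I) : GG d := (l.map C.h).prod

@[simp] lemma Hw_nil : C.Hw [] = 1 := rfl
lemma Hw_append (l l' : List I) : C.Hw (l ++ l') = C.Hw l * C.Hw l' := by simp [Hw]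
lemma Hw_cons (i : I) (l : List I) : C.Hw (i :: l) = C.h i * C.Hw l := by simp [Hw]
lemma Hw_concat (l : List I) (i : I) : C.Hw (l ++ [i]) = C.Hw l * C.h i := by simp [Hw]

/-- position of words -/
def thw (l : List I) : VV d := l.foldl (fun x i => C.psi i x) 0

lemma thw_concat (l : List I) (i : I) : C.thw (l ++ [i]) = C.psi i (C.thw l) := by simp [thw]

lemma norm_thw_le (l : List I) : ‖C.thw l‖ ≤ C.R0 := by
  induction l using List.reverseRecOn with
  | nil => simpa [thw] using C.R0_nonneg
  | append_singleton l i ih =>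
    rw [thw_concat]; exact (C.maps i _ ih).1

lemma thw_mem (l : List I) (i : I) : C.thw (l ++ [i]) ∈ C.B i := by
  rw [thw_concat]; exact (C.maps i _ (C.norm_thw_le l)).2

lemma Lg_Hw (l : List I) : ∃ R : VV d ≃ₗᵢ[ℝ] VV d, Lg (C.Hw l) = hL (C.m ^ l.length) R (C.thw l) := by
  induction l using List.reverseRecOn with
  | nil =>
    refine ⟨LinearIsometryEquiv.refl ℝ _, ?_⟩
    rw [Hw_nil, Lg_one]
    refine ContinuousLinearMap.ext fun x => ?_
    simp [thw]
  | append_singleton l i ih =>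
    obtain ⟨R, hR⟩ := ih
    refine ⟨(C.R i).trans R, ?_⟩
    rw [Hw_concat, Lg_mul, hR, Lg_h, hL_mul (pow_pos C.m_pos _) C.m_pos, thw_concat, List.length_append, List.length_singleton,
      pow_succ C.m l.length]
    rfl

lemma Hw_inj {l l' : List I} (hl : l.length = l'.length) (h : C.Hw l = C.Hw l') : l = l' := by
  induction l using List.reverseRecOn generalizing l' with
  | nil => simpa using (List.length_eq_zero_iff.1 hl.symm).symm
  | append_singleton l i ih =>
    rcases List.eq_nil_or_concat l' with rfl | ⟨l', j, rfl⟩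
    · simp at hl
    rw [List.concat_eq_append] at *
    obtain ⟨R, hR⟩ := C.Lg_Hw (l ++ [i])
    obtain ⟨R', hR'⟩ := C.Lg_Hw (l' ++ [j])
    rw [h, hR'] at hR
    have h1 := hL_theta_inj (pow_pos C.m_pos _) hR
    have hij : i = j := by
      by_contra hne
      have h2 := C.thw_mem l i
      rw [← h1] at h2
      exact Set.disjoint_left.1 (C.disj i j hne) h2 (C.thw_mem l' j)
    subst hij
    rw [Hw_concat, Hw_concat] at h
    rw [ih (by simpa using hl) (mul_right_cancel h)]

end Conc

end DriftBA

end

section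

namespace DriftBA

set_option linter.unusedSectionVars false
set_option linter.unusedSimpArgs false
set_option linter.unusedVariables false
set_option linter.deprecated false

namespace Conc

variable {d : ℕ} {I : Type*} [Fintype I] (C : Conc d I)

/-- elements pulled back -/
def gk (g : GG d) (β : ℕ → I) (K : ℕ) : GG d := (C.Hw (Sys.past β K))⁻¹ * g * C.Hw (Sys.past β K)

lemma past_succ (β : ℕ → I) (K : ℕ) : Sys.past β (K + 1) = Sys.past β K ++ [β K] := by
  simp [Sys.past, List.range_succ]

lemma gk_zero (g : GG d) (β : ℕ → I) : C.gk g β 0 = g := by simp [gk, Sys.past]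

lemma gk_succ (g : GG d) (β : ℕ → I) (K : ℕ) :
    C.gk g β (K + 1) = (C.h (β K))⁻¹ * C.gk g β K * C.h (β K) := by
  rw [gk, gk, past_succ, Hw_concat]; group

lemma gk_conj (g : GG d) (β : ℕ → I) (K : ℕ) :
    C.Hw (Sys.past β K) * C.gk g β K * (C.Hw (Sys.past β K))⁻¹ = g := by
  rw [gk]; group

lemma lam_tendsto : Tendsto (fun K : ℕ => ((C.m ^ (d + 1)) ^ K)⁻¹) atTop (𝓝 0) :=
  tendsto_inv_atTop_zero.comp (tendsto_pow_atTop_atTop_of_one_lt C.one_lt_lam)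

lemma range_of_small {g : GG d} {β : ℕ → I} (H : ∀ K, (C.m ^ (d + 1)) ^ K * NW (C.gk g β K) < 1) :
    g ∈ Set.range (uu (d := d)) := by
  have hlam := C.one_lt_lam
  have hR0 := C.R0_nonneg
  have hN : ∀ K, NW (C.gk g β K) ≤ ((C.m ^ (d + 1)) ^ K)⁻¹ := fun K => by
    have hp : 0 < (C.m ^ (d + 1)) ^ K := pow_pos (by linarith) _
    rw [← one_div, le_div_iff₀ hp, mul_comm]; exact (H K).le
  have h1 : ∀ p : VV d, (Lg g - 1) (p, 0) = 0 := by
    intro p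
    rw [← norm_le_zero_iff]
    have ht : Tendsto (fun K : ℕ => (1 + C.R0) * ((C.m ^ (d + 1)) ^ K)⁻¹ * ‖p‖) atTop (𝓝 ((1 + C.R0) * 0 * ‖p‖)) :=
      (C.lam_tendsto.const_mul _).mul_const _
    rw [mul_zero, zero_mul] at ht
    refine ge_of_tendsto ht (Eventually.of_forall fun K => ?_)
    obtain ⟨R, hR⟩ := C.Lg_Hw (Sys.past β K)
    have := conj_horiz (one_le_pow₀ C.one_lt_m.le) R _ hR (C.gk g β K) p
    rw [gk_conj] at this
    refine this.trans ?_
    have h2 := C.norm_thw_le (Sys.past β K)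
    have h3 := hN K
    have h4 := NW_nonneg (C.gk g β K)
    gcongr
  have h2 : ((Lg g - 1) (0, 1)).2 = 0 := by
    rw [← norm_le_zero_iff]
    have ht : Tendsto (fun K : ℕ => (1 + C.R0) * ((C.m ^ (d + 1)) ^ K)⁻¹) atTop (𝓝 ((1 + C.R0) * 0)) :=
      (C.lam_tendsto.const_mul _)
    rw [mul_zero] at ht
    refine ge_of_tendsto ht (Eventually.of_forall fun K => ?_)
    obtain ⟨R, hR⟩ := C.Lg_Hw (Sys.past β K)
    have := conj_vert (pow_pos C.m_pos _) R _ hR (C.gk g β K)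
    rw [gk_conj] at this
    rw [this]
    refine (snd_le (Lg (C.gk g β K) - 1) (C.thw (Sys.past β K))).trans ?_
    have h2 := C.norm_thw_le (Sys.past β K)
    have h3 := hN K
    have h4 := NW_nonneg (C.gk g β K)
    rw [NW] at h3 h4
    gcongr
  refine ⟨((Lg g - 1) (0, 1)).1, Lg_inj ?_⟩
  rw [Lg_uu]
  refine ContinuousLinearMap.ext fun x => ?_
  have hx : x = (x.1, 0) + x.2 • ((0, 1) : WW d) := by ext <;> simp
  have h3 : (Lg g - 1) x = x.2 • (Lg g - 1) (0, 1) := by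
    conv_lhs => rw [hx]
    rw [map_add, map_smul, h1, zero_add]
  have h4 : Lg g x = x + (Lg g - 1) x := by simp
  rw [h4, h3, uL_apply]
  refine Prod.ext ?_ ?_
  · rfl
  · show x.2 = x.2 + x.2 * ((Lg g - 1) (0, 1)).2
    rw [h2]; ring

lemma drift_elem {ρ : ℝ} {g : GG d} {h : GG d} {m : ℝ} (hm : 1 ≤ m) {R : VV d ≃ₗᵢ[ℝ] VV d} {θ : VV d}
    (hh : Lg h = hL m R θ) {b : ℝ}
    (hb : ‖m ^ (d + 1) • R (qq (Lg g - 1) θ)‖ ≤ b) :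
    ∃ g', h * g * h⁻¹ = g' * uu (m ^ (d + 1) • R (qq (Lg g - 1) θ)) ∧ NW g' ≤ (1 + ‖θ‖) * (2 + b) * NW g := by
  set τ := m ^ (d + 1) • R (qq (Lg g - 1) θ) with hτ
  have hm0 : 0 < m := zero_lt_one.trans_le hm
  have huu : uu (-τ) * uu τ = 1 := by
    rw [← uu_add, neg_add_cancel]
    apply Lg_inj
    rw [Lg_uu, Lg_one]
    refine ContinuousLinearMap.ext fun x => ?_
    simp
  have hb0 : 0 ≤ b := (norm_nonneg _).trans hb
  refine ⟨h * g * h⁻¹ * uu (-τ), by rw [mul_assoc _ (uu (-τ)), huu, mul_one], ?_⟩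
  have hg0 := NW_nonneg g
  refine ContinuousLinearMap.opNorm_le_bound _ (by positivity) fun x => ?_
  set N := Lg (h * g * h⁻¹) - 1 with hN
  have e1 : (Lg (h * g * h⁻¹ * uu (-τ)) - 1) x = N (x.1 - x.2 • τ, 0) + x.2 • ((0, (N (0, 1)).2) : WW d) := by
    have f1 : Lg (h * g * h⁻¹) = 1 + N := by rw [hN]; abel
    have f2 : (N (0, 1)).1 = τ := by rw [hN, conj_vert hm0 R θ hh]
    have f3 : uL (-τ) x = (x.1 - x.2 • τ, 0) + x.2 • ((0, 1) : WW d) := by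
      rw [uL_apply]; ext <;> simp [sub_eq_add_neg]
    rw [Lg_mul, Lg_uu, f1, ContinuousLinearMap.sub_apply, ContinuousLinearMap.mul_apply,
      ContinuousLinearMap.add_apply, ContinuousLinearMap.one_apply, ContinuousLinearMap.one_apply, f3, map_add, map_smul]
    have f4 : N (0, 1) = (τ, 0) + ((0, (N (0, 1)).2) : WW d) := by
      refine Prod.ext ?_ ?_
      · simp [f2]
      · simp
    rw [f4, smul_add]
    have f5 : ((x.1 - x.2 • τ, 0) : WW d) + x.2 • ((0, 1) : WW d) = x - x.2 • ((τ, 0) : WW d) := by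
      ext <;> simp
    rw [f5]
    simp only [Prod.snd_add, zero_add]
    abel
  rw [e1]
  have h1 := conj_horiz hm R θ hh g (x.1 - x.2 • τ)
  have h2 : ‖(N (0, 1)).2‖ ≤ (1 + ‖θ‖) * NW g := by
    rw [hN, conj_vert hm0 R θ hh]; exact snd_le (Lg g - 1) θ
  have h3 : ‖x.1 - x.2 • τ‖ ≤ (1 + b) * ‖x‖ := by
    refine (norm_sub_le _ _).trans ?_
    rw [norm_smul]
    have := norm_fst_le x
    have := norm_snd_le x
    calc ‖x.1‖ + ‖x.2‖ * ‖τ‖ ≤ ‖x‖ + ‖x‖ * b := by gcongr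
      _ = _ := by ring
  have h4 : ‖x.2 • ((0, (N (0, 1)).2) : WW d)‖ ≤ ‖x‖ * ((1 + ‖θ‖) * NW g) := by
    rw [norm_smul]
    have := norm_snd_le x
    have h5 : ‖((0, (N (0, 1)).2) : WW d)‖ = ‖(N (0, 1)).2‖ := by rw [Prod.norm_def]; simp
    rw [h5]
    gcongr
  calc _ ≤ _ := norm_add_le _ _
    _ ≤ (1 + ‖θ‖) * NW g * ((1 + b) * ‖x‖) + ‖x‖ * ((1 + ‖θ‖) * NW g) :=
        add_le_add (h1.trans (mul_le_mul_of_nonneg_left h3 (by positivity))) h4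
    _ = _ := by ring

theorem drift (Y : Set (XX (JJ d))) (hYc : IsCompact Y) (hYi : ∀ i, ∀ x ∈ Y, C.h i • x ∈ Y)
    (hYs : ∃ ε, 0 < ε ∧ Y ⊆ Cset (JJ d) ε) : ∃ b, (C.sys Y hYc hYi hYs).Drift C.c1 b := by
  obtain ⟨C0, hC0, hconj⟩ := NW_conj_bound C.h
  set lam := C.m ^ (d + 1) with hlam
  have h1lam : 1 < lam := C.one_lt_lam
  have hR0 := C.R0_nonneg
  set C2 := lam * C0 with hC2
  have hC2' : 1 < C2 := by nlinarith
  set b := (1 + C.R0) ^ 2 * C2 with hb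
  refine ⟨b, fun ρ hρ => ?_⟩
  have ht : Tendsto (fun K : ℕ => ((1 + C.R0) * (2 + b) * C2) * (lam ^ K)⁻¹) atTop (𝓝 (((1 + C.R0) * (2 + b) * C2) * 0)) :=
    C.lam_tendsto.const_mul _
  have ht2 : Tendsto (fun K : ℕ => C2 * (lam ^ K)⁻¹) atTop (𝓝 (C2 * 0)) :=
    C.lam_tendsto.const_mul _
  rw [mul_zero] at ht ht2
  have hev := (ht.eventually (gt_mem_nhds hρ)).and (ht2.eventually (gt_mem_nhds C.r3_pos))
  obtain ⟨K0, hK0⟩ := eventually_atTop.1 hev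
  refine ⟨(C2 ^ K0)⁻¹, by positivity, fun g hg hgr β => ?_⟩
  replace hgr : NW g < (C2 ^ K0)⁻¹ := hgr
  replace hg : g ∉ Set.range (uu (d := d)) := hg
  have hstep : ∀ K, lam ^ (K + 1) * NW (C.gk g β (K + 1)) ≤ C2 * (lam ^ K * NW (C.gk g β K)) := by
    intro K
    rw [gk_succ]
    have := (hconj (β K) (C.gk g β K)).2
    have hp : 0 < lam ^ K := pow_pos (by linarith) _
    calc _ ≤ lam ^ (K + 1) * (C0 * NW (C.gk g β K)) := by gcongr
      _ = _ := by rw [hC2]; ring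
  have hall : ∀ K, lam ^ K * NW (C.gk g β K) ≤ C2 ^ K * NW g := by
    intro K
    induction K with
    | zero => rw [gk_zero]; simp
    | succ K ih =>
      refine (hstep K).trans ?_
      rw [pow_succ' C2 K, mul_assoc C2]
      exact mul_le_mul_of_nonneg_left ih (zero_lt_one.trans hC2').le
  have hex : ∃ K, 1 ≤ lam ^ K * NW (C.gk g β K) := by
    by_contra hcon
    push Not at hcon
    exact hg (C.range_of_small hcon)
  classical
  obtain ⟨K, hK1, hKmin⟩ : ∃ K, 1 ≤ lam ^ K * NW (C.gk g β K) ∧ ∀ j < K, lam ^ j * NW (C.gk g β j) < 1 :=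
    ⟨Nat.find hex, Nat.find_spec hex, fun j hj => not_le.1 (Nat.find_min hex hj)⟩
  have hKK0 : K0 < K := by
    by_contra hcon
    push Not at hcon
    have h1 := hK1.trans (hall K)
    have h2 : C2 ^ K * NW g < C2 ^ K * (C2 ^ K0)⁻¹ := mul_lt_mul_of_pos_left hgr (by positivity)
    have h3 : C2 ^ K * (C2 ^ K0)⁻¹ ≤ C2 ^ K0 * (C2 ^ K0)⁻¹ := by
      gcongr
      exact hC2'.le
    rw [mul_inv_cancel₀ (by positivity)] at h3
    linarith
  obtain ⟨k, rfl⟩ : ∃ k, K = k + 1 := ⟨K - 1, by omega⟩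
  have hlt : lam ^ (k + 1) * NW (C.gk g β (k + 1)) ≤ C2 := by
    refine (hstep k).trans ?_
    have := (hKmin k (by omega)).le
    nlinarith
  have hpos : 0 < lam ^ (k + 1) := pow_pos (by linarith) _
  have hNle : NW (C.gk g β (k + 1)) ≤ C2 * (lam ^ (k + 1))⁻¹ := by
    rw [← div_eq_mul_inv, le_div_iff₀ hpos, mul_comm]; exact hlt
  obtain ⟨hA, hB⟩ := hK0 (k + 1) hKK0.le
  obtain ⟨good, hcard, hgood⟩ := C.lemN (C.gk g β (k + 1)) (hNle.trans_lt hB)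
  refine ⟨k, good, hcard, fun i hi l hl => ?_⟩
  obtain ⟨R, hR⟩ := C.Lg_Hw (l ++ [i])
  have hlen : (l ++ [i]).length = k + 1 := by simp [hl]
  rw [hlen] at hR
  have hq := hgood i hi _ (C.thw_mem l i)
  have hth := C.norm_thw_le (l ++ [i])
  have hnorm : ‖(C.m ^ (k + 1)) ^ (d + 1) • R (qq (Lg (C.gk g β (k + 1)) - 1) (C.thw (l ++ [i])))‖ =
      lam ^ (k + 1) * ‖qq (Lg (C.gk g β (k + 1)) - 1) (C.thw (l ++ [i]))‖ := by
    rw [norm_smul, LinearIsometryEquiv.norm_map, Real.norm_eq_abs, abs_of_pos (pow_pos (pow_pos C.m_pos _) _),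
      hlam, ← pow_mul, ← pow_mul, mul_comm (k + 1)]
  have hN0 := NW_nonneg (C.gk g β (k + 1))
  have hup : ‖(C.m ^ (k + 1)) ^ (d + 1) • R (qq (Lg (C.gk g β (k + 1)) - 1) (C.thw (l ++ [i])))‖ ≤ b := by
    rw [hnorm]
    calc _ ≤ lam ^ (k + 1) * ((1 + ‖C.thw (l ++ [i])‖) ^ 2 * NW (C.gk g β (k + 1))) := by
          gcongr
          exact norm_qq_le _ _
      _ ≤ lam ^ (k + 1) * ((1 + C.R0) ^ 2 * NW (C.gk g β (k + 1))) := by gcongr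
      _ = (1 + C.R0) ^ 2 * (lam ^ (k + 1) * NW (C.gk g β (k + 1))) := by ring
      _ ≤ b := by rw [hb]; gcongr
  obtain ⟨g', hg', hNg'⟩ := drift_elem (ρ := ρ) (one_le_pow₀ C.one_lt_m.le) hR hup
  refine ⟨g', _, ?_, ?_, ?_, hup⟩
  · rw [← show _ = g' * (C.sys Y hYc hYi hYs).u _ from hg']
    show C.Hw (l ++ [i]) * (C.Hw (Sys.past β (k + 1)))⁻¹ * g * C.Hw (Sys.past β (k + 1)) * (C.Hw (l ++ [i]))⁻¹ = _
    rw [gk]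
    simp only [mul_assoc]
  · refine hNg'.trans (le_trans ?_ hA.le)
    have hb0 : 0 ≤ b := by positivity
    calc _ ≤ (1 + C.R0) * (2 + b) * (C2 * (lam ^ (k + 1))⁻¹) := by gcongr
      _ = _ := by ring
  · rw [hnorm]
    calc C.c1 ≤ C.c1 * (lam ^ (k + 1) * NW (C.gk g β (k + 1))) := le_mul_of_one_le_right C.c1_pos.le hK1
      _ = lam ^ (k + 1) * (C.c1 * NW (C.gk g β (k + 1))) := by ring
      _ ≤ _ := by gcongr

end Conc

end DriftBA

end

section

namespace DriftBA

set_option linter.unusedSectionVars false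
set_option linter.unusedSimpArgs false
set_option linter.unusedVariables false
set_option linter.deprecated false

/-- lattice vectors -/
def lv {d : ℕ} (g : GG d) (v : JJ d → ℤ) : WW d := tow ((g : Matrix (JJ d) (JJ d) ℝ).mulVec (zv v))

lemma Lg_lv {d : ℕ} (h g : GG d) (v : JJ d → ℤ) : Lg h (lv g v) = lv (h * g) v := by
  rw [lv, Lg_tow, lv, Matrix.SpecialLinearGroup.coe_mul, Matrix.mulVec_mulVec]

lemma lv_ne_zero {d : ℕ} (g : GG d) {v : JJ d → ℤ} (hv : v ≠ 0) : lv g v ≠ 0 := by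
  intro h
  have h1 : Lg g (tow (zv v)) = 0 := by rw [Lg_tow]; exact h
  have h2 : tow (zv v) = 0 := by rw [← Lg_inv_apply g (tow (zv v)), h1, map_zero]
  have h3 := norm_le_tow (zv v)
  rw [h2, norm_zero] at h3
  exact zv_ne_zero hv (norm_le_zero_iff.1 h3)

lemma lv_ge {d : ℕ} {ε : ℝ} {g : GG d} (hg : (QuotientGroup.mk g : XX (JJ d)) ∈ Cset (JJ d) ε)
    {v : JJ d → ℤ} (hv : v ≠ 0) : ε ≤ ‖lv g v‖ :=
  (mk_mem_Cset.1 hg v hv).trans (norm_le_tow _)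

namespace Conc

variable {d : ℕ} {I : Type*} [Fintype I] [Nonempty I] [TopologicalSpace I] [DiscreteTopology I] (C : Conc d I)

section YY


lemma no_horiz (Y : Set (XX (JJ d))) (hYc : IsCompact Y) (hYi : ∀ i, ∀ x ∈ Y, C.h i • x ∈ Y)
    (hYs : ∃ ε, 0 < ε ∧ Y ⊆ Cset (JJ d) ε) (z : (C.sys Y hYc hYi hYs).OmT) (g : GG d)
    (hg : (QuotientGroup.mk g : XX (JJ d)) = (C.sys Y hYc hYi hYs).xx z) {v : JJ d → ℤ} (hv : v ≠ 0) :
    (lv g v).2 ≠ 0 := by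
  intro h0
  let S := C.sys Y hYc hYi hYs
  replace hg : (QuotientGroup.mk g : XX (JJ d)) = S.xx z := hg
  obtain ⟨ε, hε, hYε⟩ := id hYs
  have key : ∀ K, ε ≤ (C.m ^ K)⁻¹ * ‖(lv g v).1‖ := by
    intro K
    have h1 := S.xx_back z K
    have h2 := S.xx_mem (S.sg^[K] z)
    set w := Sys.past (S.bb z) K with hw
    have h3 : (QuotientGroup.mk ((C.Hw w)⁻¹ * g) : XX (JJ d)) = S.xx (S.sg^[K] z) := by
      have : (QuotientGroup.mk ((C.Hw w)⁻¹ * g) : XX (JJ d)) = (C.Hw w)⁻¹ • (QuotientGroup.mk g : XX (JJ d)) := rfl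
      rw [this, hg, h1]
      exact inv_smul_smul (C.Hw w) _
    have h4 : ε ≤ ‖lv ((C.Hw w)⁻¹ * g) v‖ := lv_ge (by rw [h3]; exact hYε h2) hv
    obtain ⟨R, hR⟩ := C.Lg_Hw w
    have h5 : lv g v = ((lv g v).1, 0) := Prod.ext rfl h0
    rw [← Lg_lv, h5, inv_horiz (pow_pos C.m_pos _) R _ hR, hw, Sys.length_past, Prod.norm_def] at h4
    simp only [norm_smul, norm_inv, norm_pow, Real.norm_eq_abs, abs_of_pos C.m_pos, LinearIsometryEquiv.norm_map,
      norm_zero, abs_zero] at h4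
    rwa [max_eq_left (mul_nonneg (inv_nonneg.2 (pow_pos C.m_pos _).le) (norm_nonneg _))] at h4
  have ht : Tendsto (fun K : ℕ => (C.m ^ K)⁻¹ * ‖(lv g v).1‖) atTop (𝓝 (0 * ‖(lv g v).1‖)) :=
    (tendsto_inv_atTop_zero.comp (tendsto_pow_atTop_atTop_of_one_lt C.one_lt_m)).mul_const _
  rw [zero_mul] at ht
  have := ge_of_tendsto ht (Eventually.of_forall key)
  linarith

theorem free (Y : Set (XX (JJ d))) (hYc : IsCompact Y) (hYi : ∀ i, ∀ x ∈ Y, C.h i • x ∈ Y)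
    (hYs : ∃ ε, 0 < ε ∧ Y ⊆ Cset (JJ d) ε) : (C.sys Y hYc hYi hYs).Free := by
  let S := C.sys Y hYc hYi hYs
  intro z l l' hl heq
  obtain ⟨g, hg⟩ := QuotientGroup.mk_surjective (S.xx z)
  replace heq : C.Hw l • S.xx z = C.Hw l' • S.xx z := heq
  have h1 : (QuotientGroup.mk (C.Hw l * g) : XX (JJ d)) = QuotientGroup.mk (C.Hw l' * g) := by
    rw [← hg] at heq; exact heq
  rw [QuotientGroup.eq] at h1
  obtain ⟨γ, hγ⟩ := h1
  have h2 : C.Hw l' * g = C.Hw l * g * Matrix.SpecialLinearGroup.map (Int.castRingHom ℝ) γ := by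
    rw [hγ]; group
  refine C.Hw_inj hl ?_
  obtain ⟨R, hR⟩ := C.Lg_Hw l
  obtain ⟨R', hR'⟩ := C.Lg_Hw l'
  have hfix : ∀ v : JJ d → ℤ, (γ : Matrix (JJ d) (JJ d) ℤ).mulVec v = v := by
    intro v
    by_contra hne
    have hne' : (γ : Matrix (JJ d) (JJ d) ℤ).mulVec v - v ≠ 0 := sub_ne_zero.2 hne
    refine C.no_horiz Y hYc hYi hYs z g hg hne' ?_
    have e1 : zv ((γ : Matrix (JJ d) (JJ d) ℤ).mulVec v - v) =
        zv ((γ : Matrix (JJ d) (JJ d) ℤ).mulVec v) + (-1 : ℝ) • zv v := by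
      funext i; simp [zv]; ring
    have e2 : lv g ((γ : Matrix (JJ d) (JJ d) ℤ).mulVec v - v) =
        lv g ((γ : Matrix (JJ d) (JJ d) ℤ).mulVec v) + (-1 : ℝ) • lv g v := by
      rw [lv, e1, Matrix.mulVec_add, Matrix.mulVec_smul, tow_add, tow_smul]; rfl
    have e3 : Lg (C.Hw l) (lv g ((γ : Matrix (JJ d) (JJ d) ℤ).mulVec v)) = Lg (C.Hw l') (lv g v) := by
      rw [Lg_lv, Lg_lv, h2, lv, lv, Matrix.SpecialLinearGroup.coe_mul (C.Hw l * g), coe_map_int, ← Matrix.mulVec_mulVec, zv_mulVec]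
    have e4 := congrArg Prod.snd e3
    rw [hR, hR', hL_apply, hL_apply, hl] at e4
    have e5 : (lv g ((γ : Matrix (JJ d) (JJ d) ℤ).mulVec v)).2 = (lv g v).2 :=
      mul_left_cancel₀ (inv_ne_zero (pow_pos (pow_pos C.m_pos _) _).ne') e4
    rw [e2]
    show (lv g ((γ : Matrix (JJ d) (JJ d) ℤ).mulVec v)).2 + (-1) * (lv g v).2 = 0
    rw [e5]; ring
  have hγ1 : γ = 1 := by
    apply Subtype.ext
    ext i j
    have := congrFun (hfix (Pi.single j 1)) i
    simp only [Matrix.mulVec_single_one, Matrix.col_apply] at this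
    rw [this, Matrix.SpecialLinearGroup.coe_one, Matrix.one_apply, Pi.single_apply]
  rw [hγ1, map_one, mul_one] at h2
  exact (mul_right_cancel h2).symm

theorem Y_empty (Y : Set (XX (JJ d))) (hYc : IsCompact Y) (hYi : ∀ i, ∀ x ∈ Y, C.h i • x ∈ Y)
    (hYs : ∃ ε, 0 < ε ∧ Y ⊆ Cset (JJ d) ε) (hd : 1 ≤ d) (hcard : 2 ≤ Fintype.card I) : Y = ∅ := by
  by_contra hne
  have hne : Y.Nonempty := Set.nonempty_iff_ne_empty.2 hne
  let S := C.sys Y hYc hYi hYs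
  obtain ⟨b0, hb0⟩ := C.drift Y hYc hYi hYs
  set b := max b0 C.c1 with hb
  have hdr : S.Drift C.c1 b := by
    intro ρ hρ
    obtain ⟨r, hr, H⟩ := hb0 ρ hρ
    refine ⟨r, hr, fun g hg hgr β => ?_⟩
    obtain ⟨k, good, hc, H2⟩ := H g hg hgr β
    refine ⟨k, good, hc, fun i hi l hl => ?_⟩
    obtain ⟨g', τ, h1, h2, h3, h4⟩ := H2 i hi l hl
    exact ⟨g', τ, h1, h2, h3, h4.trans (le_max_left _ _)⟩
  haveI : Nonempty (Fin d) := ⟨⟨0, hd⟩⟩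
  have hab : (Sys.shell (V := VV d) C.c1 b).Nonempty := by
    obtain ⟨x, hx⟩ := exists_norm_eq (VV d) C.c1_pos.le
    exact ⟨x, hx.ge, hx.le.trans (le_max_right _ _)⟩
  obtain ⟨s, hs1, hs2, β, x, H⟩ := S.exists_line hab hdr (C.free Y hYc hYi hYs) hcard hne
  obtain ⟨ε, hε, hYε⟩ := id hYs
  obtain ⟨g, hg⟩ := QuotientGroup.mk_surjective x
  obtain ⟨Ct, hCt, htow⟩ := tow_bound (d := d)
  have hs0 : 0 < ‖s‖ := C.c1_pos.trans_le hs1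
  have hbp : 0 < b := hs0.trans_le hs2
  set e : ℝ := ε / (2 * (Ct + b)) with he
  have hep : 0 < e := by positivity
  obtain ⟨T, hT, htube⟩ := tube (ι := JJ d) e hep
  set ω : JJ d → ℝ := Sum.elim (fun i => s i / ‖s‖) (fun _ => 0) with hω
  have hωω : ω ⬝ᵥ ω = 1 := by
    have h1 : ‖s‖ ^ 2 = ∑ i, s i ^ 2 := by rw [EuclideanSpace.real_norm_sq_eq]
    simp only [hω, dotProduct, Fintype.sum_sum_type, Sum.elim_inl, Sum.elim_inr, mul_zero, Finset.sum_const_zero, add_zero]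
    have h2 : ∀ i, s i / ‖s‖ * (s i / ‖s‖) = s i ^ 2 / ‖s‖ ^ 2 := fun i => by ring
    simp only [h2]
    rw [← Finset.sum_div, ← h1, div_self (by positivity)]
  obtain ⟨v, hv, y, hy, hgv⟩ := htube (g : Matrix (JJ d) (JJ d) ℝ) (by rw [g.2]; simp) ω hωω
  set r := e * T * (ω ⬝ᵥ y) with hr
  have hlv : lv g v = e • tow y + r • tow ω := by rw [lv, hgv, tow_add, tow_smul, tow_smul]
  have htω : tow ω = (‖s‖⁻¹ • s, 0) := by
    refine Prod.ext ?_ ?_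
    · ext i
      rw [tow_fst]
      simp [hω]; ring
    · rw [tow_snd]; rfl
  have hz0 : (β, x) ∈ S.Om := by
    have := H 0
    have h1 : S.u ((((0 : ℤ) : ℝ)) • s) = 1 := by
      rw [Int.cast_zero, zero_smul]; exact S.u_zero
    rwa [h1, one_smul] at this
  have hq : (lv g v).2 ≠ 0 := C.no_horiz Y hYc hYi hYs ⟨(β, x), hz0⟩ g hg hv
  set q := (lv g v).2 with hqdef
  have hqe : q = e * (tow y).2 := by
    rw [hqdef, hlv, htω]; simp
  have hqle : |q| ≤ e * Ct := by
    rw [hqe, abs_mul, abs_of_pos hep]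
    have h1 := (norm_snd_le (tow y)).trans (htow y)
    have h2 : |(tow y).2| ≤ Ct * 1 := h1.trans (mul_le_mul_of_nonneg_left hy hCt.le)
    rw [mul_one] at h2
    gcongr
  have hqle' : |q| ≤ e := by
    rw [hqe, abs_mul, abs_of_pos hep, tow_snd]
    have h1 : |y (Sum.inr ())| ≤ 1 := (norm_le_pi_norm y (Sum.inr ())).trans hy
    nlinarith
  set k : ℤ := -round (r / (‖s‖ * q)) with hk
  have hmem := H k
  have hmemY := hYε (S.Om_snd hmem)
  have hx2 : S.u ((k : ℝ) • s) • x = (QuotientGroup.mk (uu ((k : ℝ) • s) * g) : XX (JJ d)) := by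
    rw [← hg]; rfl
  rw [hx2] at hmemY
  have hge := lv_ge hmemY hv
  have hval : lv (uu ((k : ℝ) • s) * g) v = e • tow y + (((r / ‖s‖) + k * q) • s, 0) := by
    rw [← Lg_lv, Lg_uu, uL_apply, ← hqdef]
    refine Prod.ext ?_ ?_
    · show (lv g v).1 + q • ((k : ℝ) • s) = (e • tow y).1 + ((r / ‖s‖) + k * q) • s
      rw [hlv, htω]
      simp only [Prod.fst_add, Prod.smul_fst]
      rw [add_assoc, smul_smul, smul_smul, ← add_smul]
      congr 2
      ring
    · show q = (e • tow y).2 + 0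
      rw [hqe]; simp
  have hround : |r / ‖s‖ + k * q| ≤ |q| / 2 := by
    have h1 := abs_sub_round (r / (‖s‖ * q))
    have h2 : r / ‖s‖ + k * q = q * (r / (‖s‖ * q) - round (r / (‖s‖ * q))) := by
      rw [hk]; push_cast; field_simp; ring
    rw [h2, abs_mul]
    calc _ ≤ |q| * (1 / 2) := mul_le_mul_of_nonneg_left h1 (abs_nonneg _)
      _ = _ := by ring
  have hlt : ‖lv (uu ((k : ℝ) • s) * g) v‖ ≤ e * Ct + e / 2 * b := by
    rw [hval]
    refine (norm_add_le _ _).trans (add_le_add ?_ ?_)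
    · rw [norm_smul, Real.norm_eq_abs, abs_of_pos hep]
      have h1 := (htow y).trans (mul_le_mul_of_nonneg_left hy hCt.le)
      rw [mul_one] at h1
      gcongr
    · have h1 : ‖((((r / ‖s‖) + k * q) • s, 0) : WW d)‖ = |r / ‖s‖ + k * q| * ‖s‖ := by
        rw [Prod.norm_def]; simp [norm_smul]; positivity
      rw [h1]
      have : |r / ‖s‖ + k * q| ≤ e / 2 := hround.trans (by linarith)
      gcongr
  have : e * (2 * (Ct + b)) = ε := by rw [he]; field_simp
  nlinarith [mul_pos hep hCt, mul_pos hep hbp]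

end YY

/-- exit times are bounded -/
theorem exit (hd : 1 ≤ d) (hcard : 2 ≤ Fintype.card I) {ε : ℝ} (hε : 0 < ε) :
    ∃ F : Finset (List I), ∀ g : Matrix (JJ d) (JJ d) ℝ, |g.det| = 1 → ∃ l ∈ F,
      ¬ good ε ((C.Hw l : Matrix (JJ d) (JJ d) ℝ) * g) := by
  set Y : Set (XX (JJ d)) := ⋂ l : List I, (fun x => C.Hw l • x) ⁻¹' (Cset (JJ d) ε) with hY
  have hYcl : IsClosed Y := isClosed_iInter fun l => (Cset_closed ε).preimage (continuous_const_smul _)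
  have hYsub : Y ⊆ Cset (JJ d) ε := fun x hx => by
    have := Set.mem_iInter.1 hx []
    simpa using this
  have hYc : IsCompact Y := (Cset_compact hε).of_isClosed_subset hYcl hYsub
  have hYi : ∀ i, ∀ x ∈ Y, C.h i • x ∈ Y := by
    intro i x hx
    refine Set.mem_iInter.2 fun l => ?_
    have := Set.mem_iInter.1 hx (l ++ [i])
    simp only [Set.mem_preimage, Hw_concat, mul_smul] at this
    exact this
  have hE := C.Y_empty Y hYc hYi ⟨ε, hε, hYsub⟩ hd hcard
  have hcov : Cset (JJ d) ε ⊆ ⋃ l : List I, ((fun x => C.Hw l • x) ⁻¹' (Cset (JJ d) ε))ᶜ := by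
    rw [← Set.compl_iInter, ← hY, hE]; simp
  classical
  obtain ⟨F, hF⟩ := (Cset_compact (ι := JJ d) hε).elim_finite_subcover _
    (fun l => ((Cset_closed ε).preimage (continuous_const_smul (C.Hw l))).isOpen_compl) hcov
  have hdet1 : ∀ g : GG d, ∃ l ∈ insert [] F, ¬ good ε ((C.Hw l : Matrix (JJ d) (JJ d) ℝ) * (g : Matrix (JJ d) (JJ d) ℝ)) := by
    intro g
    by_cases hg : (QuotientGroup.mk g : XX (JJ d)) ∈ Cset (JJ d) ε
    · obtain ⟨l, hl, hlx⟩ := Set.mem_iUnion₂.1 (hF hg)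
      refine ⟨l, Finset.mem_insert_of_mem hl, fun hgood => hlx ?_⟩
      rw [← Matrix.SpecialLinearGroup.coe_mul, ← mk_mem_Cset] at hgood
      exact hgood
    · refine ⟨[], Finset.mem_insert_self _ _, fun hgood => hg ?_⟩
      rw [mk_mem_Cset]
      simpa using hgood
  refine ⟨insert [] F, fun g hg => ?_⟩
  rcases (abs_eq (by norm_num)).1 hg with h1 | h1
  · exact hdet1 ⟨g, h1⟩
  · set D : Matrix (JJ d) (JJ d) ℤ := Matrix.diagonal (Function.update 1 (Sum.inr ()) (-1)) with hD
    have hDdet : (D.map (Int.cast : ℤ → ℝ)).det = -1 := by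
      have : (D.map (Int.cast : ℤ → ℝ)) = Matrix.diagonal (Function.update 1 (Sum.inr ()) (-1)) := by
        rw [hD, Matrix.diagonal_map (by simp)]
        congr 1
        funext j
        rcases j with j | j <;> simp [Function.update_apply]
      rw [this, Matrix.det_diagonal]
      simp [Function.update_apply]
    have hDD : D * D = 1 := by
      rw [hD, Matrix.diagonal_mul_diagonal, ← Matrix.diagonal_one]
      congr 1
      funext j
      rcases j with j | j <;> simp [Function.update_apply]
    obtain ⟨l, hl, hng⟩ := hdet1 ⟨g * D.map (Int.cast : ℤ → ℝ), by rw [Matrix.det_mul, h1, hDdet]; norm_num⟩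
    refine ⟨l, hl, fun hgood => hng ?_⟩
    intro v hv
    have : ((C.Hw l : Matrix (JJ d) (JJ d) ℝ) * (g * D.map (Int.cast : ℤ → ℝ))).mulVec (zv v) =
        ((C.Hw l : Matrix (JJ d) (JJ d) ℝ) * g).mulVec (zv (D.mulVec v)) := by
      rw [← zv_mulVec, Matrix.mulVec_mulVec, Matrix.mul_assoc]
    show ε ≤ ‖((C.Hw l : Matrix (JJ d) (JJ d) ℝ) * (g * D.map (Int.cast : ℤ → ℝ))).mulVec (zv v)‖
    rw [this]
    refine hgood _ fun h0 => hv ?_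
    have := congrArg D.mulVec h0
    rw [Matrix.mulVec_mulVec, hDD] at this
    simpa using this

end Conc

end DriftBA

end

section

namespace DriftBA

set_option linter.unusedSectionVars false
set_option linter.unusedSimpArgs false
set_option linter.unusedVariables false
set_option linter.deprecated false

section LemN

variable {d : ℕ}

/-- lift to the affine hyperplane -/
def ww (x : VV d) : WW d := (x, 1)

lemma finrank_WW : Module.finrank ℝ (WW d) = d + 1 := by simp

lemma scalar_of_eigen {I : Type*} [DecidableEq I] (w : I → WW d) (B : Finset I) (hB : d + 2 ≤ B.card)
    (hgp : ∀ S : Finset I, S.card ≤ d + 1 → LinearIndepOn ℝ w (S : Set I))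
    (N : WW d →L[ℝ] WW d) (c : I → ℝ) (hN : ∀ i ∈ B, N (w i) = c i • w i) :
    ∃ c0 : ℝ, N = c0 • (1 : WW d →L[ℝ] WW d) := by
  obtain ⟨S, hSB, hSc⟩ := Finset.exists_subset_card_eq (show d + 1 ≤ B.card by omega)
  obtain ⟨j, hjB, hjS⟩ : ∃ j ∈ B, j ∉ S := by
    by_contra hcon
    push Not at hcon
    have := Finset.card_le_card (show B ⊆ S from hcon)
    omega
  have hLI := hgp S hSc.le
  have hspan : ⊤ ≤ Submodule.span ℝ (w '' (S : Set I)) := by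
    have h1 : LinearIndependent ℝ (fun i : S => w i) := hLI
    have h2 := h1.span_eq_top_of_card_eq_finrank' (by rw [finrank_WW]; simpa using hSc)
    rw [← h2]
    refine Submodule.span_mono ?_
    rintro _ ⟨i, rfl⟩
    exact ⟨i, i.2, rfl⟩
  obtain ⟨lam, hlam⟩ : ∃ lam : I → ℝ, ∑ i ∈ S, lam i • w i = w j := by
    have h1 : w j ∈ Submodule.span ℝ (w '' (S : Set I)) := hspan trivial
    rw [Submodule.mem_span_image_finset_iff_exists_fun] at h1
    obtain ⟨c, hc⟩ := h1
    refine ⟨fun i => if h : i ∈ S then c ⟨i, h⟩ else 0, ?_⟩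
    rw [← hc, ← Finset.sum_coe_sort]
    refine Finset.sum_congr rfl fun i _ => ?_
    simp
  rw [linearIndepOn_finset_iff] at hLI
  have hnz : ∀ i ∈ S, lam i ≠ 0 := by
    intro s hs h0
    have hcard : (insert j (S.erase s)).card ≤ d + 1 := by
      refine (Finset.card_insert_le _ _).trans ?_
      rw [Finset.card_erase_of_mem hs]; omega
    have h1 := linearIndepOn_finset_iff.1 (hgp _ hcard) (fun i => if i = j then -1 else lam i) (by
      rw [Finset.sum_insert (fun h => hjS (Finset.mem_of_mem_erase h))]
      have h2 : ∑ i ∈ S.erase s, (if i = j then (-1 : ℝ) else lam i) • w i = ∑ i ∈ S, lam i • w i := by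
        rw [← Finset.sum_erase S (a := s) (by rw [h0, zero_smul])]
        refine Finset.sum_congr rfl fun i hi => ?_
        rw [if_neg]
        rintro rfl
        exact hjS (Finset.mem_of_mem_erase hi)
      rw [h2, hlam]; simp) j (Finset.mem_insert_self _ _)
    simp at h1
  have hc : ∀ i ∈ S, c i = c j := by
    have h1 : ∑ i ∈ S, (lam i * (c i - c j)) • w i = 0 := by
      have h2 := hN j hjB
      conv_lhs at h2 => rw [← hlam, map_sum]
      rw [← hlam, Finset.smul_sum] at h2
      rw [← sub_eq_zero, ← Finset.sum_sub_distrib] at h2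
      rw [← h2]
      refine Finset.sum_congr rfl fun i hi => ?_
      rw [map_smul, hN i (hSB hi), smul_smul, smul_smul, ← sub_smul]
      congr 1
      ring
    intro i hi
    have := hLI _ h1 i hi
    exact sub_eq_zero.1 ((mul_eq_zero.1 this).resolve_left (hnz i hi))
  refine ⟨c j, ContinuousLinearMap.ext fun x => ?_⟩
  have hx : x ∈ Submodule.span ℝ (w '' (S : Set I)) := hspan trivial
  induction hx using Submodule.span_induction with
  | mem x hx =>
    obtain ⟨i, hi, rfl⟩ := hx
    rw [hN i (hSB hi), hc i hi]; rfl
  | zero => simp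
  | add x y _ _ hx hy => rw [map_add, hx, hy, map_add]
  | smul a x _ hx => rw [map_smul, hx, map_smul]

/-- determinant as a function of operators -/
def dt (L : WW d →L[ℝ] WW d) : ℝ := (toMat L).det

lemma dt_diff : Differentiable ℝ (dt (d := d)) := by
  have hent : ∀ i j, Differentiable ℝ fun L : WW d →L[ℝ] WW d => toMat L i j := by
    intro i j
    exact (LinearMap.toContinuousLinearMap
      ((Matrix.entryLinearMap ℝ ℝ i j) ∘ₗ (toMat (d := d)).toLinearMap)).differentiable
  have : (dt (d := d)) = fun L => ∑ σ : Equiv.Perm (JJ d), ((Equiv.Perm.sign σ : ℤ) : ℝ) * ∏ i, toMat L (σ i) i := by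
    funext L
    rw [dt, Matrix.det_apply']
  rw [this]
  refine Differentiable.fun_sum fun σ _ => ?_
  refine Differentiable.const_mul ?_ _
  have hp : ∀ T : Finset (JJ d), Differentiable ℝ fun L : WW d →L[ℝ] WW d => ∏ i ∈ T, toMat L (σ i) i := by
    classical
    intro T
    induction T using Finset.induction_on with
    | empty => simp
    | insert a T ha ih =>
      simp only [Finset.prod_insert ha]
      exact (hent _ _).fun_mul ih
  exact hp _

lemma dt_scalar (t : ℝ) : dt ((1 + t) • (1 : WW d →L[ℝ] WW d)) = (1 + t) ^ (d + 1) := by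
  rw [dt, map_smul, toMat_one, Matrix.det_smul, Matrix.det_one, mul_one]
  simp

lemma fderiv_dt_one : fderiv ℝ (dt (d := d)) 1 1 = d + 1 := by
  have h1 : HasDerivAt (fun t : ℝ => (1 + t) • (1 : WW d →L[ℝ] WW d)) (1 : WW d →L[ℝ] WW d) 0 := by
    have := ((hasDerivAt_id (0 : ℝ)).const_add 1).smul_const (1 : WW d →L[ℝ] WW d)
    simpa using this
  have h2 : HasFDerivAt (dt (d := d)) (fderiv ℝ (dt (d := d)) 1) ((1 + (0 : ℝ)) • (1 : WW d →L[ℝ] WW d)) := by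
    rw [add_zero, one_smul]; exact (dt_diff 1).hasFDerivAt
  have h3 := h2.comp_hasDerivAt (0 : ℝ) h1
  have h4 : HasDerivAt (fun t : ℝ => (1 + t) ^ (d + 1)) ((d : ℝ) + 1) 0 := by
    have := ((hasDerivAt_id (0 : ℝ)).const_add 1).fun_pow (d + 1)
    simpa using this
  refine h3.unique ?_
  refine h4.congr_of_eventuallyEq (Eventually.of_forall fun t => ?_)
  exact dt_scalar t

lemma qq_smul (c : ℝ) (N : WW d →L[ℝ] WW d) (x : VV d) : qq (c • N) x = c • qq N x := by
  simp [qq, smul_sub, smul_smul]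

lemma qq_cont : Continuous fun p : (WW d →L[ℝ] WW d) × VV d => qq p.1 p.2 := by
  have h1 : Continuous fun p : (WW d →L[ℝ] WW d) × VV d => p.1 (p.2, 1) :=
    continuous_fst.clm_apply (continuous_snd.prodMk continuous_const)
  exact (continuous_fst.comp h1).sub ((continuous_snd.comp h1).smul continuous_snd)

theorem lemma_N {I : Type*} [Fintype I] [DecidableEq I] (hI : Fintype.card I = 4 * (d + 1)) (a : I → VV d)
    (hgp : ∀ S : Finset I, S.card ≤ d + 1 → LinearIndepOn ℝ (fun i => ww (a i)) (S : Set I)) :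
    ∃ κ : ℝ, 0 < κ ∧ ∀ g : GG d, NW g < κ → ∃ good : Finset I, (3 / 4 : ℝ) * Fintype.card I ≤ good.card ∧
      ∀ i ∈ good, ∀ x, dist x (a i) < κ → κ * NW g ≤ ‖qq (Lg g - 1) x‖ := by
  classical
  by_contra hcon
  push Not at hcon
  set κ : ℕ → ℝ := fun n => 1 / ((n : ℝ) + 1) with hκ
  have hκpos : ∀ n, 0 < κ n := fun n => by positivity
  have hκ0 : Tendsto κ atTop (𝓝 0) := tendsto_one_div_add_atTop_nhds_zero_nat
  choose g hg hbad using fun n => hcon (κ n) (hκpos n)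
  set bad : ℕ → Finset I := fun n => Finset.univ.filter fun i => ∃ x, dist x (a i) < κ n ∧
    ‖qq (Lg (g n) - 1) x‖ < κ n * NW (g n) with hbaddef
  have hbc : ∀ n, d + 2 ≤ (bad n).card := by
    intro n
    by_contra hlt
    push Not at hlt
    obtain ⟨i, hi, x, hx1, hx2⟩ := hbad n ((bad n)ᶜ) (by
      rw [Finset.card_compl, Nat.cast_sub (Finset.card_le_univ _), hI]
      have : ((bad n).card : ℝ) ≤ d + 1 := by exact_mod_cast (by omega : (bad n).card ≤ d + 1)
      push_cast
      linarith)
    rw [Finset.mem_compl] at hi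
    exact hi (Finset.mem_filter.2 ⟨Finset.mem_univ _, x, hx1, hx2⟩)
  set f : Ultrafilter ℕ := hyperfilter ℕ with hf
  have hfle : (f : Filter ℕ) ≤ atTop := by
    rw [hf, ← Nat.cofinite_eq_atTop]; exact hyperfilter_le_cofinite
  have hNpos : ∀ n, 0 < NW (g n) := by
    intro n
    obtain ⟨i, hi⟩ := Finset.card_pos.1 (show 0 < (bad n).card by have := hbc n; omega)
    obtain ⟨x, hx1, hx2⟩ := (Finset.mem_filter.1 hi).2
    exact pos_of_mul_pos_right ((norm_nonneg _).trans_lt hx2) (hκpos n).le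
  obtain ⟨E, hE⟩ : ∃ E : ℕ → (WW d →L[ℝ] WW d), ∀ n, E n = (NW (g n))⁻¹ • (Lg (g n) - 1) := ⟨_, fun _ => rfl⟩
  have hE1 : ∀ n, ‖E n‖ = 1 := fun n => by
    rw [hE, norm_smul, norm_inv, Real.norm_eq_abs, abs_of_pos (hNpos n)]
    exact inv_mul_cancel₀ (hNpos n).ne'
  obtain ⟨N0, hN0, hlim⟩ : ∃ N0 ∈ Metric.sphere (0 : WW d →L[ℝ] WW d) 1, Tendsto E f (𝓝 N0) := by
    have hc : IsCompact (Metric.sphere (0 : WW d →L[ℝ] WW d) 1) := isCompact_sphere _ _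
    obtain ⟨N0, h1, h2⟩ := hc.ultrafilter_le_nhds (f.map E) (by
      rw [le_principal_iff, Ultrafilter.mem_coe, Ultrafilter.mem_map]
      exact Filter.univ_mem' fun n => by simp [hE1])
    exact ⟨N0, h1, h2⟩
  set B : Finset I := Finset.univ.filter fun i => ∀ᶠ n in (f : Filter ℕ), i ∈ bad n with hB
  have hBbad : ∃ n, bad n = B := by
    have h1 : ∀ᶠ n in (f : Filter ℕ), ∀ i, (i ∈ bad n ↔ i ∈ B) := by
      rw [eventually_all]
      intro i
      by_cases h : ∀ᶠ n in (f : Filter ℕ), i ∈ bad n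
      · have hi : i ∈ B := Finset.mem_filter.2 ⟨Finset.mem_univ _, h⟩
        filter_upwards [h] with n hn
        simp [hn, hi]
      · have hi : i ∉ B := fun h' => h (Finset.mem_filter.1 h').2
        rw [← Ultrafilter.eventually_not] at h
        filter_upwards [h] with n hn
        simp [hn, hi]
    obtain ⟨n, hn⟩ := h1.exists
    exact ⟨n, Finset.ext hn⟩
  have hBc : d + 2 ≤ B.card := by
    obtain ⟨n, hn⟩ := hBbad
    rw [← hn]; exact hbc n
  have hzero : ∀ i ∈ B, qq N0 (a i) = 0 := by
    intro i hi
    have hi' := (Finset.mem_filter.1 hi).2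
    have hch : ∀ n, ∃ x, i ∈ bad n → dist x (a i) < κ n ∧ ‖qq (Lg (g n) - 1) x‖ < κ n * NW (g n) := by
      intro n
      by_cases h : i ∈ bad n
      · obtain ⟨x, hx⟩ := (Finset.mem_filter.1 h).2
        exact ⟨x, fun _ => hx⟩
      · exact ⟨0, fun h' => absurd h' h⟩
    choose x hx using hch
    have hxlim : Tendsto x f (𝓝 (a i)) := by
      rw [tendsto_iff_dist_tendsto_zero]
      refine squeeze_zero' (Eventually.of_forall fun _ => dist_nonneg) ?_ (hκ0.mono_left hfle)
      filter_upwards [hi'] with n hn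
      exact (hx n hn).1.le
    have h1 : Tendsto (fun n => qq (E n) (x n)) f (𝓝 (qq N0 (a i))) := by
      have h3 : Tendsto (fun n => (E n, x n)) f (𝓝 (N0, a i)) := hlim.prodMk_nhds hxlim
      have h4 := Tendsto.comp (qq_cont.tendsto (N0, a i)) h3
      exact h4
    have h2 : Tendsto (fun n => qq (E n) (x n)) f (𝓝 0) := by
      rw [tendsto_zero_iff_norm_tendsto_zero]
      refine squeeze_zero' (Eventually.of_forall fun _ => norm_nonneg _) ?_ (hκ0.mono_left hfle)
      filter_upwards [hi'] with n hn
      rw [hE, qq_smul, norm_smul, norm_inv, Real.norm_eq_abs, abs_of_pos (hNpos n), inv_mul_le_iff₀ (hNpos n), mul_comm]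
      exact (hx n hn).2.le
    exact tendsto_nhds_unique h1 h2
  obtain ⟨c, hc⟩ := scalar_of_eigen (fun i => ww (a i)) B hBc hgp N0 (fun i => (N0 (ww (a i))).2) (by
    intro i hi
    have h := hzero i hi
    rw [qq, sub_eq_zero] at h
    refine Prod.ext ?_ ?_
    · exact h
    · simp [ww])
  have hder : Tendsto (fun n => fderiv ℝ (dt (d := d)) 1 (E n)) f (𝓝 0) := by
    have hN : Tendsto (fun n => Lg (g n) - 1) f (𝓝 0) := by
      rw [tendsto_zero_iff_norm_tendsto_zero]
      exact squeeze_zero' (Eventually.of_forall fun _ => norm_nonneg _)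
        (Eventually.of_forall fun n => (hg n).le) (hκ0.mono_left hfle)
    have ho := (hasFDerivAt_iff_isLittleO_nhds_zero.1 (dt_diff (d := d) 1).hasFDerivAt).comp_tendsto hN
    rw [Metric.tendsto_nhds]
    intro η hη
    have h1 := ho.def (half_pos hη)
    filter_upwards [h1] with n hn
    have e1 : dt (1 + (Lg (g n) - 1)) = 1 := by
      rw [add_sub_cancel, dt, toMat_Lg, (g n).2]
    have e2 : dt (1 : WW d →L[ℝ] WW d) = 1 := by rw [dt, toMat_one, Matrix.det_one]
    simp only [Function.comp, e1, e2, sub_self, zero_sub, norm_neg] at hn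
    rw [dist_zero_right, hE]
    simp only [map_smul, norm_smul, norm_inv, Real.norm_eq_abs, abs_of_pos (hNpos n)]
    rw [inv_mul_lt_iff₀ (hNpos n), mul_comm]
    refine hn.trans_lt ?_
    have : ‖Lg (g n) - 1‖ = NW (g n) := rfl
    rw [this]
    nlinarith [hNpos n]
  have hder2 : Tendsto (fun n => fderiv ℝ (dt (d := d)) 1 (E n)) f (𝓝 (fderiv ℝ (dt (d := d)) 1 N0)) :=
    ((fderiv ℝ (dt (d := d)) 1).continuous.tendsto N0).comp hlim
  have h0 := tendsto_nhds_unique hder2 hder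
  rw [hc, map_smul, fderiv_dt_one, smul_eq_mul] at h0
  have hc0 : c = 0 := (mul_eq_zero.1 h0).resolve_right (by positivity)
  have hz : N0 = 0 := by
    rw [hc, hc0]
    exact ContinuousLinearMap.ext fun x => by simp
  rw [hz] at hN0
  simp at hN0

end LemN

end DriftBA

end

section

namespace DriftBA

set_option linter.unusedSectionVars false
set_option linter.unusedSimpArgs false
set_option linter.unusedVariables false
set_option linter.deprecated false

/-- a prefixed sequence -/
def scons {E : Type*} (e : E) (b : ℕ → E) : ℕ → E
  | 0 => e
  | n + 1 => b n

/-- initial word -/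
def pre {E : Type*} (b : ℕ → E) (n : ℕ) : List E := (List.range n).map b

lemma pre_succ {E : Type*} (b : ℕ → E) (n : ℕ) : pre b (n + 1) = pre b n ++ [b n] := by
  simp [pre, List.range_succ]

lemma pre_length {E : Type*} (b : ℕ → E) (n : ℕ) : (pre b n).length = n := by simp [pre]

/-- a similarity IFS with its coding map -/
structure IFS (d : ℕ) (E : Type*) [Fintype E] where
  m : E → ℝ
  R : E → VV d ≃ₗᵢ[ℝ] VV d
  θ : E → VV d
  R0 : ℝ
  pi : (ℕ → E) → VV d
  one_lt_m : ∀ e, 1 < m e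
  R0_pos : 0 < R0
  maps : ∀ e x, ‖x‖ ≤ R0 → ‖θ e + (m e ^ (d + 1))⁻¹ • (R e).symm x‖ ≤ R0
  pi_ball : ∀ b, ‖pi b‖ ≤ R0
  pi_cons : ∀ e b, pi (scons e b) = θ e + (m e ^ (d + 1))⁻¹ • (R e).symm (pi b)

namespace IFS

variable {d : ℕ} {E : Type*} [Fintype E] (S : IFS d E)

/-- word maps -/
def W : List E → VV d → VV d
  | [], x => x
  | e :: l, x => S.θ e + (S.m e ^ (d + 1))⁻¹ • (S.R e).symm (W l x)

/-- word expansion -/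
def M (l : List E) : ℝ := (l.map S.m).prod

/-- word rotation -/
def Rw : List E → VV d ≃ₗᵢ[ℝ] VV d
  | [] => LinearIsometryEquiv.refl ℝ (VV d)
  | e :: l => (S.R e).trans (Rw l)

/-- word ratio -/
def rr (l : List E) : ℝ := (S.M l ^ (d + 1))⁻¹

lemma M_pos (l : List E) : 0 < S.M l := by
  induction l with
  | nil => simp [M]
  | cons e l ih => simpa [M] using mul_pos (zero_lt_one.trans (S.one_lt_m e)) ih

lemma rr_pos (l : List E) : 0 < S.rr l := inv_pos.2 (pow_pos (S.M_pos l) _)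

lemma M_append (u v : List E) : S.M (u ++ v) = S.M u * S.M v := by simp [M]

lemma rr_append (u v : List E) : S.rr (u ++ v) = S.rr u * S.rr v := by
  rw [rr, M_append, mul_pow, mul_inv]; rfl

lemma M_nil : S.M [] = 1 := by simp [M]

lemma rr_nil : S.rr [] = 1 := by simp [rr, M_nil]

lemma W_append (u v : List E) (x : VV d) : S.W (u ++ v) x = S.W u (S.W v x) := by
  induction u with
  | nil => rfl
  | cons e l ih => simp only [List.cons_append, W, ih]

lemma W_eq (l : List E) (x : VV d) : S.W l x = S.W l 0 + S.rr l • (S.Rw l).symm x := by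
  induction l generalizing x with
  | nil => simp [W, Rw, rr_nil]; rfl
  | cons e l ih =>
    have hrr : S.rr (e :: l) = (S.m e ^ (d + 1))⁻¹ * S.rr l := by
      simp [rr, M, mul_pow, mul_comm]
    simp only [W]
    rw [ih x, hrr]
    simp only [map_add, map_smul, smul_add, smul_smul, add_assoc, Rw, LinearIsometryEquiv.symm_trans,
      LinearIsometryEquiv.trans_apply]

lemma Rw_append (u v : List E) : S.Rw (u ++ v) = (S.Rw u).trans (S.Rw v) := by
  induction u with
  | nil => rfl
  | cons e l ih => simp only [List.cons_append, Rw, ih]; rfl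

/-- the group element of a word -/
def H (l : List E) : WW d →L[ℝ] WW d := hL (S.M l) (S.Rw l) (S.W l 0)

lemma H_append (u v : List E) : S.H (u ++ v) = S.H v * S.H u := by
  rw [H, H, H, hL_mul (S.M_pos v) (S.M_pos u), M_append, Rw_append, W_append, W_eq S u (S.W v 0), mul_comm]
  rfl

lemma W_sub (l : List E) (x y : VV d) : ‖S.W l x - S.W l y‖ = S.rr l * ‖x - y‖ := by
  rw [S.W_eq l x, S.W_eq l y, add_sub_add_left_eq_sub, ← smul_sub, ← map_sub, norm_smul, LinearIsometryEquiv.norm_map,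
    Real.norm_eq_abs, abs_of_pos (S.rr_pos l)]

lemma W_ball (l : List E) (x : VV d) (hx : ‖x‖ ≤ S.R0) : ‖S.W l x‖ ≤ S.R0 := by
  induction l with
  | nil => exact hx
  | cons e l ih => exact S.maps e _ ih

/-- word followed by a sequence -/
def app : List E → (ℕ → E) → (ℕ → E)
  | [], b => b
  | e :: l, b => scons e (app l b)

lemma pi_app (l : List E) (b : ℕ → E) : S.pi (app l b) = S.W l (S.pi b) := by
  induction l with
  | nil => rfl
  | cons e l ih => simp only [app, S.pi_cons, ih, W]

lemma app_pre (b : ℕ → E) (n : ℕ) : app (pre b n) (fun k => b (k + n)) = b := by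
  have haux : ∀ (u : List E) (e : E) (c : ℕ → E), app (u ++ [e]) c = app u (scons e c) := by
    intro u e c
    induction u with
    | nil => rfl
    | cons e' l ih => simp only [List.cons_append, app, ih]
  induction n with
  | zero => simp [pre, app]
  | succ n ih =>
    rw [pre_succ, haux]
    conv_rhs => rw [← ih]
    congr 1
    funext k
    cases k with
    | zero => simp [scons]
    | succ k => simp only [scons]; congr 1; omega

lemma pi_pre (b : ℕ → E) (n : ℕ) : S.pi b = S.W (pre b n) (S.pi fun k => b (k + n)) := by
  rw [← pi_app, app_pre]

lemma exists_rho [Nonempty E] : ∃ ρ : ℝ, 0 < ρ ∧ ρ < 1 ∧ ∀ l, S.rr l ≤ ρ ^ l.length := by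
  obtain ⟨e0, h0⟩ := Finite.exists_max fun e => (S.m e ^ (d + 1))⁻¹
  refine ⟨(S.m e0 ^ (d + 1))⁻¹, ?_, ?_, ?_⟩
  · have := S.one_lt_m e0; positivity
  · exact inv_lt_one_of_one_lt₀ (one_lt_pow₀ (S.one_lt_m e0) (by omega))
  · intro l
    induction l with
    | nil => simp [rr_nil]
    | cons e l ih =>
      have hrr : S.rr (e :: l) = (S.m e ^ (d + 1))⁻¹ * S.rr l := by
        simp [rr, M, mul_pow, mul_comm]
      rw [hrr, List.length_cons, pow_succ' _ l.length]
      have := S.one_lt_m e0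
      exact mul_le_mul (h0 e) ih (S.rr_pos l).le (by positivity)

lemma rr_pre_tendsto [Nonempty E] (b : ℕ → E) : Tendsto (fun n => S.rr (pre b n)) atTop (𝓝 0) := by
  obtain ⟨ρ, h0, h1, h2⟩ := S.exists_rho
  refine squeeze_zero (fun n => (S.rr_pos _).le) (fun n => h2 _) ?_
  simp only [pre_length]
  exact tendsto_pow_atTop_nhds_zero_of_lt_one h0.le h1

/-- affine version of word maps -/
def Wa (l : List E) : VV d →ᵃ[ℝ] VV d where
  toFun := S.W l
  linear := S.rr l • ((S.Rw l).symm.toLinearEquiv : VV d →ₗ[ℝ] VV d)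
  map_vadd' p v := by
    rw [S.W_eq l (v +ᵥ p), S.W_eq l p]
    simp [smul_add]
    abel

lemma W_surj (l : List E) : Function.Surjective (S.W l) := by
  intro y
  refine ⟨S.Rw l ((S.rr l)⁻¹ • (y - S.W l 0)), ?_⟩
  rw [W_eq]
  simp [smul_smul, (S.rr_pos l).ne']

lemma near (b : ℕ → E) (n : ℕ) (x : VV d) (hx : ‖x‖ ≤ S.R0) :
    dist (S.W (pre b n) x) (S.pi b) ≤ S.rr (pre b n) * (2 * S.R0) := by
  rw [S.pi_pre b n, dist_eq_norm, W_sub]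
  refine mul_le_mul_of_nonneg_left ?_ (S.rr_pos _).le
  refine (norm_sub_le _ _).trans ?_
  have := S.pi_ball fun k => b (k + n)
  linarith

lemma near_ev [Nonempty E] (b : ℕ → E) {ε : ℝ} (hε : 0 < ε) : ∃ n, 0 < n ∧
    ∀ x, ‖x‖ ≤ S.R0 → dist (S.W (pre b n) x) (S.pi b) < ε := by
  have h := (S.rr_pre_tendsto b).mul_const (2 * S.R0)
  rw [zero_mul] at h
  obtain ⟨n, hn, hn0⟩ := ((h.eventually (gt_mem_nhds hε)).and (eventually_gt_atTop 0)).exists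
  exact ⟨n, hn0, fun x hx => (S.near b n x hx).trans_lt hn⟩

lemma avoid_one [Nonempty E] (hspan : affineSpan ℝ (Set.range S.pi) = ⊤) (w : List E)
    (L : AffineSubspace ℝ (VV d)) (hL : L ≠ ⊤) : ∃ w', ∀ x, ‖x‖ ≤ S.R0 → S.W (w ++ w') x ∉ L := by
  obtain ⟨b, hb⟩ : ∃ b, S.W w (S.pi b) ∉ L := by
    by_contra hcon
    push Not at hcon
    have h1 : affineSpan ℝ (Set.range S.pi) ≤ L.comap (S.Wa w) := by
      rw [affineSpan_le]
      rintro _ ⟨b, rfl⟩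
      exact hcon b
    rw [hspan] at h1
    apply hL
    rw [eq_top_iff]
    intro y _
    obtain ⟨x, rfl⟩ := S.W_surj w y
    exact h1 (AffineSubspace.mem_top ℝ (VV d) x)
  have hcl : IsClosed (L : Set (VV d)) := L.closed_of_finiteDimensional
  have hcl2 : IsOpen {x | S.W w x ∉ L} := by
    have : Continuous (S.W w) := (S.Wa w).continuous_of_finiteDimensional
    exact (hcl.preimage this).isOpen_compl
  obtain ⟨ε, hε, hball⟩ := Metric.isOpen_iff.1 hcl2 (S.pi b) hb
  obtain ⟨n, -, hn⟩ := S.near_ev b hε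
  refine ⟨pre b n, fun x hx => ?_⟩
  rw [W_append]
  exact hball (hn x hx)

lemma avoid [Nonempty E] (hspan : affineSpan ℝ (Set.range S.pi) = ⊤) 
    (LL : List (AffineSubspace ℝ (VV d))) (hL : ∀ L ∈ LL, L ≠ ⊤) : ∃ w, ∀ x, ‖x‖ ≤ S.R0 → ∀ L ∈ LL, S.W w x ∉ L := by
  induction LL with
  | nil => exact ⟨[], by simp⟩
  | cons L LL ih =>
    obtain ⟨w, hw⟩ := ih fun L hL' => hL L (List.mem_cons_of_mem _ hL')
    obtain ⟨w', hw'⟩ := S.avoid_one hspan w L (hL L List.mem_cons_self)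
    refine ⟨w ++ w', fun x hx L' hL' => ?_⟩
    rcases List.mem_cons.1 hL' with rfl | h
    · exact hw' x hx
    · rw [W_append]
      exact hw _ (S.W_ball w' x hx) L' h

/-- the hyperplane spanned by points -/
def hyp (T : Set (VV d)) : AffineSubspace ℝ (VV d) :=
  (Submodule.span ℝ (ww '' T)).toAffineSubspace.comap
    ((AffineMap.id ℝ (VV d)).prod (AffineMap.const ℝ (VV d) (1 : ℝ)))

lemma mem_hyp (T : Set (VV d)) (x : VV d) : x ∈ hyp T ↔ ww x ∈ Submodule.span ℝ (ww '' T) := by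
  rw [hyp, AffineSubspace.mem_comap, Submodule.mem_toAffineSubspace]; rfl

lemma hyp_ne_top (T : Finset (VV d)) (hT : T.card ≤ d) : hyp (T : Set (VV d)) ≠ ⊤ := by
  classical
  intro h
  have h1 : Submodule.span ℝ (ww '' (T : Set (VV d))) = ⊤ := by
    rw [eq_top_iff]
    rintro ⟨x, t⟩ -
    have h2 : ∀ x, ww x ∈ Submodule.span ℝ (ww '' (T : Set (VV d))) := fun x => by
      rw [← mem_hyp, h]; exact AffineSubspace.mem_top ℝ (VV d) x
    have h3 : ((x, t) : WW d) = ww x + (t - 1) • ww 0 := by simp [ww]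
    rw [h3]
    exact Submodule.add_mem _ (h2 _) (Submodule.smul_mem _ _ (h2 _))
  have h2 := finrank_span_finset_le_card (R := ℝ) (T.image ww)
  rw [Set.finrank, Finset.coe_image, h1, finrank_top, finrank_WW] at h2
  have := Finset.card_image_le (s := T) (f := ww)
  omega

lemma gen_pos [Nonempty E] (hd : 1 ≤ d) (hspan : affineSpan ℝ (Set.range S.pi) = ⊤) (n : ℕ) :
    ∃ F : Finset (VV d), F.card = n ∧ (∀ x ∈ F, x ∈ Set.range S.pi) ∧
      ∀ T ⊆ F, T.card ≤ d + 1 → LinearIndepOn ℝ ww (T : Set (VV d)) := by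
  classical
  induction n with
  | zero =>
    refine ⟨∅, rfl, by simp, fun T hT _ => ?_⟩
    rw [Finset.subset_empty.1 hT]
    simp
  | succ n ih =>
    obtain ⟨F, hF, hFK, hind⟩ := ih
    obtain ⟨w, hw⟩ := S.avoid hspan (List.map (fun T : Finset (VV d) => hyp (T : Set (VV d))) (F.powerset.filter fun T => T.card ≤ d).toList) (by
      intro L hL
      simp only [List.mem_map, Finset.mem_toList, Finset.mem_filter] at hL
      obtain ⟨T, hT, rfl⟩ := hL
      exact hyp_ne_top T hT.2)
    obtain ⟨b⟩ : Nonempty (ℕ → E) := inferInstance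
    set x := S.W w (S.pi b) with hx
    have hxT : ∀ T ⊆ F, T.card ≤ d → ww x ∉ Submodule.span ℝ (ww '' (T : Set (VV d))) := by
      intro T hT hc
      rw [← mem_hyp]
      refine hw _ (S.pi_ball b) _ ?_
      simp only [List.mem_map, Finset.mem_toList, Finset.mem_filter, Finset.mem_powerset]
      exact ⟨T, ⟨hT, hc⟩, rfl⟩
    have hxF : x ∉ F := by
      intro h
      refine hxT {x} (by simpa using h) (by simpa using hd) (Submodule.subset_span ?_)
      simp
    refine ⟨insert x F, by rw [Finset.card_insert_of_notMem hxF, hF], ?_, ?_⟩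
    · intro y hy
      rcases Finset.mem_insert.1 hy with rfl | h
      · exact ⟨app w b, S.pi_app w b⟩
      · exact hFK y h
    · intro T hT hc
      by_cases hxTm : x ∈ T
      · rw [← Finset.insert_erase hxTm, Finset.coe_insert]
        have h1 : T.erase x ⊆ F := by
          intro y hy
          have := Finset.mem_erase.1 hy
          exact (Finset.mem_insert.1 (hT this.2)).resolve_left this.1
        have h2 : (T.erase x).card ≤ d := by rw [Finset.card_erase_of_mem hxTm]; omega
        refine LinearIndepOn.insert (hind _ h1 (by omega)) (hxT _ h1 h2)
      · refine hind T (fun y hy => ?_) hc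
        refine (Finset.mem_insert.1 (hT hy)).resolve_left ?_
        rintro rfl
        exact hxTm hy

end IFS

end DriftBA

end

section

namespace DriftBA

set_option linter.unusedSectionVars false
set_option linter.unusedSimpArgs false
set_option linter.unusedVariables false
set_option linter.deprecated false

namespace IFS

variable {d : ℕ} {E : Type*} [Fintype E] (S : IFS d E)

/-- determinant of the rotation part -/
def dR (l : List E) : ℝ := LinearMap.det ((S.Rw l).toLinearEquiv : VV d →ₗ[ℝ] VV d)

lemma dR_nil : S.dR [] = 1 := by
  have : ((S.Rw []).toLinearEquiv : VV d →ₗ[ℝ] VV d) = LinearMap.id := rfl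
  rw [dR, this, LinearMap.det_id]

lemma dR_append (u v : List E) : S.dR (u ++ v) = S.dR u * S.dR v := by
  have : ((S.Rw (u ++ v)).toLinearEquiv : VV d →ₗ[ℝ] VV d) =
    ((S.Rw v).toLinearEquiv : VV d →ₗ[ℝ] VV d) ∘ₗ ((S.Rw u).toLinearEquiv : VV d →ₗ[ℝ] VV d) := by
    rw [Rw_append]; rfl
  rw [dR, this, LinearMap.det_comp, mul_comm]; rfl

lemma abs_dR (l : List E) : |S.dR l| = 1 := by
  have h := LinearIsometry.normDet_eq_one (S.Rw l).toLinearIsometry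
  rw [LinearMap.normDet_eq_abs_det] at h
  exact h

lemma toMat_H_det (l : List E) : |(toMat (S.H l)).det| = 1 := by
  have h1 : (toMat (S.H l)).det = LinearMap.det (S.H l : WW d →ₗ[ℝ] WW d) :=
    LinearMap.det_toMatrix (bW d) (S.H l : WW d →ₗ[ℝ] WW d)
  rw [h1, H, det_hL _ (S.M_pos l)]
  exact S.abs_dR l

lemma mult_flatMap (f : List E → ℝ) (f0 : f [] = 1) (fa : ∀ u v, f (u ++ v) = f u * f v) {I : Type*} (v : I → List E)
    (l : List I) : f (l.flatMap v) = (l.map fun i => f (v i)).prod := by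
  induction l with
  | nil => simpa using f0
  | cons i l ih => rw [List.flatMap_cons, fa, ih, List.map_cons, List.prod_cons]

/-- the balanced words -/
def bw {I : Type*} [DecidableEq I] (v : I → List E) (LI : List I) (k : ℕ) (i : I) : List E :=
  v i ++ ((LI.erase i).flatMap v ++ (List.replicate (2 * k + 1) LI).flatMap fun l => l.flatMap v)

lemma mult_bw (f : List E → ℝ) (f0 : f [] = 1) (fa : ∀ u v, f (u ++ v) = f u * f v) {I : Type*} [DecidableEq I]
    (v : I → List E) (LI : List I) (k : ℕ) (i : I) (hi : i ∈ LI) :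
    f (bw v LI k i) = f (LI.flatMap v) ^ (2 * k + 2) := by
  rw [bw, fa, fa, mult_flatMap f f0 fa, mult_flatMap f f0 fa (fun l : List I => l.flatMap v), List.map_replicate, List.prod_replicate,
    ← mul_assoc]
  have h1 : f (v i) * ((LI.erase i).map fun i => f (v i)).prod = f (LI.flatMap v) := by
    rw [mult_flatMap f f0 fa v LI, ← List.prod_cons, ← List.map_cons (f := fun i => f (v i))]
    exact ((List.perm_cons_erase hi).symm.map _).prod_eq
  rw [h1, ← pow_succ']

lemma M_gt {l : List E} (hl : l ≠ []) : 1 < S.M l := by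
  induction l with
  | nil => exact absurd rfl hl
  | cons e l ih =>
    have h1 : S.M (e :: l) = S.m e * S.M l := by simp [M]
    rw [h1]
    by_cases hl : l = []
    · rw [hl, M_nil, mul_one]; exact S.one_lt_m e
    · exact one_lt_mul_of_lt_of_le (S.one_lt_m e) (ih hl).le

theorem exit_words [Nonempty E] (hd : 1 ≤ d) (hspan : affineSpan ℝ (Set.range S.pi) = ⊤) {ε : ℝ} (hε : 0 < ε) :
    ∃ F : Finset (List E), ∀ u : List E, ∃ v ∈ F, ¬ good ε (toMat (S.H (u ++ v))) := by
  classical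
  obtain ⟨F, hFc, hFK, hind⟩ := S.gen_pos hd hspan (4 * (d + 1))
  set a : Fin (4 * (d + 1)) → VV d := fun i => ((F.equivFinOfCardEq hFc).symm i : VV d) with ha
  have hainj : Function.Injective a := Subtype.val_injective.comp (Equiv.injective _)
  have haF : ∀ i, a i ∈ F := fun i => ((F.equivFinOfCardEq hFc).symm i).2
  obtain ⟨κ, hκ, hN⟩ := lemma_N (by simp) a (fun T hT => by
    have h1 := hind (T.image a) (by
      intro x hx
      obtain ⟨i, -, rfl⟩ := Finset.mem_image.1 hx
      exact haF i) (Finset.card_image_le.trans hT)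
    rw [Finset.coe_image] at h1
    exact h1.comp_of_image hainj.injOn)
  obtain ⟨κ', hκ'0, hκ'κ, hsep⟩ : ∃ κ' : ℝ, 0 < κ' ∧ κ' ≤ κ ∧ ∀ i j, i ≠ j → κ' + κ' ≤ dist (a i) (a j) := by
    have h1 : ∀ᶠ r in 𝓝[>] (0 : ℝ), ∀ i j, i ≠ j → r + r ≤ dist (a i) (a j) := by
      rw [eventually_all]; intro i
      rw [eventually_all]; intro j
      by_cases hij : i = j
      · simp [hij]
      · have h2 : 0 < dist (a i) (a j) := dist_pos.2 fun h => hij (hainj h)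
        have h3 : ∀ᶠ r in 𝓝[>] (0 : ℝ), r < dist (a i) (a j) / 2 :=
          mem_nhdsWithin_of_mem_nhds (Iio_mem_nhds (half_pos h2))
        filter_upwards [h3] with r hr _
        linarith
    have h2 : ∀ᶠ r in 𝓝[>] (0 : ℝ), r < κ := mem_nhdsWithin_of_mem_nhds (Iio_mem_nhds hκ)
    obtain ⟨r, ⟨hr1, hr2⟩, hr3⟩ := ((h1.and h2).and self_mem_nhdsWithin).exists
    exact ⟨r, hr3, hr2.le, hr1⟩
  have hv : ∀ i, ∃ v : List E, v ≠ [] ∧ ∀ x, ‖x‖ ≤ S.R0 → dist (S.W v x) (a i) < κ' := by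
    intro i
    obtain ⟨b, hb⟩ := hFK _ (haF i)
    obtain ⟨n, hn, h⟩ := S.near_ev b hκ'0
    refine ⟨pre b n, ?_, fun x hx => by rw [← hb]; exact h x hx⟩
    rw [← List.length_pos_iff, pre_length]
    exact hn
  choose v hv0 hv using hv
  set LI : List (Fin (4 * (d + 1))) := Finset.univ.toList with hLI
  have hmem : ∀ i, i ∈ LI := fun i => by simp [hLI]
  set T := LI.flatMap v with hT
  have hT1 : 1 < S.M T := by
    refine S.M_gt ?_
    intro h
    rw [hT, List.flatMap_eq_nil_iff] at h
    exact hv0 0 (h 0 (hmem 0))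
  obtain ⟨k, hk⟩ : ∃ k : ℕ, 1 / κ + (1 + S.R0) ^ 2 / κ ^ 2 < S.M T ^ k := pow_unbounded_of_one_lt _ hT1
  set m := S.M T ^ (2 * k + 2) with hm
  set w := bw v LI k with hw
  have hMw : ∀ i, S.M (w i) = m := fun i => mult_bw S.M S.M_nil S.M_append v LI k i (hmem i)
  have hDw : ∀ i, S.dR (w i) = 1 := fun i => by
    rw [hw, mult_bw S.dR S.dR_nil S.dR_append v LI k i (hmem i), show 2 * k + 2 = 2 * (k + 1) by ring, pow_mul,
      ← sq_abs, abs_dR]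
    simp
  have hlam : 1 / κ + (1 + S.R0) ^ 2 / κ ^ 2 < m ^ (d + 1) := by
    refine hk.trans_le ?_
    rw [hm, ← pow_mul]
    refine pow_le_pow_right₀ hT1.le ?_
    nlinarith
  have hWw : ∀ i x, S.W (w i) x = S.W (w i) 0 + (m ^ (d + 1))⁻¹ • (S.Rw (w i)).symm x := fun i x => by
    rw [S.W_eq (w i) x, rr, hMw]
  let C : Conc d (Fin (4 * (d + 1))) :=
    { m := m
      R := fun i => S.Rw (w i)
      θ := fun i => S.W (w i) 0
      R0 := S.R0
      B := fun i => Metric.ball (a i) κ'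
      r3 := κ
      c1 := κ
      one_lt_m := one_lt_pow₀ hT1 (by omega)
      detR := hDw
      R0_nonneg := S.R0_pos.le
      disj := fun i j hij => Metric.ball_disjoint_ball (hsep i j hij)
      maps := fun i x hx => by
        rw [← hWw]
        refine ⟨S.W_ball _ _ hx, ?_⟩
        rw [hw, bw, W_append]
        exact hv i _ (S.W_ball _ _ hx)
      r3_pos := hκ
      c1_pos := hκ
      lemN := fun g hg => by
        obtain ⟨good, hc, h⟩ := hN g hg
        exact ⟨good, hc, fun i hi x hx => h i hi x (lt_of_lt_of_le hx hκ'κ)⟩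
      hlam1 := by
        rw [← div_lt_iff₀ hκ]
        refine lt_of_le_of_lt ?_ hlam
        have : 0 ≤ (1 + S.R0) ^ 2 / κ ^ 2 := by positivity
        linarith
      hlam2 := by
        have h1 : (1 + S.R0) ^ 2 ≤ m ^ (d + 1) * κ ^ 2 := by
          rw [← div_le_iff₀ (by positivity)]
          have : 0 ≤ 1 / κ := by positivity
          linarith
        have h2 : 0 < m ^ (d + 1) := by positivity
        nlinarith }
  haveI : Nonempty (Fin (4 * (d + 1))) := ⟨0⟩
  obtain ⟨F', hF'⟩ := C.exit hd (by simp; omega) hε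
  have hHw : ∀ l : List (Fin (4 * (d + 1))), ((C.Hw l : GG d) : Matrix (JJ d) (JJ d) ℝ) = toMat (S.H (l.reverse.flatMap w)) := by
    intro l
    rw [← toMat_Lg]
    congr 1
    induction l with
    | nil =>
      rw [Conc.Hw_nil, Lg_one]
      refine ContinuousLinearMap.ext fun x => ?_
      simp [H, M_nil, W, Rw]
    | cons i l ih =>
      have hH : S.H (w i) = hL m (S.Rw (w i)) (S.W (w i) 0) := by rw [H, hMw]
      rw [Conc.Hw_cons, Lg_mul, ih, List.reverse_cons, List.flatMap_append, H_append, C.Lg_h, List.flatMap_singleton, hH]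
  refine ⟨F'.image fun l => l.reverse.flatMap w, fun u => ?_⟩
  obtain ⟨l, hl, hl2⟩ := hF' (toMat (S.H u)) (S.toMat_H_det u)
  refine ⟨_, Finset.mem_image_of_mem _ hl, ?_⟩
  rwa [H_append, toMat_mul, ← hHw]

end IFS

end DriftBA

end

section

namespace DriftBA

set_option linter.unusedSectionVars false
set_option linter.unusedSimpArgs false
set_option linter.unusedVariables false
set_option linter.deprecated false

variable {d : ℕ}

lemma toMat_tow (L : WW d →L[ℝ] WW d) (x : JJ d → ℝ) : L (tow x) = tow ((toMat L).mulVec x) := by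
  have h := LinearMap.toMatrix_mulVec_repr (bW d) (bW d) (L : WW d →ₗ[ℝ] WW d) (tow x)
  have h1 : LinearMap.toMatrix (bW d) (bW d) (L : WW d →ₗ[ℝ] WW d) = toMat L := rfl
  have h2 : ((bW d).repr (tow x) : JJ d → ℝ) = x := by
    rw [← Module.Basis.equivFun_apply, tow, LinearEquiv.apply_symm_apply]
  rw [h1, h2] at h
  rw [h]
  refine (LinearEquiv.eq_symm_apply _).2 ?_
  rw [Module.Basis.equivFun_apply]
  rfl

namespace IFS

variable {E : Type*} [Fintype E] (S : IFS d E)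

lemma one_le_M (l : List E) : 1 ≤ S.M l := by
  by_cases h : l = []
  · rw [h, M_nil]
  · exact (S.M_gt h).le

lemma ba_good (hd : 1 ≤ d) (b : ℕ → E) (c : ℝ) (hc : 0 < c)
    (hba : ∀ q : ℕ, 0 < q → ∀ p : Fin d → ℤ, c * (q : ℝ) ^ (-(1 : ℝ) / d) ≤
      ‖(q : ℝ) • S.pi b - (EuclideanSpace.equiv (Fin d) ℝ).symm (fun i => (p i : ℝ))‖) :
    ∃ ε : ℝ, 0 < ε ∧ ∀ k, good ε (toMat (S.H (pre b k))) := by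
  obtain ⟨C, hC, htow⟩ := tow_bound (d := d)
  set ε' : ℝ := min 1 (c / (1 + S.R0)) with hε'
  have hR0 := S.R0_pos
  have hε'0 : 0 < ε' := lt_min one_pos (by positivity)
  have hε1 : ε' ≤ 1 := min_le_left _ _
  have hε2 : ε' * (1 + S.R0) ≤ c := by
    rw [← le_div_iff₀ (by positivity)]; exact min_le_right _ _
  -- extended inequality
  have hba' : ∀ q : ℤ, q ≠ 0 → ∀ p : VV d, (∃ p' : Fin d → ℤ, ∀ i, p i = p' i) →
      c * |(q : ℝ)| ^ (-(1 : ℝ) / d) ≤ ‖p - (q : ℝ) • S.pi b‖ := by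
    have hpos : ∀ q : ℤ, 0 < q → ∀ p : VV d, (∃ p' : Fin d → ℤ, ∀ i, p i = p' i) →
      c * |(q : ℝ)| ^ (-(1 : ℝ) / d) ≤ ‖p - (q : ℝ) • S.pi b‖ := by
      rintro q hq p ⟨p', hp'⟩
      have h1 := hba q.toNat (by omega) p'
      have h2 : ((q.toNat : ℕ) : ℝ) = q := by exact_mod_cast Int.toNat_of_nonneg hq.le
      have h3 : (EuclideanSpace.equiv (Fin d) ℝ).symm (fun i => (p' i : ℝ)) = p := by
        ext i; rw [hp' i]; rfl
      rw [h2, h3] at h1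
      rw [abs_of_pos (by exact_mod_cast hq), norm_sub_rev]
      exact h1
    intro q hq p ⟨p', hp'⟩
    rcases lt_or_gt_of_ne hq with h | h
    · have h1 := hpos (-q) (by omega) (-p) ⟨fun i => - p' i, fun i => by simp [hp']⟩
      rw [show -p - ((-q : ℤ) : ℝ) • S.pi b = -(p - (q : ℝ) • S.pi b) by push_cast; rw [neg_smul]; abel, norm_neg] at h1
      simpa using h1
    · exact hpos q h p ⟨p', hp'⟩
  refine ⟨ε' / C, by positivity, fun k v hv => ?_⟩
  rw [div_le_iff₀ hC, mul_comm]
  refine le_trans ?_ (htow _)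
  rw [← toMat_tow, H, hL_apply]
  set M := S.M (pre b k) with hM
  have hM1 : 1 ≤ M := S.one_le_M _
  have hM0 : 0 < M := by linarith
  set θ := S.W (pre b k) 0 with hθ
  set p : VV d := (tow (zv v)).1 with hp
  have hpi : ∀ i, p i = (v (Sum.inl i) : ℝ) := fun i => by rw [hp, tow_fst]; rfl
  have hq : (tow (zv v)).2 = (v (Sum.inr ()) : ℝ) := by rw [tow_snd]; rfl
  rw [hq]
  set q := v (Sum.inr ()) with hqd
  by_cases hq0 : q = 0
  · refine le_trans ?_ (norm_fst_le _)
    simp only [hq0, Int.cast_zero, zero_smul, sub_zero]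
    rw [norm_smul, LinearIsometryEquiv.norm_map, Real.norm_eq_abs, abs_of_pos hM0]
    obtain ⟨i, hi⟩ : ∃ i, v (Sum.inl i) ≠ 0 := by
      by_contra hcon
      push Not at hcon
      apply hv
      funext j
      rcases j with j | j
      · exact hcon j
      · exact hq0
    have h1 : 1 ≤ ‖p‖ := by
      refine le_trans ?_ (PiLp.norm_apply_le p i)
      rw [hpi, Real.norm_eq_abs]
      exact_mod_cast Int.one_le_abs hi
    nlinarith
  · by_cases hqs : ε' ≤ |(q : ℝ)| * (M ^ d)⁻¹
    · refine le_trans ?_ (norm_snd_le _)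
      simp only [norm_mul, Real.norm_eq_abs]
      rw [abs_of_pos (show 0 < (M ^ d)⁻¹ by positivity), mul_comm]
      exact hqs
    · push Not at hqs
      refine le_trans ?_ (norm_fst_le _)
      simp only
      rw [norm_smul, LinearIsometryEquiv.norm_map, Real.norm_eq_abs, abs_of_pos hM0]
      have h1 := hba' q hq0 p ⟨_, hpi⟩
      have h2 : ‖S.pi b - θ‖ ≤ (M ^ (d + 1))⁻¹ * S.R0 := by
        rw [S.pi_pre b k, hθ, S.W_sub, sub_zero]
        exact mul_le_mul_of_nonneg_left (S.pi_ball _) (S.rr_pos _).le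
      have h3 : ‖p - (q : ℝ) • S.pi b‖ ≤ ‖p - (q : ℝ) • θ‖ + |(q : ℝ)| * ‖S.pi b - θ‖ := by
        rw [← Real.norm_eq_abs, ← norm_smul]
        have : p - (q : ℝ) • S.pi b = (p - (q : ℝ) • θ) - (q : ℝ) • (S.pi b - θ) := by
          rw [smul_sub]; abel
        rw [this]; exact norm_sub_le _ _
      have hqpos : 0 < |(q : ℝ)| := abs_pos.2 (by exact_mod_cast hq0)
      have h4 : 1 ≤ M * |(q : ℝ)| ^ (-(1 : ℝ) / d) := by
        have h5 : |(q : ℝ)| ≤ M ^ d := by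
          rw [← div_eq_mul_inv, div_lt_iff₀ (by positivity)] at hqs
          have : 0 < M ^ d := by positivity
          nlinarith
        have hd0 : (0 : ℝ) < d := by exact_mod_cast hd
        have h6 := Real.rpow_le_rpow_of_nonpos hqpos h5 (show -(1 : ℝ) / d ≤ 0 by
          rw [neg_div]; simp)
        have h7 : ((M ^ d : ℝ)) ^ (-(1 : ℝ) / d) = M⁻¹ := by
          rw [← Real.rpow_natCast, ← Real.rpow_mul hM0.le, mul_div_cancel₀ _ hd0.ne', Real.rpow_neg_one]
        rw [h7] at h6
        have := mul_le_mul_of_nonneg_left h6 hM0.le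
        rwa [mul_inv_cancel₀ hM0.ne'] at this
      have h8 : M * (|(q : ℝ)| * ‖S.pi b - θ‖) ≤ ε' * S.R0 := by
        have h9 : M * (|(q : ℝ)| * ‖S.pi b - θ‖) ≤ M * (|(q : ℝ)| * ((M ^ (d + 1))⁻¹ * S.R0)) := by gcongr
        have h10 : M * (|(q : ℝ)| * ((M ^ (d + 1))⁻¹ * S.R0)) = (|(q : ℝ)| * (M ^ d)⁻¹) * S.R0 := by
          field_simp
          ring
        rw [h10] at h9
        refine h9.trans (mul_le_mul_of_nonneg_right hqs.le hR0.le)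
      nlinarith [mul_le_mul_of_nonneg_left (h1.trans h3) hM0.le, mul_le_mul_of_nonneg_left h4 hc.le]

end IFS

end DriftBA

end

section

namespace DriftBA

set_option linter.unusedSectionVars false
set_option linter.unusedSimpArgs false
set_option linter.unusedVariables false
set_option linter.deprecated false

lemma tree_zero {E : Type*} [Fintype E] (a pw : List E → ℝ) (pw_pos : ∀ u, 0 < pw u)
    (pw_nil : pw [] = 1) (pw_app : ∀ u v, pw (u ++ v) = pw u * pw v)
    (hsum : ∑ e, pw [e] = 1) (C : ℝ) (hC : 0 ≤ C) (ha0 : ∀ u, 0 ≤ a u) (ha : ∀ u, a u ≤ C * pw u)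
    (hsub : ∀ u, a u ≤ ∑ e, a (u ++ [e])) (F : Finset (List E)) (hF : ∀ u, ∃ v ∈ F, a (u ++ v) = 0) :
    ∀ u, a u = 0 := by
  classical
  obtain ⟨δ, hδ0, hδ1, hδ⟩ : ∃ δ : ℝ, 0 < δ ∧ δ ≤ 1 ∧ ∀ v ∈ F, δ ≤ pw v := by
    obtain ⟨v0, hv0, -⟩ := hF []
    obtain ⟨v1, hv1, h1⟩ := F.exists_min_image pw ⟨v0, hv0⟩
    exact ⟨min 1 (pw v1), lt_min one_pos (pw_pos _), min_le_left _ _, fun v hv => (min_le_right _ _).trans (h1 v hv)⟩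
  have key : ∀ q : ℝ, 0 ≤ q → (∀ u, a u ≤ q * pw u) → ∀ v u, a (u ++ v) = 0 → a u ≤ (1 - pw v) * q * pw u := by
    intro q hq hqa v
    induction v with
    | nil =>
      intro u hu
      rw [List.append_nil] at hu
      rw [hu, pw_nil]; simp
    | cons e v ih =>
      intro u hu
      have h1 := ih (u ++ [e]) (by simpa using hu)
      have h2 : a u ≤ ∑ e', (q * pw u) * (pw [e'] - if e' = e then pw [e] * pw v else 0) := by
        refine (hsub u).trans (Finset.sum_le_sum fun e' _ => ?_)
        split_ifs with h
        · subst h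
          refine h1.trans (le_of_eq ?_)
          rw [pw_app]; ring
        · refine (hqa _).trans (le_of_eq ?_)
          rw [pw_app]; ring
      rw [← Finset.mul_sum, Finset.sum_sub_distrib, hsum, Finset.sum_ite_eq' Finset.univ e, if_pos (Finset.mem_univ _),
        ← pw_app] at h2
      refine h2.trans (le_of_eq ?_)
      simp only [List.singleton_append]
      ring
  have hpow : ∀ k : ℕ, ∀ u, a u ≤ (C * (1 - δ) ^ k) * pw u := by
    intro k
    induction k with
    | zero => simpa using ha
    | succ k ih =>
      intro u
      obtain ⟨v, hv, hv0⟩ := hF u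
      have hq : 0 ≤ C * (1 - δ) ^ k := mul_nonneg hC (pow_nonneg (by linarith) _)
      refine (key _ hq ih v u hv0).trans ?_
      rw [show C * (1 - δ) ^ (k + 1) = (1 - δ) * (C * (1 - δ) ^ k) by ring]
      have := hδ v hv
      have := pw_pos u
      gcongr
  intro u
  refine le_antisymm ?_ (ha0 u)
  have h1 : Tendsto (fun k : ℕ => (C * (1 - δ) ^ k) * pw u) atTop (𝓝 ((C * 0) * pw u)) :=
    ((tendsto_pow_atTop_nhds_zero_of_lt_one (by linarith) (by linarith)).const_mul C).mul_const _
  rw [mul_zero, zero_mul] at h1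
  exact ge_of_tendsto h1 (Eventually.of_forall fun k => hpow k u)

namespace IFS

variable {d : ℕ} {E : Type*} [Fintype E] (S : IFS d E)

lemma rr_ofFn {n : ℕ} (f : Fin n → E) : S.rr (List.ofFn f) = ∏ i, S.rr [f i] := by
  induction n with
  | zero => simp [rr_nil]
  | succ n ih =>
    rw [List.ofFn_succ, Fin.prod_univ_succ, ← ih, ← rr_append]
    rfl

lemma pre_eq_ofFn (b : ℕ → E) (n : ℕ) : pre b n = List.ofFn fun i : Fin n => b i := by
  rw [pre]
  refine List.ext_getElem (by simp) fun i h1 h2 => by simp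

lemma W_lip (l : List E) : LipschitzWith (Real.toNNReal (S.rr l)) (S.W l) := by
  refine LipschitzWith.of_dist_le_mul fun x y => ?_
  rw [Real.coe_toNNReal _ (S.rr_pos l).le, dist_eq_norm, dist_eq_norm, W_sub]

lemma ediam_K : Metric.ediam (Set.range S.pi) ≤ ENNReal.ofReal (2 * S.R0) := by
  refine Metric.ediam_le ?_
  rintro _ ⟨b, rfl⟩ _ ⟨b', rfl⟩
  rw [edist_dist]
  refine ENNReal.ofReal_le_ofReal ?_
  rw [dist_eq_norm]
  refine (norm_sub_le _ _).trans ?_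
  linarith [S.pi_ball b, S.pi_ball b']

lemma ediam_W (l : List E) : Metric.ediam (S.W l '' Set.range S.pi) ≤ ENNReal.ofReal (S.rr l * (2 * S.R0)) := by
  refine ((S.W_lip l).ediam_image_le _).trans ?_
  rw [ENNReal.ofReal_mul (S.rr_pos l).le]
  exact mul_le_mul_right S.ediam_K _

lemma hfin [Nonempty E] {s0 : ℝ} (hs0 : 0 ≤ s0) (hsum : ∑ e, S.rr [e] ^ s0 = 1) :
    μH[s0] (Set.range S.pi) < ⊤ := by
  obtain ⟨ρ, h0, h1, hρ⟩ := S.exists_rho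
  have hR := S.R0_pos
  have := Measure.hausdorffMeasure_le_liminf_sum (ι := fun n => Fin n → E) s0 (Set.range S.pi) (l := atTop)
    (fun n => ENNReal.ofReal (ρ ^ n * (2 * S.R0))) (by
      have h2 : Tendsto (fun n : ℕ => ρ ^ n * (2 * S.R0)) atTop (𝓝 (0 * (2 * S.R0))) :=
        (tendsto_pow_atTop_nhds_zero_of_lt_one h0.le h1).mul_const _
      rw [zero_mul] at h2
      simpa using ENNReal.tendsto_ofReal h2)
    (fun n f => S.W (List.ofFn f) '' Set.range S.pi)
    (Eventually.of_forall fun n f => (S.ediam_W _).trans (ENNReal.ofReal_le_ofReal (by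
      have := hρ (List.ofFn f)
      rw [List.length_ofFn] at this
      gcongr)))
    (Eventually.of_forall fun n => by
      rintro _ ⟨b, rfl⟩
      refine Set.mem_iUnion.2 ⟨fun i => b i, ?_⟩
      rw [S.pi_pre b n, pre_eq_ofFn]
      exact Set.mem_image_of_mem _ ⟨_, rfl⟩)
  refine this.trans_lt (lt_of_le_of_lt ?_ (ENNReal.ofReal_lt_top (r := (2 * S.R0) ^ s0)))
  refine Filter.liminf_le_of_frequently_le' (Frequently.of_forall fun n => ?_)
  have h3 : ∑ f : Fin n → E, S.rr (List.ofFn f) ^ s0 = 1 := by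
    rw [← one_pow n, ← hsum, Fintype.sum_pow]
    refine Finset.sum_congr rfl fun f _ => ?_
    rw [rr_ofFn, Real.finset_prod_rpow _ _ fun i _ => (S.rr_pos _).le]
  calc ∑ f : Fin n → E, Metric.ediam (S.W (List.ofFn f) '' Set.range S.pi) ^ s0
      ≤ ∑ f : Fin n → E, ENNReal.ofReal (S.rr (List.ofFn f) ^ s0 * (2 * S.R0) ^ s0) := by
        refine Finset.sum_le_sum fun f _ => ?_
        have hp := S.rr_pos (List.ofFn f)
        rw [← Real.mul_rpow hp.le (by positivity), ← ENNReal.ofReal_rpow_of_pos (by positivity)]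
        exact ENNReal.rpow_le_rpow (S.ediam_W _) hs0
    _ = ENNReal.ofReal ((2 * S.R0) ^ s0) := by
        rw [← ENNReal.ofReal_sum_of_nonneg, ← Finset.sum_mul, h3, one_mul]
        intro f _
        have hp := S.rr_pos (List.ofFn f)
        positivity

lemma hscale {s0 : ℝ} (hs0 : 0 ≤ s0) (u : List E) :
    μH[s0] (S.W u '' Set.range S.pi) ≤ ENNReal.ofReal (S.rr u ^ s0) * μH[s0] (Set.range S.pi) := by
  refine ((S.W_lip u).hausdorffMeasure_image_le hs0 _).trans ?_
  rw [← ENNReal.ofReal_rpow_of_pos (S.rr_pos u)]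
  rfl

/-- alive sequences extending a word -/
def Al (ε : ℝ) (u : List E) : Set (VV d) :=
  {x | ∃ b, x = S.pi (app u b) ∧ ∀ k, good ε (toMat (S.H (pre (app u b) k)))}

lemma pre_app (u : List E) (b : ℕ → E) : pre (app u b) u.length = u := by
  induction u with
  | nil => rfl
  | cons e u ih =>
    simp only [pre, List.length_cons, List.range_succ_eq_map, List.map_cons, List.map_map] at ih ⊢
    congr 1

lemma app_snoc (u : List E) (b : ℕ → E) : app u b = app (u ++ [b 0]) fun k => b (k + 1) := by
  induction u with
  | nil =>
    funext k
    cases k <;> rfl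
  | cons e u ih => simp only [List.cons_append, app, ih]

theorem alive_zero [Nonempty E] (hd : 1 ≤ d) (hspan : affineSpan ℝ (Set.range S.pi) = ⊤) {ε : ℝ} (hε : 0 < ε)
    {s0 : ℝ} (hs0 : 0 ≤ s0) (hsum : ∑ e, S.rr [e] ^ s0 = 1) :
    μH[s0] {x | ∃ b, x = S.pi b ∧ ∀ k, good ε (toMat (S.H (pre b k)))} = 0 := by
  have hfin := S.hfin hs0 hsum
  obtain ⟨F, hF⟩ := S.exit_words hd hspan hε
  have hle : ∀ u, μH[s0] (S.Al ε u) ≤ ENNReal.ofReal (S.rr u ^ s0) * μH[s0] (Set.range S.pi) := by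
    intro u
    refine (measure_mono ?_).trans (S.hscale hs0 u)
    rintro x ⟨b, rfl, -⟩
    rw [pi_app]
    exact Set.mem_image_of_mem _ ⟨_, rfl⟩
  have htop : ∀ u, μH[s0] (S.Al ε u) ≠ ⊤ := fun u =>
    ((hle u).trans_lt (ENNReal.mul_lt_top ENNReal.ofReal_lt_top hfin)).ne
  have hz := tree_zero (fun u => (μH[s0] (S.Al ε u)).toReal) (fun u => S.rr u ^ s0)
    (fun u => Real.rpow_pos_of_pos (S.rr_pos u) _) (by simp [rr_nil])
    (fun u v => by rw [rr_append, Real.mul_rpow (S.rr_pos u).le (S.rr_pos v).le]) hsum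
    (μH[s0] (Set.range S.pi)).toReal ENNReal.toReal_nonneg (fun u => ENNReal.toReal_nonneg)
    (fun u => by
      have h1 := ENNReal.toReal_mono (ENNReal.mul_lt_top ENNReal.ofReal_lt_top hfin).ne (hle u)
      rw [ENNReal.toReal_mul, ENNReal.toReal_ofReal (Real.rpow_pos_of_pos (S.rr_pos u) _).le, mul_comm] at h1
      exact h1)
    (fun u => by
      rw [← ENNReal.toReal_sum fun e _ => htop _]
      refine ENNReal.toReal_mono (ENNReal.sum_lt_top.2 fun e _ => (htop _).lt_top).ne ?_
      refine (measure_mono ?_).trans (measure_iUnion_fintype_le _ _)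
      rintro x ⟨b, rfl, hb⟩
      refine Set.mem_iUnion.2 ⟨b 0, fun k => b (k + 1), ?_, ?_⟩
      · rw [← app_snoc]
      · rw [← app_snoc]; exact hb)
    F (fun u => by
      obtain ⟨v, hv, hv2⟩ := hF u
      refine ⟨v, hv, ?_⟩
      have : S.Al ε (u ++ v) = ∅ := by
        rw [Set.eq_empty_iff_forall_notMem]
        rintro x ⟨b, rfl, hb⟩
        have := hb (u ++ v).length
        rw [pre_app] at this
        exact hv2 this
      rw [this]; simp) []
  have h2 := (ENNReal.toReal_eq_zero_iff _).1 hz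
  exact h2.resolve_right (htop _)

end IFS

end DriftBA

end

section

namespace DriftBA

set_option linter.unusedSectionVars false
set_option linter.unusedSimpArgs false
set_option linter.unusedVariables false
set_option linter.deprecated false

namespace IFS

variable {d : ℕ} {E : Type*} [Fintype E] (S : IFS d E)

/-- open set condition for the IFS -/
def OSC (U : Set (VV d)) : Prop := IsOpen U ∧ U.Nonempty ∧ (∀ e, ∀ x ∈ U, S.W [e] x ∈ U) ∧
  ∀ e e', e ≠ e' → ∀ x ∈ U, ∀ y ∈ U, S.W [e] x ≠ S.W [e'] y

variable {S}

lemma OSC.mem {U : Set (VV d)} (hU : S.OSC U) (w : List E) (x : VV d) (hx : x ∈ U) : S.W w x ∈ U := by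
  induction w with
  | nil => exact hx
  | cons e w ih => exact hU.2.2.1 e _ ih

lemma OSC.ne {U : Set (VV d)} (hU : S.OSC U) (w w' : List E) (h1 : ¬ w <+: w') (h2 : ¬ w' <+: w) (x y : VV d) (hx : x ∈ U)
    (hy : y ∈ U) : S.W w x ≠ S.W w' y := by
  induction w generalizing w' with
  | nil => exact absurd ⟨_, rfl⟩ h1
  | cons e w ih =>
    cases w' with
    | nil => exact absurd ⟨_, rfl⟩ h2
    | cons e' w' =>
      by_cases he : e = e'
      · subst he
        rw [List.cons_prefix_cons] at h1 h2
        intro h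
        refine ih w' (fun h => h1 ⟨rfl, h⟩) (fun h => h2 ⟨rfl, h⟩) ?_
        have h3 := S.W_sub [e] (S.W w x) (S.W w' y)
        have h4 : S.W [e] (S.W w x) = S.W [e] (S.W w' y) := h
        rw [h4, sub_self, norm_zero, eq_comm, mul_eq_zero] at h3
        exact sub_eq_zero.1 (norm_eq_zero.1 (h3.resolve_left (S.rr_pos _).ne'))
      · exact hU.2.2.2 e e' he _ (hU.mem w x hx) _ (hU.mem w' y hy)

variable (S)

/-- stopping words -/
def Ga (r : ℝ) (w : List E) : Prop := S.rr w ≤ r ∧ ∀ u, u <+: w → u ≠ w → r < S.rr u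

lemma Ga_lower [Nonempty E] : ∃ η : ℝ, 0 < η ∧ ∀ r, 0 < r → r < 1 → ∀ w, S.Ga r w → η * r ≤ S.rr w := by
  obtain ⟨e0, h0⟩ := Finite.exists_min fun e => S.rr [e]
  refine ⟨S.rr [e0], S.rr_pos _, fun r hr hr1 w hw => ?_⟩
  rcases List.eq_nil_or_concat w with rfl | ⟨u, e, rfl⟩
  · have := hw.1
    rw [rr_nil] at this
    linarith
  · have h1 := hw.2 u (by simp) (by simp)
    rw [List.concat_eq_append, rr_append, mul_comm]
    exact mul_le_mul h1.le (h0 e) (S.rr_pos _).le (S.rr_pos _).le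

lemma pre_take (b : ℕ → E) {k n : ℕ} (h : k ≤ n) : (pre b n).take k = pre b k := by
  rw [pre, ← List.map_take, List.take_range, min_eq_left h]; rfl

lemma Ga_exists [Nonempty E] {r : ℝ} (hr : 0 < r) (b : ℕ → E) : ∃ n, S.Ga r (pre b n) := by
  classical
  have h : ∃ n, S.rr (pre b n) ≤ r := by
    obtain ⟨n, hn⟩ := ((S.rr_pre_tendsto b).eventually (gt_mem_nhds hr)).exists
    exact ⟨n, hn.le⟩
  refine ⟨Nat.find h, Nat.find_spec h, fun u hu hne => ?_⟩
  have h1 := List.prefix_iff_eq_take.1 hu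
  have h2 := hu.length_le
  rw [pre_length] at h2
  rw [pre_take b h2] at h1
  have h3 : u.length < Nat.find h := by
    refine lt_of_le_of_ne h2 fun h4 => hne ?_
    rw [h1, h4]
  have h5 := Nat.find_min h h3
  rw [h1]
  exact not_le.1 h5

/-- stopping words hitting a ball -/
def Hit (r : ℝ) (x : VV d) (w : List E) : Prop := S.Ga r w ∧ ∃ b, dist (S.W w (S.pi b)) x < r

lemma count [Nonempty E] {U : Set (VV d)} (hU : S.OSC U) : ∃ N : ℕ, ∀ r, 0 < r → r < 1 → ∀ x, ∀ T : Finset (List E),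
    (∀ w ∈ T, S.Hit r x w) → T.card ≤ N := by
  obtain ⟨η, hη, hlow⟩ := S.Ga_lower
  obtain ⟨z, hz⟩ := hU.2.1
  obtain ⟨a, ha, hball⟩ := Metric.isOpen_iff.1 hU.1 z hz
  have hR := S.R0_pos
  set C : ℝ := a + ‖z‖ + S.R0 + 1 with hC
  have hC0 : 0 < C := by positivity
  obtain ⟨N, hN⟩ := exists_nat_ge ((C / (η * a)) ^ d)
  refine ⟨N, fun r hr hr1 x T hT => ?_⟩
  set v1 := (volume : Measure (VV d)) (Metric.ball 0 1) with hv1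
  have hv10 : v1 ≠ 0 := (Metric.measure_ball_pos volume 0 one_pos).ne'
  have hv1t : v1 ≠ ⊤ := measure_ball_lt_top.ne
  have hin : ∀ w, ∀ y ∈ Metric.ball (S.W w z) (η * r * a), η * r ≤ S.rr w → ∃ y' ∈ U, S.W w y' = y := by
    intro w y hy hw
    obtain ⟨y', rfl⟩ := S.W_surj w y
    refine ⟨y', hball ?_, rfl⟩
    rw [Metric.mem_ball, dist_eq_norm, W_sub] at hy
    rw [Metric.mem_ball, dist_eq_norm]
    have h1 : S.rr w * ‖y' - z‖ < S.rr w * a := hy.trans_le (by gcongr)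
    exact lt_of_mul_lt_mul_left h1 (S.rr_pos w).le
  have hdisj : (T : Set (List E)).PairwiseDisjoint fun w => Metric.ball (S.W w z) (η * r * a) := by
    intro w hw w' hw' hne
    refine Set.disjoint_left.2 fun y hy hy' => ?_
    have g := (hT w hw).1
    have g' := (hT w' hw').1
    obtain ⟨x1, hx1, e1⟩ := hin w y hy (hlow r hr hr1 w g)
    obtain ⟨x2, hx2, e2⟩ := hin w' y hy' (hlow r hr hr1 w' g')
    refine hU.ne w w' (fun h => ?_) (fun h => ?_) x1 x2 hx1 hx2 (e1.trans e2.symm)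
    · exact absurd (g'.2 w h hne) (not_lt.2 g.1)
    · exact absurd (g.2 w' h hne.symm) (not_lt.2 g'.1)
  have hsub : (⋃ w ∈ T, Metric.ball (S.W w z) (η * r * a)) ⊆ Metric.ball x (C * r) := by
    intro y hy
    obtain ⟨w, hw, hy⟩ := Set.mem_iUnion₂.1 hy
    obtain ⟨g, b, hb⟩ := hT w hw
    have h1 := hlow r hr hr1 w g
    have h2 : dist (S.W w z) (S.W w (S.pi b)) ≤ r * (‖z‖ + S.R0) := by
      rw [dist_eq_norm, W_sub]
      refine mul_le_mul g.1 ((norm_sub_le _ _).trans ?_) (norm_nonneg _) hr.le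
      linarith [S.pi_ball b]
    have h3 : dist y (S.W w z) < r * a := by
      refine lt_of_lt_of_le hy ?_
      have := h1.trans g.1
      gcongr
    rw [Metric.mem_ball]
    have h4 := dist_triangle4 y (S.W w z) (S.W w (S.pi b)) x
    rw [hC]
    nlinarith
  have hvol := measure_mono (μ := (volume : Measure (VV d))) hsub
  rw [measure_biUnion_finset hdisj fun w _ => Metric.isOpen_ball.measurableSet] at hvol
  have hb : ∀ (y : VV d) (ρ : ℝ), 0 < ρ → volume (Metric.ball y ρ) = ENNReal.ofReal (ρ ^ d) * v1 := by
    intro y ρ hρ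
    rw [Measure.addHaar_ball_of_pos _ y hρ]
    simp [hv1]
  rw [Finset.sum_congr rfl fun w _ => hb (S.W w z) (η * r * a) (by positivity), hb x _ (by positivity), Finset.sum_const,
    nsmul_eq_mul, ← mul_assoc, ENNReal.mul_le_mul_iff_left hv10 hv1t, ← ENNReal.ofReal_natCast,
    ← ENNReal.ofReal_mul (by positivity), ENNReal.ofReal_le_ofReal_iff (by positivity)] at hvol
  have h5 : (T.card : ℝ) ≤ (C / (η * a)) ^ d := by
    rw [div_pow, le_div_iff₀ (by positivity)]
    have h6 : (0 : ℝ) < r ^ d := by positivity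
    refine le_of_mul_le_mul_right ?_ h6
    calc (T.card : ℝ) * (η * a) ^ d * r ^ d = T.card * (η * r * a) ^ d := by rw [mul_pow, mul_pow, mul_pow]; ring
      _ ≤ (C * r) ^ d := hvol
      _ = C ^ d * r ^ d := mul_pow _ _ _
  exact_mod_cast h5.trans hN

end IFS

end DriftBA

end

section

namespace DriftBA

set_option linter.unusedSectionVars false
set_option linter.unusedSimpArgs false
set_option linter.unusedVariables false
set_option linter.deprecated false

namespace IFS

variable {d : ℕ} {E : Type*} [Fintype E] (S : IFS d E)

/-- the one-step distribution -/
def nu [MeasurableSpace E] (s0 : ℝ) : Measure E := ∑ e, ENNReal.ofReal (S.rr [e] ^ s0) • Measure.dirac e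

lemma nu_single [MeasurableSpace E] [MeasurableSingletonClass E] (s0 : ℝ) (e : E) :
    S.nu s0 {e} = ENNReal.ofReal (S.rr [e] ^ s0) := by
  classical
  simp only [nu, Measure.finsetSum_apply, Measure.smul_apply, smul_eq_mul]
  rw [Finset.sum_eq_single e]
  · simp
  · intro f _ hf
    simp [hf]
  · simp

lemma nu_prob [MeasurableSpace E] [MeasurableSingletonClass E] {s0 : ℝ} (hsum : ∑ e, S.rr [e] ^ s0 = 1) :
    IsProbabilityMeasure (S.nu s0) := by
  constructor
  simp only [nu, Measure.finsetSum_apply, Measure.smul_apply, smul_eq_mul, measure_univ, mul_one]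
  rw [← ENNReal.ofReal_sum_of_nonneg fun e _ => Real.rpow_nonneg (S.rr_pos _).le _, hsum, ENNReal.ofReal_one]

lemma meas_pi [Nonempty E] [MeasurableSpace E] [MeasurableSingletonClass E] : Measurable S.pi := by
  have h : ∀ n, Measurable fun b : ℕ → E => S.W (pre b n) 0 := by
    intro n
    simp only [pre_eq_ofFn]
    have h1 : Measurable fun f : Fin n → E => S.W (List.ofFn f) 0 := measurable_of_finite _
    exact h1.comp (measurable_pi_lambda _ fun i => measurable_pi_apply _)
  refine measurable_of_tendsto_metrizable h (tendsto_pi_nhds.2 fun b => ?_)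
  rw [tendsto_iff_norm_sub_tendsto_zero]
  have h2 := (S.rr_pre_tendsto b).mul_const (2 * S.R0)
  rw [zero_mul] at h2
  refine squeeze_zero (fun _ => norm_nonneg _) (fun n => ?_) h2
  rw [S.pi_pre b n, W_sub]
  have h3 := S.pi_ball fun k => b (k + n)
  have h4 := S.R0_pos
  have h5 := S.rr_pos (pre b n)
  rw [zero_sub, norm_neg]
  gcongr
  linarith

lemma cyl [Nonempty E] [MeasurableSpace E] [MeasurableSingletonClass E] {s0 : ℝ} (hsum : ∑ e, S.rr [e] ^ s0 = 1)
    (w : List E) : (Measure.infinitePi fun _ : ℕ => S.nu s0) {b | pre b w.length = w} = ENNReal.ofReal (S.rr w ^ s0) := by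
  haveI := S.nu_prob hsum
  obtain ⟨b0, hb0⟩ : ∃ b0 : ℕ → E, pre b0 w.length = w :=
    ⟨app w fun _ => Classical.arbitrary E, pre_app w _⟩
  have hset : {b : ℕ → E | pre b w.length = w} = Set.pi (Finset.range w.length : Set ℕ) fun i => {b0 i} := by
    ext b
    rw [Set.mem_setOf_eq]
    conv_lhs => rhs; rw [← hb0]
    simp [pre]
  rw [hset, Measure.infinitePi_pi _ fun i _ => measurableSet_singleton _]
  have h1 : ∀ n, ∏ i ∈ Finset.range n, S.nu s0 {b0 i} = ENNReal.ofReal (S.rr (pre b0 n) ^ s0) := by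
    intro n
    induction n with
    | zero => simp [pre, rr_nil]
    | succ n ih =>
      rw [Finset.prod_range_succ, ih, nu_single, pre_succ, rr_append, Real.mul_rpow (S.rr_pos _).le (S.rr_pos _).le,
        ENNReal.ofReal_mul (Real.rpow_nonneg (S.rr_pos _).le _)]
  rw [h1, hb0]

lemma ball_le [Nonempty E] [MeasurableSpace E] [MeasurableSingletonClass E] {s0 : ℝ} (hs0 : 0 ≤ s0)
    (hsum : ∑ e, S.rr [e] ^ s0 = 1) {N : ℕ} {r : ℝ} (hr : 0 < r) {x : VV d}
    (hN : ∀ T : Finset (List E), (∀ w ∈ T, S.Hit r x w) → T.card ≤ N) :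
    (Measure.infinitePi fun _ : ℕ => S.nu s0) (S.pi ⁻¹' Metric.ball x r) ≤ N * ENNReal.ofReal r ^ s0 := by
  have hfin : {w | S.Hit r x w}.Finite := by
    by_contra h
    obtain ⟨T, hT, hc⟩ := Set.Infinite.exists_subset_card_eq h (N + 1)
    have := hN T fun w hw => hT hw
    omega
  set T := hfin.toFinset with hT
  have hTN : T.card ≤ N := hN T fun w hw => by simpa [hT] using hw
  calc _ ≤ (Measure.infinitePi fun _ : ℕ => S.nu s0) (⋃ w ∈ T, {b | pre b w.length = w}) := by
        refine measure_mono fun b hb => ?_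
        obtain ⟨n, hn⟩ := S.Ga_exists hr b
        simp only [Set.mem_iUnion]
        refine ⟨pre b n, ?_, ?_⟩
        · simp only [hT, Set.Finite.mem_toFinset, Set.mem_setOf_eq]
          refine ⟨hn, fun k => b (k + n), ?_⟩
          rw [← S.pi_pre b n]
          exact hb
        · simp [pre_length]
    _ ≤ ∑ w ∈ T, (Measure.infinitePi fun _ : ℕ => S.nu s0) {b | pre b w.length = w} := measure_biUnion_finset_le _ _
    _ ≤ ∑ w ∈ T, ENNReal.ofReal r ^ s0 := by
        refine Finset.sum_le_sum fun w hw => ?_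
        have h1 : S.Hit r x w := by simpa [hT] using hw
        rw [S.cyl hsum, ENNReal.ofReal_rpow_of_pos hr]
        exact ENNReal.ofReal_le_ofReal (Real.rpow_le_rpow (S.rr_pos _).le h1.1.1 hs0)
    _ ≤ _ := by
        rw [Finset.sum_const, nsmul_eq_mul]
        gcongr

theorem le_dim [Nonempty E] {U : Set (VV d)} (hU : S.OSC U) {s0 : ℝ} (hs0 : 0 ≤ s0)
    (hsum : ∑ e, S.rr [e] ^ s0 = 1) : ENNReal.ofReal s0 ≤ dimH (Set.range S.pi) := by
  letI : MeasurableSpace E := ⊤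
  haveI : MeasurableSingletonClass E := ⟨fun _ => trivial⟩
  haveI := S.nu_prob hsum
  obtain ⟨N0, hN0⟩ := S.count hU
  set N := N0 + 1 with hN
  set P := Measure.infinitePi fun _ : ℕ => S.nu s0 with hP
  have hle : (N : ENNReal)⁻¹ • Measure.map S.pi P ≤ μH[s0] := by
    refine Measure.le_hausdorffMeasure s0 _ (1 / 2) (by simp) fun t ht => ?_
    rcases t.eq_empty_or_nonempty with rfl | ⟨x, hx⟩
    · simp
    rw [Measure.smul_apply, smul_eq_mul, ← ENNReal.div_eq_inv_mul]
    refine ENNReal.div_le_of_le_mul ?_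
    rw [mul_comm]
    have htop : Metric.ediam t ≠ ⊤ := ne_top_of_le_ne_top (by simp) ht
    set D := (Metric.ediam t).toReal with hD
    have hD1 : D ≤ 1 / 2 := by
      have := ENNReal.toReal_mono (by simp) ht
      simpa using this
    have hDe : Metric.ediam t = ENNReal.ofReal D := (ENNReal.ofReal_toReal htop).symm
    have hD0 : 0 ≤ D := ENNReal.toReal_nonneg
    have hev : ∀ᶠ r in 𝓝[>] D, Measure.map S.pi P t ≤ N * ENNReal.ofReal r ^ s0 := by
      have h1 : Set.Ioo D 1 ∈ 𝓝[>] D := Ioo_mem_nhdsGT (by linarith)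
      filter_upwards [h1] with r hr
      have hr0 : 0 < r := hD0.trans_lt hr.1
      have hsub : t ⊆ Metric.ball x r := by
        intro y hy
        have h2 := Metric.edist_le_ediam_of_mem hy hx
        rw [hDe, edist_dist, ENNReal.ofReal_le_ofReal_iff hD0] at h2
        exact h2.trans_lt hr.1
      refine (measure_mono hsub).trans ?_
      rw [Measure.map_apply S.meas_pi Metric.isOpen_ball.measurableSet]
      exact S.ball_le hs0 hsum hr0 fun T hT => (hN0 r hr0 hr.2 x T hT).trans (by omega)
    have hlim : Tendsto (fun r : ℝ => (N : ENNReal) * ENNReal.ofReal r ^ s0) (𝓝[>] D) (𝓝 (N * ENNReal.ofReal D ^ s0)) := by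
      refine Tendsto.mono_left ?_ nhdsWithin_le_nhds
      refine ENNReal.Tendsto.const_mul ?_ (Or.inr (by simp))
      exact ((ENNReal.continuous_rpow_const.comp ENNReal.continuous_ofReal).tendsto D)
    rw [hDe]
    exact ge_of_tendsto hlim hev
  have hne : μH[s0] (Set.range S.pi) ≠ 0 := by
    have h1 := hle (Set.range S.pi)
    have h2 : 1 ≤ Measure.map S.pi P (Set.range S.pi) := by
      have := Measure.le_map_apply (μ := P) S.meas_pi.aemeasurable (Set.range S.pi)
      refine le_trans ?_ this
      simp
    intro h3
    rw [h3, Measure.smul_apply, smul_eq_mul, nonpos_iff_eq_zero, mul_eq_zero] at h1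
    rcases h1 with h1 | h1
    · simp at h1
    · rw [h1] at h2
      simp at h2
  have h4 := le_dimH_of_hausdorffMeasure_ne_zero (d := s0.toNNReal) (s := Set.range S.pi) (by rwa [Real.coe_toNNReal s0 hs0])
  exact h4

end IFS

end DriftBA

end

section

namespace DriftBA

set_option linter.unusedSectionVars false
set_option linter.unusedSimpArgs false
set_option linter.unusedVariables false
set_option linter.deprecated false

lemma IFS.exists_s0 {d : ℕ} {E : Type*} [Fintype E] [Nonempty E] (S : IFS d E) :
    ∃ s0 : ℝ, 0 ≤ s0 ∧ ∑ e, S.rr [e] ^ s0 = 1 := by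
  have hlt : ∀ e, S.rr [e] < 1 := fun e => by
    have : S.rr [e] = (S.m e ^ (d + 1))⁻¹ := by simp [IFS.rr, IFS.M]
    rw [this]
    exact inv_lt_one_of_one_lt₀ (one_lt_pow₀ (S.one_lt_m e) (by omega))
  have hlim : Tendsto (fun s : ℝ => ∑ e, S.rr [e] ^ s) atTop (𝓝 0) := by
    have : Tendsto (fun s : ℝ => ∑ e, S.rr [e] ^ s) atTop (𝓝 (∑ e : E, 0)) :=
      tendsto_finsetSum _ fun e _ => tendsto_rpow_atTop_of_base_lt_one _ (by linarith [S.rr_pos [e]]) (hlt e)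
    simpa using this
  obtain ⟨s1, hs1, hs10⟩ := ((hlim.eventually (gt_mem_nhds one_pos)).and (eventually_ge_atTop 0)).exists
  have hcont : Continuous fun s : ℝ => ∑ e, S.rr [e] ^ s := by
    refine continuous_finsetSum _ fun e _ => ?_
    exact Real.continuous_const_rpow (S.rr_pos [e]).ne'
  have h0 : (1 : ℝ) ≤ ∑ e, S.rr [e] ^ (0 : ℝ) := by
    simp only [Real.rpow_zero, Finset.sum_const, nsmul_eq_mul, mul_one, Finset.card_univ]
    exact_mod_cast Fintype.card_pos
  obtain ⟨s, hs, h⟩ := intermediate_value_Icc' hs10 hcont.continuousOn (Set.mem_Icc.2 ⟨hs1.le, h0⟩)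
  exact ⟨s, hs.1, h⟩

lemma sim_form {d : ℕ} {f : EuclideanSpace ℝ (Fin d) → EuclideanSpace ℝ (Fin d)} (hf : ContractingSimilarity f) :
    ∃ (c : ℝ) (R : VV d ≃ₗᵢ[ℝ] VV d), 0 < c ∧ c < 1 ∧ ∀ x, f x = f 0 + c • R.symm x := by
  obtain ⟨c, hc0, hc1, h⟩ := hf
  have hi : Isometry fun x => c⁻¹ • f x := by
    refine Isometry.of_dist_eq fun x y => ?_
    rw [dist_smul₀, h, Real.norm_eq_abs, abs_of_pos (inv_pos.2 hc0), inv_mul_cancel_left₀ hc0.ne']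
  let A := hi.affineIsometryOfStrictConvexSpace
  let R := A.linearIsometry.toLinearIsometryEquiv rfl
  refine ⟨c, R.symm, hc0, hc1, fun x => ?_⟩
  have h1 : A x = A.linearIsometry x + A 0 := by
    have := A.map_vadd 0 x
    simpa using this
  have h2 : c⁻¹ • f x = A.linearIsometry x + c⁻¹ • f 0 := h1
  have h3 : f x = c • (c⁻¹ • f x) := by rw [smul_smul, mul_inv_cancel₀ hc0.ne', one_smul]
  rw [h3, h2, smul_add, smul_smul, mul_inv_cancel₀ hc0.ne', one_smul, add_comm]
  rfl

lemma seqApply_scons {E X : Type*} (φ : E → X → X) (e : E) (b : ℕ → E) (n : ℕ) (x : X) :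
    seqApply φ (scons e b) (n + 1) x = φ e (seqApply φ b n x) := by
  induction n generalizing x with
  | zero => rfl
  | succ n ih =>
    change seqApply φ (scons e b) (n + 1) (φ (scons e b (n + 1)) x) = φ e (seqApply φ b n (φ (b n) x))
    rw [ih]
    rfl

lemma build {d : ℕ} {E : Type*} [Fintype E] [Nonempty E]
    (φ : E → EuclideanSpace ℝ (Fin d) → EuclideanSpace ℝ (Fin d))
    (hsim : ∀ e, ContractingSimilarity (φ e))
    (π : (ℕ → E) → EuclideanSpace ℝ (Fin d))
    (hπ : ∀ (b : ℕ → E) (x₀ : EuclideanSpace ℝ (Fin d)),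
      Tendsto (fun n => seqApply φ b n x₀) atTop (𝓝 (π b))) :
    ∃ S : IFS d E, S.pi = π ∧ ∀ e x, S.W [e] x = φ e x := by
  choose c R hc0 hc1 hφ using fun e => sim_form (hsim e)
  have hm : ∀ e, (((c e) ^ (-(1 : ℝ) / (d + 1 : ℕ))) ^ (d + 1))⁻¹ = c e := by
    intro e
    rw [← Real.rpow_natCast, ← Real.rpow_mul (hc0 e).le, div_mul_cancel₀ _ (by positivity), Real.rpow_neg_one, inv_inv]
  set R0 : ℝ := 1 + ∑ e, ‖φ e 0‖ / (1 - c e) with hR0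
  have hpos : ∀ e, 0 ≤ ‖φ e 0‖ / (1 - c e) := fun e => div_nonneg (norm_nonneg _) (by linarith [hc1 e])
  have hR0p : 0 < R0 := by
    have := Finset.sum_nonneg fun e (_ : e ∈ Finset.univ) => hpos e
    linarith
  have hmaps : ∀ e x, ‖x‖ ≤ R0 → ‖φ e x‖ ≤ R0 := by
    intro e x hx
    have h1 : ‖φ e 0‖ / (1 - c e) ≤ R0 := by
      have := Finset.single_le_sum (fun e _ => hpos e) (Finset.mem_univ e)
      linarith
    rw [div_le_iff₀ (by linarith [hc1 e])] at h1
    rw [hφ]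
    refine (norm_add_le _ _).trans ?_
    rw [norm_smul, LinearIsometryEquiv.norm_map, Real.norm_eq_abs, abs_of_pos (hc0 e)]
    nlinarith [hc0 e]
  have hseq : ∀ b n x, ‖x‖ ≤ R0 → ‖seqApply φ b n x‖ ≤ R0 := by
    intro b n
    induction n with
    | zero => exact fun x hx => hx
    | succ n ih => exact fun x hx => ih _ (hmaps _ _ hx)
  have hcont : ∀ e, Continuous (φ e) := by
    intro e
    have : φ e = fun x => φ e 0 + c e • (R e).symm x := funext (hφ e)
    rw [this]
    fun_prop
  refine ⟨{ m := fun e => (c e) ^ (-(1 : ℝ) / (d + 1 : ℕ))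
            R := R
            θ := fun e => φ e 0
            R0 := R0
            pi := π
            one_lt_m := fun e => ?_
            R0_pos := hR0p
            maps := fun e x hx => ?_
            pi_ball := fun b => ?_
            pi_cons := fun e b => ?_ }, rfl, fun e x => ?_⟩
  · refine Real.one_lt_rpow_of_pos_of_lt_one_of_neg (hc0 e) (hc1 e) ?_
    exact div_neg_of_neg_of_pos (by norm_num) (by positivity)
  · rw [hm, ← hφ]
    exact hmaps e x hx
  · refine le_of_tendsto (hπ b 0).norm (Eventually.of_forall fun n => hseq b n 0 (by simpa using hR0p.le))
  · rw [hm, ← hφ]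
    have h1 := ((hcont e).tendsto _).comp (hπ b 0)
    have h2 := (tendsto_add_atTop_iff_nat 1).2 (hπ (scons e b) 0)
    simp only [seqApply_scons] at h2
    exact tendsto_nhds_unique h2 h1
  · change φ e 0 + ((_ ^ (d + 1))⁻¹ : ℝ) • (R e).symm x = _
    rw [hm, ← hφ]

lemma span_top {d : ℕ} {E : Type*} [Fintype E] [Nonempty E]
    (φ : E → EuclideanSpace ℝ (Fin d) → EuclideanSpace ℝ (Fin d)) (hirr : IrreducibleIFS φ)
    (S : IFS d E) (hS : ∀ e x, S.W [e] x = φ e x) : affineSpan ℝ (Set.range S.pi) = ⊤ := by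
  by_contra hne
  refine hirr ⟨affineSpan ℝ (Set.range S.pi), ?_, hne, fun e => ?_⟩
  · rw [affineSpan_nonempty]
    exact ⟨S.pi fun _ => Classical.arbitrary E, ⟨_, rfl⟩⟩
  set L := affineSpan ℝ (Set.range S.pi) with hL
  have hLne : (L : Set (VV d)).Nonempty := by
    rw [hL, affineSpan_nonempty]
    exact ⟨S.pi fun _ => Classical.arbitrary E, ⟨_, rfl⟩⟩
  have hWa : ∀ x, S.Wa [e] x = φ e x := fun x => hS e x
  have hmap : L.map (S.Wa [e]) ≤ L := by
    rw [hL, AffineSubspace.map_span]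
    refine affineSpan_mono ℝ ?_
    rintro _ ⟨_, ⟨b, rfl⟩, rfl⟩
    refine ⟨scons e b, ?_⟩
    rw [S.pi_cons]
    rfl
  have hinj : Function.Injective (S.Wa [e]).linear := by
    rw [AffineMap.linear_injective_iff]
    intro x y hxy
    have h3 := S.W_sub [e] x y
    have h4 : S.W [e] x = S.W [e] y := hxy
    rw [h4, sub_self, norm_zero, eq_comm, mul_eq_zero] at h3
    exact sub_eq_zero.1 (norm_eq_zero.1 (h3.resolve_left (S.rr_pos _).ne'))
  have hdir : (L.map (S.Wa [e])).direction = L.direction := by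
    refine Submodule.eq_of_le_of_finrank_eq (AffineSubspace.direction_le hmap) ?_
    rw [AffineSubspace.map_direction]
    exact (Submodule.equivMapOfInjective _ hinj L.direction).finrank_eq.symm
  have heq : L.map (S.Wa [e]) = L := by
    refine AffineSubspace.eq_of_direction_eq_of_nonempty_of_le hdir ?_ hmap
    exact hLne.image _
  have h5 : (L.map (S.Wa [e]) : Set (VV d)) = L := by rw [heq]
  rw [AffineSubspace.coe_map] at h5
  rw [← Set.image_congr fun x _ => hWa x]
  exact h5

theorem main
    (d : ℕ) (hd : 1 ≤ d) {E : Type*} [Fintype E] [Nonempty E]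
    (φ : E → EuclideanSpace ℝ (Fin d) → EuclideanSpace ℝ (Fin d))
    (hsim : ∀ e, ContractingSimilarity (φ e))
    (hirr : IrreducibleIFS φ)
    (hosc : OpenSetCondition φ)
    (π : (ℕ → E) → EuclideanSpace ℝ (Fin d))
    (hπ : ∀ (b : ℕ → E) (x₀ : EuclideanSpace ℝ (Fin d)),
      Tendsto (fun n => seqApply φ b n x₀) atTop (𝓝 (π b)))
    (K : Set (EuclideanSpace ℝ (Fin d))) (hK : K = Set.range π)
    (s : ℝ) (hs : s = (dimH K).toReal) :
    (μH[s].restrict K) (badlyApproximable d) = 0 := by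
  obtain ⟨S, hSp, hS⟩ := build φ hsim π hπ
  have hspan := span_top φ hirr S hS
  obtain ⟨s0, hs0, hsum⟩ := S.exists_s0
  obtain ⟨U, hU1, hU2, hU3, hU4⟩ := hosc
  have hU : S.OSC U := by
    refine ⟨hU1, hU2, fun e x hx => ?_, fun e e' hne x hx y hy hxy => ?_⟩
    · rw [hS]
      exact hU3 e ⟨x, hx, rfl⟩
    · rw [hS, hS] at hxy
      exact Set.disjoint_left.1 (hU4 e e' hne) ⟨x, hx, rfl⟩ ⟨y, hy, hxy.symm⟩
  have hdim := S.le_dim hU hs0 hsum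
  rw [hSp, ← hK] at hdim
  have hfin : dimH K ≠ ⊤ := by
    have h1 : dimH K ≤ dimH (Set.univ : Set (EuclideanSpace ℝ (Fin d))) := dimH_mono (Set.subset_univ K)
    rw [Real.dimH_univ_eq_finrank] at h1
    exact ne_top_of_le_ne_top (by simp) h1
  have hss : s0 ≤ s := by
    have := ENNReal.toReal_mono hfin hdim
    rwa [ENNReal.toReal_ofReal hs0, ← hs] at this
  -- the key null set
  have hnull : μH[s] (K ∩ badlyApproximable d) = 0 := by
    have hsub : K ∩ badlyApproximable d ⊆ ⋃ n : ℕ, {x | ∃ b, x = S.pi b ∧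
        ∀ k, good (1 / ((n : ℝ) + 1)) (toMat (S.H (pre b k)))} := by
      rintro x ⟨hx, c, hc, hba⟩
      rw [hK, ← hSp] at hx
      obtain ⟨b, rfl⟩ := hx
      obtain ⟨ε, hε, hg⟩ := S.ba_good hd b c hc hba
      obtain ⟨n, hn⟩ := exists_nat_one_div_lt hε
      refine Set.mem_iUnion.2 ⟨n, b, rfl, fun k v hv => hn.le.trans (hg k v hv)⟩
    refine measure_mono_null hsub (measure_iUnion_null fun n => ?_)
    have h0 := S.alive_zero hd hspan (ε := 1 / ((n : ℝ) + 1)) (by positivity) hs0 hsum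
    exact le_antisymm ((Measure.hausdorffMeasure_mono hss _).trans h0.le) zero_le
  have hKm : MeasurableSet K := by
    letI : TopologicalSpace E := ⊥
    haveI : DiscreteTopology E := ⟨rfl⟩
    have hc : Continuous S.pi := by
      refine continuous_iff_continuousAt.2 fun b => Metric.tendsto_nhds.2 fun ε hε => ?_
      have h1 := (S.rr_pre_tendsto b).mul_const (2 * S.R0)
      rw [zero_mul] at h1
      obtain ⟨n, hn⟩ := (h1.eventually (gt_mem_nhds hε)).exists
      have h2 : ∀ᶠ b' : ℕ → E in 𝓝 b, ∀ i ∈ Finset.range n, b' i = b i := by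
        rw [Finset.eventually_all]
        intro i _
        have h3 : Tendsto (fun b' : ℕ → E => b' i) (𝓝 b) (𝓝 (b i)) := (continuous_apply i).tendsto b
        rw [nhds_discrete E] at h3
        exact tendsto_pure.1 h3
      filter_upwards [h2] with b' hb'
      have h4 : pre b' n = pre b n := by
        refine List.map_congr_left fun i hi => hb' i ?_
        simpa using hi
      rw [S.pi_pre b' n, h4]
      exact (S.near b n _ (S.pi_ball _)).trans_lt hn
    rw [hK, ← hSp]
    exact (isCompact_range hc).measurableSet
  rw [Measure.restrict_apply' hKm, Set.inter_comm]
  exact hnull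

end DriftBA

end

/-- **Theorem.** Let `K ⊆ ℝ^d` be the limit set (the range of the coding map `π`) of an
irreducible finite similarity IFS satisfying the open set condition, let `s = dim_H K`, and
let `μ_K = H^s|_K`.  Then `μ_K(BA) = 0`: `μ_K`-a.e. point is not badly approximable. -/
theorem hausdorff_measure_badlyApproximable_eq_zero
    (d : ℕ) (hd : 1 ≤ d) {E : Type*} [Fintype E] [Nonempty E]
    (φ : E → EuclideanSpace ℝ (Fin d) → EuclideanSpace ℝ (Fin d))
    (hsim : ∀ e, ContractingSimilarity (φ e))
    (hirr : IrreducibleIFS φ)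
    (hosc : OpenSetCondition φ)
    (π : (ℕ → E) → EuclideanSpace ℝ (Fin d))
    (hπ : ∀ (b : ℕ → E) (x₀ : EuclideanSpace ℝ (Fin d)),
      Tendsto (fun n => seqApply φ b n x₀) atTop (𝓝 (π b)))
    (K : Set (EuclideanSpace ℝ (Fin d))) (hK : K = Set.range π)
    (s : ℝ) (hs : s = (dimH K).toReal) :
    (μH[s].restrict K) (badlyApproximable d) = 0 := by
  exact DriftBA.main d hd φ hsim hirr hosc π hπ K hK s hs
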